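/- There exists a constant c > 0 such that the following holds. Let G be a finite abelian group, let C be a finite set of colors with 1 ≤ |C| ≤ c·log log log |G|, and let f : G × G × G → C be any coloring. Then there exist x, y, z ∈ G and d ∈ G with d ≠ 0 such that (x, y, z), (x+d, y, z), (x, y+d, z) and (x, y, z+d) all receive the same color under f. -/

import Mathlib

open Finset BigOperators

namespace Corners

/-- real indicator of a proposition -/
noncomputable def I (p : Prop) : ℝ := by classical exact if p then 1 else 0

lemma I_true {p : Prop} (h : p) : I p = 1 := by simp [I, h]
lemma I_false {p : Prop} (h : ¬ p) : I p = 0 := by simp [I, h]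
lemma I_nonneg (p : Prop) : 0 ≤ I p := by unfold I; split_ifs <;> norm_num
lemma I_le_one (p : Prop) : I p ≤ 1 := by unfold I; split_ifs <;> norm_num
lemma I_abs_le (p : Prop) : |I p| ≤ 1 := by
  rw [abs_of_nonneg (I_nonneg p)]; exact I_le_one p
lemma I_mul_self (p : Prop) : I p * I p = I p := by unfold I; split_ifs <;> norm_num
lemma I_and (p q : Prop) : I (p ∧ q) = I p * I q := by
  by_cases hp : p <;> by_cases hq : q <;> simp [I, hp, hq]
lemma I_not (p : Prop) : I (¬ p) = 1 - I p := by
  by_cases hp : p <;> simp [I, hp]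
lemma I_mono {p q : Prop} (h : p → q) : I p ≤ I q := by
  by_cases hp : p
  · rw [I_true hp, I_true (h hp)]
  · rw [I_false hp]; exact I_nonneg q

section exp
variable {α β : Type*} [Fintype α] [Fintype β]

lemma ex_le {f g : α → ℝ} (h : ∀ a, f a ≤ g a) : 𝔼 a, f a ≤ 𝔼 a, g a :=
  expect_le_expect (fun a _ => h a)
lemma ex_nonneg {f : α → ℝ} (h : ∀ a, 0 ≤ f a) : 0 ≤ 𝔼 a, f a :=
  expect_nonneg (fun a _ => h a)
lemma ex_const [Nonempty α] (c : ℝ) : 𝔼 _a : α, c = c := Fintype.expect_const c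
lemma ex_le_const [Nonempty α] {f : α → ℝ} {c : ℝ} (h : ∀ a, f a ≤ c) : 𝔼 a, f a ≤ c :=
  (ex_le h).trans_eq (ex_const c)
lemma const_le_ex [Nonempty α] {f : α → ℝ} {c : ℝ} (h : ∀ a, c ≤ f a) : c ≤ 𝔼 a, f a :=
  (ex_const c).symm.trans_le (ex_le h)
lemma ex_abs (f : α → ℝ) : |𝔼 a, f a| ≤ 𝔼 a, |f a| := by
  rw [abs_le]
  constructor
  · rw [← expect_neg_distrib]; exact ex_le (fun a => neg_abs_le _)
  · exact ex_le (fun a => le_abs_self _)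
lemma ex_abs_le [Nonempty α] {f : α → ℝ} {c : ℝ} (h : ∀ a, |f a| ≤ c) : |𝔼 a, f a| ≤ c :=
  (ex_abs f).trans (ex_le_const h)
lemma ex_abs_le' {f : α → ℝ} {c : ℝ} (hc : 0 ≤ c) (h : ∀ a, |f a| ≤ c) : |𝔼 a, f a| ≤ c := by
  cases isEmpty_or_nonempty α
  · simpa using hc
  · exact ex_abs_le h

lemma ex_cs (f g : α → ℝ) : (𝔼 a, f a * g a) ^ 2 ≤ (𝔼 a, f a ^ 2) * (𝔼 a, g a ^ 2) := by
  simp only [Fintype.expect_eq_sum_div_card]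
  rw [div_pow, div_mul_div_comm, ← pow_two]
  gcongr
  exact Finset.sum_mul_sq_le_sq_mul_sq _ _ _

lemma ex_sq_le (f : α → ℝ) : (𝔼 a, f a) ^ 2 ≤ 𝔼 a, f a ^ 2 := by
  cases isEmpty_or_nonempty α
  · simp
  have := ex_cs f (fun _ => 1)
  simpa using this

lemma exists_ge_of_ex [Nonempty α] {f : α → ℝ} {c : ℝ} (h : c ≤ 𝔼 a, f a) : ∃ a, c ≤ f a := by
  by_contra! hc
  have : 𝔼 a, f a < c := by
    have := Finset.expect_lt (s := univ) (f := f) (a := c) (fun x _ => (hc x).le)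
      ⟨Classical.arbitrary α, mem_univ _, hc _⟩
    simpa using this
  linarith

end exp

lemma pow_key {t Γ : ℝ} (ht : 0 ≤ t) (htG : t ≤ Γ) (m : ℕ) :
    t ^ m ≤ 2 ^ m + Γ ^ m * |t - 1| := by
  have hΓ : 0 ≤ Γ := ht.trans htG
  by_cases h : t ≤ 2
  · have := pow_le_pow_left₀ ht h m
    have : 0 ≤ Γ ^ m * |t - 1| := by positivity
    linarith
  · push Not at h
    have h1 : 1 ≤ |t - 1| := by rw [abs_of_nonneg (by linarith)]; linarith
    have h2 := pow_le_pow_left₀ ht htG m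
    have h3 : Γ ^ m * 1 ≤ Γ ^ m * |t - 1| := by gcongr
    have : (0:ℝ) ≤ 2 ^ m := by positivity
    linarith

/-- Tangent line inequality. -/
lemma tangent {t l : ℝ} (ht : 0 ≤ t) (hl : 0 < l) (m : ℕ) :
    l ^ m + m * l ^ (m - 1) * (t - l) ≤ t ^ m := by
  have h := one_add_mul_le_pow (a := t / l - 1) (by have : 0 ≤ t / l := by positivity
                                                    linarith) m
  cases m with
  | zero => simp
  | succ k =>
    have h2 : l ^ (k+1) * (1 + ((k+1 : ℕ) : ℝ) * (t / l - 1)) ≤ l ^ (k+1) * (1 + (t / l - 1)) ^ (k+1) := by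
      gcongr
    have e1 : l ^ (k+1) * (1 + (t / l - 1)) ^ (k+1) = t ^ (k+1) := by
      rw [← mul_pow]; congr 1; field_simp; ring
    rw [e1] at h2
    refine le_trans (le_of_eq ?_) h2
    simp only [Nat.add_sub_cancel]
    field_simp
    ring

/-! ### Cut norm -/
section cut
variable {X Z : Type*} [Fintype X] [Fintype Z]

def Cut (s : X → Z → ℝ) (ε : ℝ) : Prop :=
  ∀ (a : X → ℝ) (b : Z → ℝ), (∀ x, |a x| ≤ 1) → (∀ z, |b z| ≤ 1) →
    |𝔼 x, 𝔼 z, s x z * (a x * b z)| ≤ ε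

def Good (φ : X → Z → ℝ) (R : ℝ) : Prop :=
  0 ≤ R ∧ ∀ s ε, Cut s ε → Cut (fun x z => s x z * φ x z) (R * ε)

lemma Cut.nonneg {s : X → Z → ℝ} {ε : ℝ} (h : Cut s ε) : 0 ≤ ε :=
  (abs_nonneg _).trans (h 0 0 (by simp) (by simp))

lemma Cut.scaled {s : X → Z → ℝ} {ε : ℝ} (h : Cut s ε) {A B : ℝ} (hA : 0 ≤ A) (hB : 0 ≤ B)
    {a : X → ℝ} {b : Z → ℝ} (ha : ∀ x, |a x| ≤ A) (hb : ∀ z, |b z| ≤ B) :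
    |𝔼 x, 𝔼 z, s x z * (a x * b z)| ≤ A * B * ε := by
  rcases hA.eq_or_lt with rfl | hA'
  · have : ∀ x, a x = 0 := fun x => by simpa using ha x
    simp [this]
  rcases hB.eq_or_lt with rfl | hB'
  · have : ∀ x, b x = 0 := fun x => by simpa using hb x
    simp [this]
  have := h (fun x => a x / A) (fun z => b z / B)
    (fun x => by rw [abs_div, abs_of_pos hA', div_le_one hA']; exact ha x)
    (fun z => by rw [abs_div, abs_of_pos hB', div_le_one hB']; exact hb z)
  have e : 𝔼 x, 𝔼 z, s x z * (a x * b z) =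
      A * B * 𝔼 x, 𝔼 z, s x z * (a x / A * (b z / B)) := by
    simp only [mul_expect]
    congr! 2 with x _ z _
    field_simp
  rw [e, abs_mul, abs_of_pos (by positivity)]
  gcongr

lemma Good.prod {a : X → ℝ} {b : Z → ℝ} {A B : ℝ} (hA : 0 ≤ A) (hB : 0 ≤ B)
    (ha : ∀ x, |a x| ≤ A) (hb : ∀ z, |b z| ≤ B) : Good (fun x z => a x * b z) (A * B) := by
  refine ⟨by positivity, fun s ε hs a' b' ha' hb' => ?_⟩
  have := hs.scaled (a := fun x => a x * a' x) (b := fun z => b z * b' z) hA hB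
    (fun x => by rw [abs_mul]; nlinarith [ha x, ha' x, abs_nonneg (a x), abs_nonneg (a' x)])
    (fun x => by rw [abs_mul]; nlinarith [hb x, hb' x, abs_nonneg (b x), abs_nonneg (b' x)])
  convert this using 2
  congr! 2 with x _ z _
  ring_nf

lemma Good.mul {φ ψ : X → Z → ℝ} {R R' : ℝ} (h : Good φ R) (h' : Good ψ R') :
    Good (fun x z => φ x z * ψ x z) (R * R') := by
  refine ⟨mul_nonneg h.1 h'.1, fun s ε hs => ?_⟩
  have := h'.2 _ _ (h.2 s ε hs)
  convert this using 1
  · funext x z; ring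
  · ring

lemma Good.one : Good (fun (_ : X) (_ : Z) => (1:ℝ)) 1 := by
  refine ⟨by norm_num, fun s ε hs => by simpa using hs⟩

lemma Good.pow {φ : X → Z → ℝ} {R : ℝ} (h : Good φ R) (n : ℕ) :
    Good (fun x z => φ x z ^ n) (R ^ n) := by
  induction n with
  | zero => simpa using Good.one
  | succ n ih => simpa [pow_succ] using ih.mul h

lemma Good.add {φ ψ : X → Z → ℝ} {R R' : ℝ} (h : Good φ R) (h' : Good ψ R') :
    Good (fun x z => φ x z + ψ x z) (R + R') := by
  refine ⟨add_nonneg h.1 h'.1, fun s ε hs a b ha hb => ?_⟩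
  have h1 := h.2 s ε hs a b ha hb
  have h2 := h'.2 s ε hs a b ha hb
  simp only [mul_add, add_mul, expect_add_distrib]
  exact (abs_add_le _ _).trans (by linarith)

lemma Good.neg {φ : X → Z → ℝ} {R : ℝ} (h : Good φ R) :
    Good (fun x z => - φ x z) R := by
  refine ⟨h.1, fun s ε hs a b ha hb => ?_⟩
  have h1 := h.2 s ε hs a b ha hb
  simpa only [mul_neg, neg_mul, expect_neg_distrib, abs_neg] using h1

lemma Good.expect {ι : Type*} [Fintype ι] {φ : ι → X → Z → ℝ} {R : ℝ} (hR : 0 ≤ R)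
    (h : ∀ i, Good (φ i) R) :
    Good (fun x z => 𝔼 i, φ i x z) R := by
  refine ⟨hR, fun s ε hs a b ha hb => ?_⟩
  have e : 𝔼 x, 𝔼 z, s x z * (𝔼 i, φ i x z) * (a x * b z)
      = 𝔼 i, 𝔼 x, 𝔼 z, s x z * φ i x z * (a x * b z) := by
    simp only [mul_expect, expect_mul]
    symm
    rw [expect_comm]
    congr! 2 with x _
    rw [expect_comm]
  rw [e]
  exact ex_abs_le' (mul_nonneg hR hs.nonneg) (fun i => (h i).2 s ε hs a b ha hb)

lemma Good.bound {φ : X → Z → ℝ} {R : ℝ} (h : Good φ R) {s : X → Z → ℝ} {ε : ℝ} (hs : Cut s ε) :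
    |𝔼 x, 𝔼 z, s x z * φ x z| ≤ R * ε := by
  have := h.2 s ε hs 1 1 (by simp) (by simp)
  simpa using this

end cut
end Corners

open Finset BigOperators

namespace Corners

structure Gr {X Z : Type*} [Fintype X] [Fintype Z] (f s : X → Z → ℝ) (K Γ ε η : ℝ) : Prop where
  f0 : ∀ x z, 0 ≤ f x z
  fK : ∀ x z, f x z ≤ K * s x z
  s0 : ∀ x z, 0 ≤ s x z
  sG : ∀ x z, s x z ≤ Γ
  cut : Cut (fun x z => s x z - 1) ε
  mean : 𝔼 x, 𝔼 z, f x z = 1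
  NI : ∀ (X' : X → Prop) (Z' : Z → Prop), η ≤ 𝔼 x, I (X' x) → η ≤ 𝔼 z, I (Z' z) →
    𝔼 x, 𝔼 z, f x z * (I (X' x) * I (Z' z)) ≤ (1 + 1/10000) * ((𝔼 x, I (X' x)) * 𝔼 z, I (Z' z))
  K1 : 1 ≤ K
  G1 : 1 ≤ Γ
  η0 : 0 < η
  η1 : η ≤ 1

section
variable {X Y Z : Type*} [Fintype X] [Fintype Y] [Fintype Z]
  {f s : X → Z → ℝ} {K Γ ε η : ℝ}

lemma Cut.swap {s : X → Z → ℝ} (h : Cut s ε) : Cut (fun z x => s x z) ε := by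
  intro a b ha hb
  rw [expect_comm]
  have := h b a hb ha
  convert this using 2
  congr! 2 with x _ z _
  ring_nf

lemma Gr.swap (h : Gr f s K Γ ε η) : Gr (fun z x => f x z) (fun z x => s x z) K Γ ε η where
  f0 := fun x z => h.f0 z x
  fK := fun x z => h.fK z x
  s0 := fun x z => h.s0 z x
  sG := fun x z => h.sG z x
  cut := h.cut.swap
  mean := by rw [expect_comm]; exact h.mean
  NI := by
    intro X' Z' h1 h2
    have := h.NI Z' X' h2 h1
    rw [expect_comm, mul_comm (𝔼 x, I (X' x))]
    convert this using 2
    congr! 2 with x _ z _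
    ring
  K1 := h.K1
  G1 := h.G1
  η0 := h.η0
  η1 := h.η1

lemma Gr.nX (h : Gr f s K Γ ε η) : Nonempty X := by
  by_contra hc
  rw [not_nonempty_iff] at hc
  have := h.mean
  simp at this

lemma Gr.nZ (h : Gr f s K Γ ε η) : Nonempty Z := h.swap.nX

lemma Gr.ε0 (h : Gr f s K Γ ε η) : 0 ≤ ε := h.cut.nonneg

lemma Gr.f_le (h : Gr f s K Γ ε η) (x : X) (z : Z) : f x z ≤ K * Γ :=
  (h.fK x z).trans (by have := h.sG x z; have := h.K1; gcongr)

/-- transference of nonnegative good functions -/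
lemma Gr.transfer (h : Gr f s K Γ ε η) {φ : X → Z → ℝ} {R : ℝ} (hφ : Good φ R)
    (h0 : ∀ x z, 0 ≤ φ x z) :
    𝔼 x, 𝔼 z, f x z * φ x z ≤ K * ((𝔼 x, 𝔼 z, φ x z) + R * ε) := by
  have h1 : 𝔼 x, 𝔼 z, f x z * φ x z ≤ K * 𝔼 x, 𝔼 z, s x z * φ x z := by
    simp only [mul_expect]
    refine ex_le fun x => ex_le fun z => ?_
    rw [← mul_assoc]
    exact mul_le_mul_of_nonneg_right (h.fK x z) (h0 x z)
  have h2 := (abs_le.1 (hφ.bound h.cut)).2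
  have e : 𝔼 x, 𝔼 z, (s x z - 1) * φ x z = (𝔼 x, 𝔼 z, s x z * φ x z) - 𝔼 x, 𝔼 z, φ x z := by
    simp only [sub_mul, one_mul, expect_sub_distrib]
  rw [e] at h2
  refine h1.trans ?_
  have := h.K1
  gcongr
  linarith

lemma P_nonneg (p : Z → Prop) : 0 ≤ 𝔼 z, I (p z) := ex_nonneg fun _ => I_nonneg _
lemma P_le_one (p : Z → Prop) : 𝔼 z, I (p z) ≤ 1 := by
  cases isEmpty_or_nonempty Z
  · simp
  · exact ex_le_const fun _ => I_le_one _

lemma Gr.maj (h : Gr f s K Γ ε η) (Z' : Z → Prop) :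
    𝔼 x, 𝔼 z, f x z * I (Z' z) ≤ K * ((𝔼 z, I (Z' z)) + ε) := by
  have := h.nX
  have hg : Good (fun (_ : X) z => (1:ℝ) * I (Z' z)) (1 * 1) :=
    Good.prod (by norm_num) (by norm_num) (by simp) (fun z => I_abs_le _)
  have := h.transfer hg (fun x z => by simpa using I_nonneg _)
  simpa using this

lemma Gr.up (h : Gr f s K Γ ε η) (Z' : Z → Prop) :
    𝔼 x, 𝔼 z, f x z * I (Z' z) ≤ (1 + 1/10000) * (𝔼 z, I (Z' z)) + K * (η + ε) := by
  have := h.nX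
  have hp := P_nonneg Z'
  have hK := h.K1
  have hη := h.η0
  have hε := h.ε0
  by_cases hc : η ≤ 𝔼 z, I (Z' z)
  · have := h.NI (fun _ => True) Z' (by simpa [I] using h.η1) hc
    simp only [I_true trivial, ex_const, one_mul] at this
    have : 0 ≤ K * (η + ε) := by positivity
    linarith
  · push Not at hc
    have h1 := h.maj Z'
    have : K * ((𝔼 z, I (Z' z)) + ε) ≤ K * (η + ε) := by gcongr
    linarith

/-- column degree minus one -/
noncomputable def dg (f : X → Z → ℝ) (z : Z) : ℝ := (𝔼 x, f x z) - 1

lemma ex_dg (f : X → Z → ℝ) (b : Z → ℝ) :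
    𝔼 x, 𝔼 z, f x z * b z = 𝔼 z, (1 + dg f z) * b z := by
  rw [expect_comm]
  congr! 2 with z _
  rw [← expect_mul]; unfold dg; ring

lemma Gr.dg_ge (h : Gr f s K Γ ε η) (z : Z) : 0 ≤ 1 + dg f z := by
  unfold dg
  have : 0 ≤ 𝔼 x, f x z := ex_nonneg fun x => h.f0 x z
  linarith

lemma Gr.lowdeg (h : Gr f s K Γ ε η) (hμ : K * (η + ε) ≤ 5/100000) :
    𝔼 z, I (¬ (-(1/400) ≤ dg f z)) ≤ 1/16 := by
  have := h.nZ
  have := h.nX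
  set V : Z → Prop := fun z => -(1/400) ≤ dg f z
  have h1 := h.up V
  have h2 : 𝔼 x, 𝔼 z, f x z * I (¬ V z) ≤ (1 - 1/400) * 𝔼 z, I (¬ V z) := by
    rw [ex_dg, mul_expect]
    refine ex_le fun z => ?_
    by_cases hv : V z
    · rw [I_false (not_not.2 hv)]; simp
    · rw [I_true hv]; simp only [V] at hv; push Not at hv; linarith
  have h3 : (𝔼 x, 𝔼 z, f x z * I (V z)) + 𝔼 x, 𝔼 z, f x z * I (¬ V z) = 1 := by
    rw [← h.mean]
    simp only [← expect_add_distrib, I_not]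
    congr! 2 with x _ z _
    ring_nf
  have h4 : 𝔼 z, I (V z) = 1 - 𝔼 z, I (¬ V z) := by
    simp only [I_not, expect_sub_distrib, ex_const]; ring
  rw [h4] at h1
  have := P_nonneg (fun z => ¬ V z)
  linarith

lemma Gr.highdeg (h : Gr f s K Γ ε η) {t : ℝ} (ht : 1/10000 < t) :
    𝔼 z, I (t < dg f z) ≤ η := by
  have := h.nX
  by_contra! hc
  have h1 := h.NI (fun _ => True) (fun z => t < dg f z) (by simpa [I] using h.η1) hc.le
  simp only [I_true trivial, ex_const, one_mul] at h1
  rw [ex_dg] at h1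
  have h2 : (1 + t) * 𝔼 z, I (t < dg f z) ≤ 𝔼 z, (1 + dg f z) * I (t < dg f z) := by
    rw [mul_expect]
    refine ex_le fun z => ?_
    by_cases hv : t < dg f z
    · rw [I_true hv]; linarith
    · rw [I_false hv]; simp
  have := h.η0
  nlinarith

lemma Cut.abs_le {s : X → Z → ℝ} (h : Cut (fun x z => s x z - 1) ε) {A : ℝ} (hA : 0 ≤ A) {a : X → ℝ}
    (ha : ∀ x, |a x| ≤ A) : 𝔼 z, |𝔼 x, (s x z - 1) * a x| ≤ A * ε := by
  have h1 := h.scaled hA zero_le_one (a := a) (b := fun z => SignType.sign (𝔼 x, (s x z - 1) * a x)) ha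
    (fun z => by
      rcases lt_trichotomy (𝔼 x, (s x z - 1) * a x) 0 with h | h | h <;> simp [h])
  rw [expect_comm] at h1
  have h2 := (_root_.abs_le.1 h1).2
  refine le_trans (le_of_eq ?_) (h2.trans (by simp))
  congr! 2 with z _
  simp only [← mul_assoc]
  rw [← expect_mul]
  exact (self_mul_sign _).symm

lemma Gr.powdeg (h : Gr f s K Γ ε η) (p : ℕ) (V : Z → Prop) :
    𝔼 z, I (V z) * (𝔼 x, f x z) ^ p ≤ K ^ p * (2 ^ p * (𝔼 z, I (V z)) + Γ ^ p * ε) := by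
  have := h.nX
  have hK := h.K1
  have hG := h.G1
  have h1 : ∀ z, I (V z) * (𝔼 x, f x z) ^ p ≤
      K ^ p * (2 ^ p * I (V z) + Γ ^ p * |(𝔼 x, s x z) - 1|) := by
    intro z
    by_cases hv : V z
    · rw [I_true hv, one_mul, mul_one]
      have h0 : 0 ≤ 𝔼 x, s x z := ex_nonneg fun x => h.s0 x z
      have h1 : 𝔼 x, f x z ≤ K * 𝔼 x, s x z := by
        rw [mul_expect]; exact ex_le fun x => h.fK x z
      have h2 := pow_le_pow_left₀ (ex_nonneg fun x => h.f0 x z) h1 p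
      rw [mul_pow] at h2
      refine h2.trans ?_
      gcongr
      exact pow_key h0 (ex_le_const fun x => h.sG x z) p
    · rw [I_false hv]
      simp only [zero_mul, mul_zero, zero_add]
      positivity
  refine (ex_le h1).trans ?_
  rw [← mul_expect, expect_add_distrib, ← mul_expect, ← mul_expect]
  have h2 := h.cut.abs_le (a := fun _ => 1) zero_le_one (by simp)
  simp only [mul_one, expect_sub_distrib, ex_const, one_mul] at h2
  gcongr

/-- p-th moment of the degree deviation on valid vertices -/
lemma Gr.momdeg (h : Gr f s K Γ ε η) {p : ℕ} (hp : Even p) :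
    𝔼 z, I (-(1/400) ≤ dg f z) * dg f z ^ p ≤
      (1/400) ^ p + K ^ p * (2 ^ p * η + Γ ^ p * ε) := by
  have := h.nZ
  have hK := h.K1
  have hG := h.G1
  have h1 : ∀ z, I (-(1/400) ≤ dg f z) * dg f z ^ p ≤
      (1/400) ^ p + I (1/400 < dg f z) * (𝔼 x, f x z) ^ p := by
    intro z
    have h0 : 0 ≤ 𝔼 x, f x z := ex_nonneg fun x => h.f0 x z
    by_cases hv : -(1/400) ≤ dg f z
    · rw [I_true hv, one_mul]
      by_cases hw : 1/400 < dg f z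
      · rw [I_true hw, one_mul]
        have : dg f z ^ p ≤ (𝔼 x, f x z) ^ p :=
          pow_le_pow_left₀ (by linarith) (by unfold dg; linarith) p
        have : (0:ℝ) ≤ (1/400) ^ p := by positivity
        linarith
      · rw [I_false hw, zero_mul, add_zero, ← hp.pow_abs]
        exact pow_le_pow_left₀ (abs_nonneg _) (abs_le.2 ⟨hv, not_lt.1 hw⟩) p
    · rw [I_false hv, zero_mul]
      have := I_nonneg (1/400 < dg f z)
      positivity
  refine (ex_le h1).trans ?_
  rw [expect_add_distrib, ex_const]
  gcongr
  refine (h.powdeg p _).trans ?_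
  have := h.highdeg (t := 1/400) (by norm_num)
  gcongr

end
end Corners

open Finset BigOperators

namespace Corners
section
variable {X Y Z : Type*} [Fintype X] [Fintype Y] [Fintype Z]

lemma moment (H : X → Y → ℝ) (F : X → Z → ℝ) (p : ℕ) :
    𝔼 y, 𝔼 z, (𝔼 x, H x y * F x z) ^ p =
      𝔼 v : Fin p → X, (𝔼 y, ∏ i, H (v i) y) * (𝔼 z, ∏ i, F (v i) z) := by
  have e : ∀ y z, (𝔼 x, H x y * F x z) ^ p = 𝔼 v : Fin p → X, (∏ i, H (v i) y) * ∏ i, F (v i) z := by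
    intro y z
    rw [expect_pow, Fintype.piFinset_univ]
    simp only [prod_mul_distrib]
  simp only [e, expect_mul_expect]
  symm
  rw [expect_comm]
  congr! 2 with y _
  rw [expect_comm]

/-- codegree -/
noncomputable def UU (F : X → Z → ℝ) (z z' : Z) : ℝ := 𝔼 x, F x z * F x z'

lemma moment_nonneg (F : X → Z → ℝ) (p : ℕ) : 0 ≤ 𝔼 z, 𝔼 z', UU F z z' ^ p := by
  unfold UU
  rw [moment]
  exact ex_nonneg fun v => mul_self_nonneg _

lemma moment_cs (H : X → Y → ℝ) (F : X → Z → ℝ) (p : ℕ) :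
    (𝔼 y, 𝔼 z, (𝔼 x, H x y * F x z) ^ p) ^ 2 ≤
      (𝔼 y, 𝔼 y', UU H y y' ^ p) * (𝔼 z, 𝔼 z', UU F z z' ^ p) := by
  unfold UU
  simp only [moment]
  refine (ex_cs _ _).trans (le_of_eq ?_)
  simp only [pow_two]

lemma choose_big (p : ℕ) (hp : 1 ≤ p) : (24:ℝ) ^ p ≤ (25 * p + 1).choose p := by
  have h := Nat.pow_le_choose (α := ℝ) p (25 * p + 1)
  refine le_trans ?_ h
  rw [le_div_iff₀ (by positivity)]
  have h1 : ((p.factorial : ℕ) : ℝ) ≤ (p:ℝ) ^ p := by exact_mod_cast Nat.factorial_le_pow p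
  have h2 : ((25 * p + 1 + 1 - p : ℕ) : ℝ) = 24 * p + 2 := by
    rw [show 25 * p + 1 + 1 - p = 24 * p + 2 by omega]; push_cast; ring
  calc (24:ℝ) ^ p * p.factorial ≤ 24 ^ p * p ^ p := by gcongr
    _ = (24 * p) ^ p := by rw [mul_pow]
    _ ≤ _ := by rw [h2]; gcongr; linarith

lemma num_aux (p : ℕ) (hp : 2 ≤ p) : (1 + 1/100 : ℝ) ^ (25 * p + 1) + 1 ≤ 2 ^ p := by
  have h : (1 + 1/100 : ℝ) ^ (25 * p + 1) ≤ (13/10) ^ p * (1 + 1/100) := by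
    rw [pow_succ, pow_mul]
    have h25 : (1 + 1/100 : ℝ) ^ 25 ≤ 13/10 := by norm_num
    exact mul_le_mul_of_nonneg_right (pow_le_pow_left₀ (by positivity) h25 p) (by norm_num)
  have h2 : ((13/10) ^ p * (1 + 1/100) + 1 : ℝ) ≤ 2 ^ p := by
    clear h
    induction p, hp using Nat.le_induction with
    | base => norm_num
    | succ n hn ih =>
      rw [pow_succ, pow_succ]
      have : (0:ℝ) ≤ (13/10) ^ n := by positivity
      linarith
  linarith

/-- Steps four and five, first half. -/
lemma bigU [Nonempty Z] (F : X → Z → ℝ) {p : ℕ} (hp2 : 2 ≤ p) (hp : Even p)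
    (h : (1/12 : ℝ) ^ p ≤ 𝔼 z, 𝔼 z', UU F z z' ^ p) :
    1 ≤ 𝔼 z, 𝔼 z', I (1/100 ≤ UU F z z') * (1 + UU F z z') ^ (25 * p + 1) := by
  set q := 25 * p + 1 with hq
  have hqo : Odd q := by
    rw [hq]; exact ((hp.mul_left 25)).add_one
  have h1 : (2:ℝ) ^ p ≤ 𝔼 z, 𝔼 z', (1 + UU F z z') ^ q := by
    have e : 𝔼 z, 𝔼 z', (1 + UU F z z') ^ q =
        ∑ j ∈ range (q + 1), (q.choose j : ℝ) * 𝔼 z, 𝔼 z', UU F z z' ^ j := by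
      simp only [add_comm (1:ℝ), add_pow, one_pow, mul_one, mul_expect]
      simp only [expect_sum_comm]
      refine sum_congr rfl fun j _ => expect_congr rfl fun z _ => expect_congr rfl fun z' _ => ?_
      ring
    rw [e]
    have h3 : (q.choose p : ℝ) * 𝔼 z, 𝔼 z', UU F z z' ^ p ≤
        ∑ j ∈ range (q + 1), (q.choose j : ℝ) * 𝔼 z, 𝔼 z', UU F z z' ^ j :=
      single_le_sum (f := fun j => (q.choose j : ℝ) * 𝔼 z, 𝔼 z', UU F z z' ^ j)
        (fun j _ => mul_nonneg (by positivity) (moment_nonneg F j))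
        (mem_range.2 (by omega))
    refine le_trans ?_ h3
    have h4 := choose_big p (by omega)
    calc (2:ℝ) ^ p = 24 ^ p * (1/12) ^ p := by rw [← mul_pow]; norm_num
      _ ≤ _ := by gcongr
  have h2 : 𝔼 z, 𝔼 z', (1 + UU F z z') ^ q ≤
      (𝔼 z, 𝔼 z', I (1/100 ≤ UU F z z') * (1 + UU F z z') ^ q) + (1 + 1/100) ^ q := by
    have : ∀ z z', (1 + UU F z z') ^ q ≤
        I (1/100 ≤ UU F z z') * (1 + UU F z z') ^ q + (1 + 1/100) ^ q := by
      intro z z'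
      by_cases hv : 1/100 ≤ UU F z z'
      · rw [I_true hv, one_mul]
        have : (0:ℝ) ≤ (1 + 1/100) ^ q := by positivity
        linarith
      · rw [I_false hv, zero_mul, zero_add]
        exact hqo.strictMono_pow.monotone (by linarith)
    refine (ex_le fun z => ex_le fun z' => this z z').trans ?_
    simp only [expect_add_distrib, ex_const]
    exact le_rfl
  have := num_aux p hp2
  linarith

variable {f s : X → Z → ℝ} {K Γ ε η : ℝ}

noncomputable def Ft (f : X → Z → ℝ) (x : X) (z : Z) : ℝ := I (-(1/400) ≤ dg f z) * (f x z - 1)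

lemma UU_Ft [Nonempty X] (f : X → Z → ℝ) (z z' : Z) :
    UU (Ft f) z z' = I (-(1/400) ≤ dg f z) * I (-(1/400) ≤ dg f z') *
      (UU f z z' - 1 - dg f z - dg f z') := by
  have e : UU f z z' - 1 - dg f z - dg f z' = 𝔼 x, (f x z - 1) * (f x z' - 1) := by
    unfold UU dg
    simp only [sub_mul, mul_sub, one_mul, mul_one, expect_sub_distrib, ex_const]
    ring
  rw [e, mul_expect]
  unfold UU Ft
  refine expect_congr rfl fun x _ => ?_
  ring

lemma D_prop [Nonempty X] {f : X → Z → ℝ} {z z' : Z} (h : 1/100 ≤ UU (Ft f) z z') :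
    1 + 1/200 ≤ UU f z z' ∧ 1 + UU (Ft f) z z' ≤ 2 * UU f z z' := by
  rw [UU_Ft] at h ⊢
  by_cases h1 : -(1/400) ≤ dg f z
  · by_cases h2 : -(1/400) ≤ dg f z'
    · rw [I_true h1, I_true h2] at h ⊢
      constructor <;> linarith
    · rw [I_false h2] at h; norm_num at h
  · rw [I_false h1] at h; norm_num at h

/-- Step five, second half: density of D. -/
lemma Gr.densD (h : Gr f s K Γ ε η) {q : ℕ}
    (hq : 1 ≤ 𝔼 z, 𝔼 z', I (1/100 ≤ UU (Ft f) z z') * (1 + UU (Ft f) z z') ^ q)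
    (hε : (2 * K ^ 2) ^ q * (Γ ^ 2) ^ q * ((Γ + 1) * ε) ≤ 1/2) :
    (1/2) * (1 / (4 * K ^ 2)) ^ q ≤ 𝔼 z, 𝔼 z', I (1/100 ≤ UU (Ft f) z z') := by
  have := h.nX
  have hn := h.nZ
  have hK := h.K1
  have hG := h.G1
  have h1 : ∀ z z', I (1/100 ≤ UU (Ft f) z z') * (1 + UU (Ft f) z z') ^ q ≤
      (2 * K ^ 2) ^ q * (2 ^ q * I (1/100 ≤ UU (Ft f) z z') +
        (Γ ^ 2) ^ q * (|𝔼 x, (s x z' - 1) * s x z| + |(𝔼 x, s x z) - 1|)) := by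
    intro z z'
    by_cases hv : 1/100 ≤ UU (Ft f) z z'
    · rw [I_true hv, one_mul, mul_one]
      have h2 := (D_prop hv).2
      have h3 : UU f z z' ≤ K ^ 2 * UU s z z' := by
        unfold UU; rw [mul_expect]
        refine ex_le fun x => ?_
        calc f x z * f x z' ≤ (K * s x z) * (K * s x z') :=
              mul_le_mul (h.fK x z) (h.fK x z') (h.f0 x z')
                (mul_nonneg (by linarith) (h.s0 x z))
          _ = _ := by ring
      have h4 : (1 + UU (Ft f) z z') ^ q ≤ (2 * K ^ 2) ^ q * UU s z z' ^ q := by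
        rw [← mul_pow]
        exact pow_le_pow_left₀ (by linarith) (by linarith) q
      refine h4.trans ?_
      have hs0 : 0 ≤ UU s z z' := ex_nonneg fun x => mul_nonneg (h.s0 _ _) (h.s0 _ _)
      have hs1 : UU s z z' ≤ Γ ^ 2 := ex_le_const fun x => by
        rw [pow_two]; exact mul_le_mul (h.sG _ _) (h.sG _ _) (h.s0 _ _) (by linarith)
      have h5 := pow_key hs0 hs1 q
      have h6 : |UU s z z' - 1| ≤ |𝔼 x, (s x z' - 1) * s x z| + |(𝔼 x, s x z) - 1| := by
        have : UU s z z' - 1 = (𝔼 x, (s x z' - 1) * s x z) + ((𝔼 x, s x z) - 1) := by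
          have e2 : 𝔼 x, (s x z' - 1) * s x z = 𝔼 x, (s x z * s x z' - s x z) :=
            expect_congr rfl fun x _ => by ring
          rw [e2, expect_sub_distrib]; unfold UU; ring
        rw [this]; exact abs_add_le _ _
      have h7 : (Γ ^ 2) ^ q * |UU s z z' - 1| ≤
          (Γ ^ 2) ^ q * (|𝔼 x, (s x z' - 1) * s x z| + |(𝔼 x, s x z) - 1|) := by gcongr
      gcongr
      linarith
    · rw [I_false hv, zero_mul]; positivity
  have h2 := hq.trans (ex_le fun z => ex_le fun z' => h1 z z')
  simp only [← mul_expect, expect_add_distrib, ex_const] at h2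
  have h3 : 𝔼 z, 𝔼 z', |𝔼 x, (s x z' - 1) * s x z| ≤ Γ * ε :=
    ex_le_const fun z => h.cut.abs_le (by linarith)
      (fun x => by rw [abs_of_nonneg (h.s0 _ _)]; exact h.sG _ _)
  have h4 := h.cut.abs_le (a := fun _ => 1) zero_le_one (by simp)
  simp only [mul_one, expect_sub_distrib, ex_const, one_mul] at h4
  set π := 𝔼 z, 𝔼 z', I (1/100 ≤ UU (Ft f) z z')
  have h5 : (2 * K ^ 2) ^ q * ((Γ ^ 2) ^ q * ((𝔼 z, 𝔼 z', |𝔼 x, (s x z' - 1) * s x z|) +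
      𝔼 z, |(𝔼 x, s x z) - 1|)) ≤ (2 * K ^ 2) ^ q * ((Γ ^ 2) ^ q * ((Γ + 1) * ε)) := by
    gcongr; linarith
  have h6 : 1/2 ≤ (4 * K ^ 2) ^ q * π := by
    have : (4 * K ^ 2) ^ q = (2 * K ^ 2) ^ q * 2 ^ q := by rw [← mul_pow]; ring_nf
    rw [this]; linarith
  rw [one_div_pow, ← div_eq_mul_one_div, div_le_iff₀ (by positivity)]
  linarith

end
end Corners

open Finset BigOperators

namespace Corners
section
variable {X Y Z : Type*} [Fintype X] [Fintype Y] [Fintype Z]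
variable {f s : X → Z → ℝ} {K Γ ε η : ℝ}

set_option maxHeartbeats 1600000 in
lemma Gr.final (h : Gr f s K Γ ε η) (D : Z → Z → Prop) {π : ℝ} {m : ℕ} (hm : 1 ≤ m)
    (hD : ∀ z z', D z z' → 1 + 1/200 ≤ UU f z z') (hπ : 0 < π)
    (hDπ : π ≤ 𝔼 z, 𝔼 z', I (D z z'))
    (n2 : K * (η + ε) ≤ π / 2000)
    (n3 : 3 * K * (1 + 1/800) ^ m ≤ (1 + 1/400) ^ m)
    (n4 : (K * Γ * (2 / π)) ^ m * ε ≤ π / 2)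
    (n5 : η ≤ π / 2) (n5' : η ≤ (1/4) * (1 / (2 * K)) ^ m)
    (n6 : K ^ m * (Γ ^ m * ((2 / π) * ε)) ≤ 1/4) : False := by
  have hX := h.nX
  have hZ := h.nZ
  have hK := h.K1
  have hG := h.G1
  have hε := h.ε0
  have hη := h.η0
  set Pz : Z → ℝ := fun z => 𝔼 z', I (D z z') with hPz
  have Pz0 : ∀ z, 0 ≤ Pz z := fun z => P_nonneg _
  have Pz1 : ∀ z, Pz z ≤ 1 := fun z => P_le_one _
  set W : Z → ℝ := fun z => I (π / 2 ≤ Pz z) with hW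
  set δ : Z → ℝ := fun z => W z * Pz z with hδ
  have δ0 : ∀ z, 0 ≤ δ z := fun z => mul_nonneg (I_nonneg _) (Pz0 z)
  have δ1 : ∀ z, δ z ≤ 1 := fun z => mul_le_one₀ (I_le_one _) (Pz0 z) (Pz1 z)
  set d : X → Z → ℝ := fun x z => 𝔼 z', f x z' * (W z * (Pz z)⁻¹ * I (D z z')) with hd
  have d0 : ∀ x z, 0 ≤ d x z := fun x z => ex_nonneg fun z' =>
    mul_nonneg (h.f0 _ _) (mul_nonneg (mul_nonneg (I_nonneg _) (inv_nonneg.2 (Pz0 z))) (I_nonneg _))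
  set Δ := 𝔼 z, δ z with hΔ
  have hΔ0 : π / 2 ≤ Δ := by
    have : 𝔼 z, Pz z ≤ 𝔼 z, (δ z + π / 2) := ex_le fun z => by
      simp only [hδ, hW]
      by_cases hz : π / 2 ≤ Pz z
      · rw [I_true hz]; linarith
      · rw [I_false hz]; linarith
    rw [expect_add_distrib, ex_const] at this
    linarith
  have hΔp : 0 < Δ := by linarith
  have δd : ∀ x z, δ z * d x z = W z * 𝔼 z', f x z' * I (D z z') := by
    intro x z
    simp only [hδ, hd, hW]
    by_cases hz : π / 2 ≤ Pz z
    · have : Pz z ≠ 0 := by linarith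
      simp only [I_true hz, one_mul]; rw [mul_expect]
      apply expect_congr rfl
      intro z' _
      field_simp
    · rw [I_false hz]; simp
  -- (i)
  have i1 : (1 + 1/200) * Δ ≤ 𝔼 x, 𝔼 z, f x z * δ z * d x z := by
    have e : 𝔼 x, 𝔼 z, f x z * δ z * d x z = 𝔼 z, W z * 𝔼 z', I (D z z') * UU f z z' := by
      rw [expect_comm]
      refine expect_congr rfl fun z _ => ?_
      have : ∀ x, f x z * δ z * d x z = W z * 𝔼 z', I (D z z') * (f x z * f x z') := by
        intro x
        rw [mul_assoc, δd, mul_left_comm]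
        congr 1
        rw [mul_expect]
        refine expect_congr rfl fun z' _ => ?_
        ring
      simp only [this, ← mul_expect]
      congr 1
      rw [expect_comm]
      refine expect_congr rfl fun z' _ => ?_
      rw [← mul_expect]; rfl
    rw [e, hΔ, mul_expect]
    refine ex_le fun z => ?_
    simp only [hδ, hPz]
    rw [mul_left_comm]
    refine mul_le_mul_of_nonneg_left ?_ (I_nonneg _)
    rw [mul_expect]
    refine ex_le fun z' => ?_
    by_cases hz : D z z'
    · rw [I_true hz]; linarith [hD z z' hz]
    · rw [I_false hz]; simp
  -- (ii)
  set m0 := 𝔼 x, 𝔼 z, f x z * δ z with hm0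
  have i2 : m0 ≤ (1 + 1/800) * Δ := by
    have hh := h.highdeg (t := 2/10000) (by norm_num)
    have hmj := h.maj (fun z => 2/10000 < dg f z)
    rw [ex_dg] at hmj
    have : 𝔼 z, (1 + dg f z) * δ z ≤
        𝔼 z, ((1 + 2/10000) * δ z + (1 + dg f z) * I (2/10000 < dg f z)) := ex_le fun z => by
      have := δ0 z; have := δ1 z
      by_cases hz : 2/10000 < dg f z
      · rw [I_true hz]; nlinarith
      · rw [I_false hz]; nlinarith
    rw [expect_add_distrib, ← mul_expect] at this
    rw [hm0, ex_dg]
    have : K * ((𝔼 z, I (2/10000 < dg f z)) + ε) ≤ K * (η + ε) := by gcongr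
    linarith
  -- (iii)
  have i3 : (1 + 1/400) ^ m * Δ ≤ 𝔼 x, 𝔼 z, f x z * (δ z * d x z ^ m) := by
    have : 𝔼 x, 𝔼 z, ((1 + 1/400) ^ m * (f x z * δ z) + m * (1 + 1/400) ^ (m - 1) *
        (f x z * δ z * d x z - (1 + 1/400) * (f x z * δ z))) ≤
        𝔼 x, 𝔼 z, f x z * (δ z * d x z ^ m) := ex_le fun x => ex_le fun z => by
      have ht := tangent (d0 x z) (l := 1 + 1/400) (by norm_num) m
      have := mul_le_mul_of_nonneg_left ht (mul_nonneg (h.f0 x z) (δ0 z))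
      refine le_trans (le_of_eq ?_) (this.trans (le_of_eq ?_)) <;> ring
    refine le_trans ?_ this
    simp only [expect_add_distrib, expect_sub_distrib, ← mul_expect]
    rw [← hm0]
    obtain ⟨k, rfl⟩ : ∃ k, m = k + 1 := ⟨m - 1, by omega⟩
    simp only [Nat.add_sub_cancel, pow_succ]
    push_cast
    have hA : (1 + 1/400 : ℝ) * m0 ≤ (1 + 1/200) * Δ := by nlinarith
    set A := 𝔼 x, 𝔼 z, f x z * δ z * d x z
    have hp : (0:ℝ) < (1 + 1/400) ^ k := by positivity
    have hk : (0:ℝ) ≤ k := by positivity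
    have : (1 + 1/400) * Δ ≤ (1 + 1/400) * m0 + (k + 1) * (A - (1 + 1/400) * m0) := by
      have : 0 ≤ k * (A - (1 + 1/400) * m0) := mul_nonneg hk (by linarith)
      linarith
    have := mul_le_mul_of_nonneg_left this hp.le
    linarith
  -- (iv)
  have hB : ∀ z, |W z * (Pz z)⁻¹| ≤ 2 / π := by
    intro z
    simp only [hW]
    by_cases hz : π / 2 ≤ Pz z
    · rw [I_true hz, one_mul, abs_of_nonneg (inv_nonneg.2 (Pz0 z)), ← one_div]
      rw [div_le_div_iff₀ (by linarith) hπ]; linarith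
    · rw [I_false hz]; simp; positivity
  have g1 : Good d (K * Γ * (2 / π)) := by
    refine Good.expect (by positivity) fun z' => ?_
    refine Good.prod (by positivity) (by positivity) (fun x => ?_) (fun z => ?_)
    · rw [abs_of_nonneg (h.f0 _ _)]; exact h.f_le _ _
    · rw [abs_mul]
      have := hB z
      have := I_abs_le (D z z')
      have := abs_nonneg (W z * (Pz z)⁻¹)
      have := abs_nonneg (I (D z z'))
      nlinarith
  have g2 : Good (fun x z => δ z * d x z ^ m) ((K * Γ * (2 / π)) ^ m) := by
    have g3 : Good (fun (_ : X) z => (1:ℝ) * δ z) (1 * 1) :=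
      Good.prod (by norm_num) (by norm_num) (by simp)
        (fun z => by rw [abs_of_nonneg (δ0 z)]; exact δ1 z)
    have := g3.mul (g1.pow m)
    simpa using this
  have i4 := i3.trans (h.transfer g2 (fun x z => mul_nonneg (δ0 z) (pow_nonneg (d0 x z) m)))
  set E := 𝔼 x, 𝔼 z, δ z * d x z ^ m with hE
  have h8 : (1:ℝ) ≤ (1 + 1/800) ^ m := one_le_pow₀ (by norm_num)
  have i5 : 2 * (1 + 1/800) ^ m * Δ ≤ E := by
    have h1 : 3 * K * (1 + 1/800) ^ m * Δ ≤ (1 + 1/400) ^ m * Δ := by gcongr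
    have h2 : K * (3 * (1 + 1/800) ^ m * Δ) ≤ K * (E + (K * Γ * (2 / π)) ^ m * ε) := by linarith
    have h3 := le_of_mul_le_mul_left h2 (by linarith)
    nlinarith
  -- (vi)
  obtain ⟨z, hz, hz2⟩ : ∃ z, π / 2 ≤ Pz z ∧ 1/2 ≤ 𝔼 x, I (1 + 1/800 ≤ d x z) * d x z ^ m := by
    by_contra! hc
    have h1 : E ≤ (1 + 1/800) ^ m * Δ + Δ / 2 := by
      have e1 : E = 𝔼 z, δ z * 𝔼 x, d x z ^ m := by
        rw [hE, expect_comm]; simp only [mul_expect]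
      have e2 : (1 + 1/800) ^ m * Δ + Δ / 2 = 𝔼 z, δ z * ((1 + 1/800) ^ m + 1/2) := by
        rw [← expect_mul]; ring
      rw [e1, e2]
      refine ex_le fun z => ?_
      by_cases hz : π / 2 ≤ Pz z
      · have := (hc z hz).le
        refine mul_le_mul_of_nonneg_left ?_ (δ0 z)
        refine (ex_le (g := fun x => (1 + 1/800) ^ m + I (1 + 1/800 ≤ d x z) * d x z ^ m)
          fun x => ?_).trans ?_
        · by_cases hx : 1 + 1/800 ≤ d x z
          · rw [I_true hx]; linarith
          · rw [I_false hx, zero_mul, add_zero]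
            exact pow_le_pow_left₀ (d0 x z) (not_le.1 hx).le m
        · rw [expect_add_distrib, ex_const]; linarith
      · simp only [hδ, hW]; rw [I_false hz]; simp
    nlinarith
  have hWz : W z = 1 := I_true hz
  have hPp : 0 < Pz z := by linarith
  -- (vii)
  set t : X → ℝ := fun x => 𝔼 z', s x z' * ((Pz z)⁻¹ * I (D z z')) with ht
  have hav : 𝔼 z', ((Pz z)⁻¹ * I (D z z')) = 1 := by
    rw [← mul_expect]; exact inv_mul_cancel₀ hPp.ne'
  have t0 : ∀ x, 0 ≤ t x := fun x => ex_nonneg fun z' =>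
    mul_nonneg (h.s0 _ _) (mul_nonneg (inv_nonneg.2 hPp.le) (I_nonneg _))
  have tG : ∀ x, t x ≤ Γ := fun x => by
    have : t x ≤ 𝔼 z', Γ * ((Pz z)⁻¹ * I (D z z')) := ex_le fun z' =>
      mul_le_mul_of_nonneg_right (h.sG _ _) (mul_nonneg (inv_nonneg.2 hPp.le) (I_nonneg _))
    rwa [← mul_expect, hav, mul_one] at this
  have dt : ∀ x, d x z ≤ K * t x := fun x => by
    rw [mul_expect]
    refine ex_le fun z' => ?_
    rw [hWz, one_mul, ← mul_assoc K]
    exact mul_le_mul_of_nonneg_right (h.fK _ _) (mul_nonneg (inv_nonneg.2 hPp.le) (I_nonneg _))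
  have ht1 : 𝔼 x, |t x - 1| ≤ 2 / π * ε := by
    have hc := h.swap.cut.abs_le (A := 2 / π) (a := fun z' => (Pz z)⁻¹ * I (D z z')) (by positivity)
      (fun z' => by
        have h1 := hB z
        rw [hWz, one_mul] at h1
        rw [abs_mul]
        have := I_abs_le (D z z')
        have := abs_nonneg ((Pz z)⁻¹)
        have := abs_nonneg (I (D z z'))
        nlinarith)
    refine le_trans (le_of_eq ?_) hc
    refine expect_congr rfl fun x _ => ?_
    congr 1
    simp only [sub_mul, one_mul, expect_sub_distrib, hav]
    rfl
  set PQ := 𝔼 x, I (1 + 1/800 ≤ d x z) with hPQ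
  have i7 : 1/2 ≤ K ^ m * (2 ^ m * PQ + Γ ^ m * (2 / π * ε)) := by
    refine hz2.trans ?_
    have : 𝔼 x, I (1 + 1/800 ≤ d x z) * d x z ^ m ≤
        𝔼 x, K ^ m * (2 ^ m * I (1 + 1/800 ≤ d x z) + Γ ^ m * |t x - 1|) := ex_le fun x => by
      by_cases hx : 1 + 1/800 ≤ d x z
      · rw [I_true hx, one_mul, mul_one]
        have h1 := pow_le_pow_left₀ (d0 x z) (dt x) m
        rw [mul_pow] at h1
        refine h1.trans ?_
        gcongr
        exact pow_key (t0 x) (tG x) m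
      · rw [I_false hx, zero_mul]; positivity
    refine this.trans ?_
    simp only [← mul_expect, expect_add_distrib]
    gcongr
  have i8 : η ≤ PQ := by
    refine n5'.trans ?_
    have : 1/4 ≤ (2 * K) ^ m * PQ := by rw [mul_pow]; linarith
    rw [one_div_pow, ← div_eq_mul_one_div, div_le_iff₀ (by positivity)]
    linarith
  -- (viii)
  have hni := h.NI (fun x => 1 + 1/800 ≤ d x z) (D z) i8 (n5.trans hz)
  have e : 𝔼 x, 𝔼 z', f x z' * (I (1 + 1/800 ≤ d x z) * I (D z z')) =
      𝔼 x, Pz z * (I (1 + 1/800 ≤ d x z) * d x z) := by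
    refine expect_congr rfl fun x _ => ?_
    have := δd x z
    simp only [hδ, hWz, one_mul] at this
    rw [mul_left_comm, this, mul_expect]
    refine expect_congr rfl fun z' _ => ?_
    ring
  rw [e] at hni
  have h9 : (1 + 1/800) * (PQ * Pz z) ≤ 𝔼 x, Pz z * (I (1 + 1/800 ≤ d x z) * d x z) := by
    rw [hPQ, expect_mul, mul_expect]
    refine ex_le fun x => ?_
    by_cases hx : 1 + 1/800 ≤ d x z
    · rw [I_true hx]; nlinarith
    · rw [I_false hx]; simp
  have : 0 < PQ * Pz z := mul_pos (by linarith) hPp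
  change _ ≤ (1 + 1/10000) * (PQ * Pz z) at hni
  linarith

lemma Gr.noU (h : Gr f s K Γ ε η) {p m : ℕ} {π : ℝ} (hp2 : 2 ≤ p) (hp : Even p) (hm : 1 ≤ m)
    (hU : (1/12 : ℝ) ^ p ≤ 𝔼 z, 𝔼 z', UU (Ft f) z z' ^ p)
    (hπ : π = (1/2) * (1 / (4 * K ^ 2)) ^ (25 * p + 1))
    (n1 : (2 * K ^ 2) ^ (25 * p + 1) * (Γ ^ 2) ^ (25 * p + 1) * ((Γ + 1) * ε) ≤ 1/2)
    (n2 : K * (η + ε) ≤ π / 2000)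
    (n3 : 3 * K * (1 + 1/800) ^ m ≤ (1 + 1/400) ^ m)
    (n4 : (K * Γ * (2 / π)) ^ m * ε ≤ π / 2)
    (n5 : η ≤ π / 2) (n5' : η ≤ (1/4) * (1 / (2 * K)) ^ m)
    (n6 : K ^ m * (Γ ^ m * ((2 / π) * ε)) ≤ 1/4) : False := by
  have hX := h.nX
  have hZ := h.nZ
  have hK := h.K1
  have hd := h.densD (bigU (Ft f) hp2 hp hU) n1
  rw [← hπ] at hd
  exact h.final (fun z z' => 1/100 ≤ UU (Ft f) z z') hm (fun z z' hz => (D_prop hz).1)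
    (by rw [hπ]; positivity) hd n2 n3 n4 n5 n5' n6

end
end Corners

open Finset BigOperators

namespace Corners
section
variable {X Y Z : Type*} [Fintype X] [Fintype Y] [Fintype Z]
variable {f sf : X → Z → ℝ} {h sh : X → Y → ℝ} {g sg : Y → Z → ℝ} {K Γ ε η : ℝ}

lemma three_pow (a b c : ℝ) {p : ℕ} (hp : Even p) (_hp2 : 2 ≤ p) :
    (a + b + c) ^ p ≤ 3 ^ p / 3 * (a ^ p + b ^ p + c ^ p) := by
  have h1 := Real.pow_arith_mean_le_arith_mean_pow_of_even (univ : Finset (Fin 3))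
    (fun _ => (1/3:ℝ)) ![a, b, c] (by simp) (by simp) hp
  simp [Fin.sum_univ_three] at h1
  have e : a + b + c = 3 * (3⁻¹ * a + 3⁻¹ * b + 3⁻¹ * c) := by ring
  rw [e, mul_pow]
  have : (0:ℝ) < 3 ^ p := by positivity
  nlinarith

set_option maxHeartbeats 1600000 in
/-- Lemma C. -/
lemma tri_count (Hf : Gr f sf K Γ ε η) (Hh : Gr h sh K Γ ε η) (Hg : Gr g sg K Γ ε η)
    {p m : ℕ} {π : ℝ} (hp2 : 2 ≤ p) (hp : Even p) (hm : 1 ≤ m)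
    (hπ : π = (1/2) * (1 / (4 * K ^ 2)) ^ (25 * p + 1))
    (n1 : (2 * K ^ 2) ^ (25 * p + 1) * (Γ ^ 2) ^ (25 * p + 1) * ((Γ + 1) * ε) ≤ 1/2)
    (n2 : K * (η + ε) ≤ π / 2000)
    (n3 : 3 * K * (1 + 1/800) ^ m ≤ (1 + 1/400) ^ m)
    (n4 : (K * Γ * (2 / π)) ^ m * ε ≤ π / 2)
    (n5 : η ≤ π / 2) (n5' : η ≤ (1/4) * (1 / (2 * K)) ^ m)
    (n6 : K ^ m * (Γ ^ m * ((2 / π) * ε)) ≤ 1/4)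
    (n0 : K * (η + ε) ≤ 5/100000)
    (nA : 4 * K ≤ 2 ^ p)
    (nB : (1 + (K * Γ) * (K * Γ)) ^ p * ε ≤ (1/4) ^ p)
    (nC : 12 ^ p * ((1/400) ^ p + K ^ p * (2 ^ p * η + Γ ^ p * ε)) ≤ 1) :
    1/16 ≤ 𝔼 y, 𝔼 z, g y z * 𝔼 x, h x y * f x z := by
  by_contra! hT
  have hX := Hf.nX
  have hZ := Hf.nZ
  have hY := Hh.nZ
  have hK := Hf.K1
  have hG := Hf.G1
  have hε := Hf.ε0
  set k : Y → Z → ℝ := fun y z => 𝔼 x, h x y * f x z with hk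
  set Vy : Y → Prop := fun y => -(1/400) ≤ dg h y with hVy
  set Vz : Z → Prop := fun z => -(1/400) ≤ dg f z with hVz
  have k0 : ∀ y z, 0 ≤ k y z := fun y z => ex_nonneg fun x => mul_nonneg (Hh.f0 _ _) (Hf.f0 _ _)
  have ly := Hh.lowdeg n0
  have lz := Hf.lowdeg n0
  -- step 0
  have uz := Hg.up (fun z => ¬ Vz z)
  have uy := Hg.swap.up (fun y => ¬ Vy y)
  rw [expect_comm] at uy
  have s0 : 3/4 ≤ 𝔼 y, 𝔼 z, g y z * (I (Vy y) * I (Vz z)) := by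
    have h1 : 𝔼 y, 𝔼 z, g y z ≤ 𝔼 y, 𝔼 z, (g y z * (I (Vy y) * I (Vz z)) +
        g y z * I (¬ Vz z) + g y z * I (¬ Vy y)) := ex_le fun y => ex_le fun z => by
      have := Hg.f0 y z
      by_cases h1 : Vy y <;> by_cases h2 : Vz z <;> simp [I, h1, h2, this]
    rw [Hg.mean] at h1
    simp only [expect_add_distrib] at h1
    change _ ≤ _ at lz
    change 𝔼 z, I (¬ Vz z) ≤ 1/16 at lz
    change 𝔼 y, I (¬ Vy y) ≤ 1/16 at ly
    linarith
  set v : Y → Z → ℝ := fun y z => I (Vy y) * I (Vz z) with hv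
  have v0 : ∀ y z, 0 ≤ v y z := fun y z => mul_nonneg (I_nonneg _) (I_nonneg _)
  have v1 : ∀ y z, v y z ≤ 1 := fun y z => mul_le_one₀ (I_le_one _) (I_nonneg _) (I_le_one _)
  -- step 1
  have s1 : (1/2 : ℝ) ^ p ≤ 𝔼 y, 𝔼 z, g y z * (v y z * (1 - k y z) ^ p) := by
    have h1 : 𝔼 y, 𝔼 z, ((1/2) ^ p * (g y z * v y z) + p * (1/2) ^ (p - 1) *
        ((g y z * v y z - g y z * k y z) - (1/2) * (g y z * v y z))) ≤
        𝔼 y, 𝔼 z, g y z * (v y z * (1 - k y z) ^ p) := ex_le fun y => ex_le fun z => by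
      have ht := tangent (t := max (1 - k y z) 0) (le_max_right _ _) (l := 1/2) (by norm_num) p
      have hgv := mul_nonneg (Hg.f0 y z) (v0 y z)
      have hmx : max (1 - k y z) 0 ^ p ≤ (1 - k y z) ^ p := by
        rcases le_total (1 - k y z) 0 with hc | hc
        · rw [max_eq_right hc, zero_pow (by omega)]; exact hp.pow_nonneg _
        · rw [max_eq_left hc]
      have := mul_le_mul_of_nonneg_left (ht.trans hmx) hgv
      have hc : 0 ≤ (p:ℝ) * (1/2) ^ (p - 1) := by positivity
      have h3 : g y z * v y z - g y z * k y z ≤ g y z * v y z * max (1 - k y z) 0 := by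
        have a1 : g y z * v y z * (1 - k y z) ≤ g y z * v y z * max (1 - k y z) 0 :=
          mul_le_mul_of_nonneg_left (le_max_left _ _) hgv
        have a2 : g y z * v y z * k y z ≤ g y z * k y z :=
          mul_le_mul_of_nonneg_right
            (mul_le_of_le_one_right (Hg.f0 y z) (v1 y z)) (k0 y z)
        linarith
      have := mul_le_mul_of_nonneg_left h3 hc
      linarith
    refine le_trans ?_ h1
    simp only [expect_add_distrib, expect_sub_distrib, ← mul_expect]
    set M := 𝔼 y, 𝔼 z, g y z * v y z with hM
    have hM1 : M ≤ 1 := by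
      rw [← Hg.mean]
      exact ex_le fun y => ex_le fun z => mul_le_of_le_one_right (Hg.f0 y z) (v1 y z)
    change 3/4 ≤ M at s0
    obtain ⟨j, rfl⟩ : ∃ j, p = j + 1 := ⟨p - 1, by omega⟩
    simp only [Nat.add_sub_cancel, pow_succ]
    push_cast
    have hp' : (0:ℝ) < (1/2) ^ j := by positivity
    have hj : (0:ℝ) ≤ j := by positivity
    have : (1/2) ≤ (1/2) * M + (j + 1) * (M - (𝔼 y, 𝔼 z, g y z * k y z) - (1/2) * M) := by
      nlinarith
    have := mul_le_mul_of_nonneg_left this hp'.le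
    linarith
  have g1 : Good k ((K * Γ) * (K * Γ)) := by
    refine Good.expect (by positivity) fun x => ?_
    refine Good.prod (by positivity) (by positivity) (fun y => ?_) (fun z => ?_)
    · rw [abs_of_nonneg (Hh.f0 _ _)]; exact Hh.f_le _ _
    · rw [abs_of_nonneg (Hf.f0 _ _)]; exact Hf.f_le _ _
  have g2 : Good (fun y z => v y z * (1 - k y z) ^ p) ((1 + (K * Γ) * (K * Γ)) ^ p) := by
    have a1 : Good v (1 * 1) := Good.prod (by norm_num) (by norm_num)
      (fun y => I_abs_le _) (fun z => I_abs_le _)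
    have a2 := a1.mul ((Good.one.add g1.neg).pow p)
    simpa [sub_eq_add_neg] using a2
  have s2 := s1.trans (Hg.transfer g2 (fun y z => mul_nonneg (v0 y z) (hp.pow_nonneg _)))
  have s3 : 2 * (1/4 : ℝ) ^ p ≤ 𝔼 y, 𝔼 z, v y z * (1 - k y z) ^ p := by
    set E := 𝔼 y, 𝔼 z, v y z * (1 - k y z) ^ p
    have a1 : (1/2:ℝ) ^ p = 2 ^ p * (1/4) ^ p := by rw [← mul_pow]; norm_num
    have a2 : (0:ℝ) < (1/4) ^ p := by positivity
    have a3 : K * (4 * (1/4) ^ p) ≤ K * (E + (1 + (K * Γ) * (K * Γ)) ^ p * ε) := by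
      refine le_trans ?_ s2
      rw [a1]
      nlinarith
    have := le_of_mul_le_mul_left a3 (by linarith)
    linarith
  -- step 2
  set N : Y → Z → ℝ := fun y z => 𝔼 x, (h x y - 1) * (f x z - 1) with hN
  have hkN : ∀ y z, k y z - 1 = N y z + dg h y + dg f z := by
    intro y z
    simp only [hN, hk, dg, sub_mul, mul_sub, one_mul, mul_one, expect_sub_distrib, ex_const]
    ring
  have s4 : 𝔼 y, 𝔼 z, v y z * (1 - k y z) ^ p ≤ 3 ^ p / 3 * ((𝔼 y, 𝔼 z, v y z * N y z ^ p) +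
      (𝔼 y, I (Vy y) * dg h y ^ p) + 𝔼 z, I (Vz z) * dg f z ^ p) := by
    have a1 : 𝔼 y, 𝔼 z, v y z * (1 - k y z) ^ p ≤ 𝔼 y, 𝔼 z, 3 ^ p / 3 * (v y z * N y z ^ p +
      I (Vy y) * dg h y ^ p + I (Vz z) * dg f z ^ p) := ex_le fun y => ex_le fun z => by
      have b1 := three_pow (N y z) (dg h y) (dg f z) hp hp2
      rw [← hkN, ← hp.neg_pow, neg_sub] at b1
      have b2 := mul_le_mul_of_nonneg_left b1 (v0 y z)
      refine b2.trans ?_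
      rw [mul_left_comm]
      have c1 : v y z ≤ I (Vy y) := mul_le_of_le_one_right (I_nonneg _) (I_le_one _)
      have c2 : v y z ≤ I (Vz z) := mul_le_of_le_one_left (I_nonneg _) (I_le_one _)
      have d1 := mul_le_mul_of_nonneg_right c1 (hp.pow_nonneg (dg h y))
      have d2 := mul_le_mul_of_nonneg_right c2 (hp.pow_nonneg (dg f z))
      gcongr
      linarith
    refine a1.trans (le_of_eq ?_)
    simp only [← mul_expect, expect_add_distrib, ex_const]
  have mh := Hh.momdeg hp
  have mf := Hf.momdeg hp
  have s5 : (1/12 : ℝ) ^ p ≤ 𝔼 y, 𝔼 z, v y z * N y z ^ p := by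
    set E := (1/400:ℝ) ^ p + K ^ p * (2 ^ p * η + Γ ^ p * ε) with hE
    set B := 𝔼 y, 𝔼 z, v y z * N y z ^ p
    have a0 : E ≤ (1/12) ^ p := by
      rw [one_div_pow, le_div_iff₀ (by positivity)]; linarith
    have a1 : (3:ℝ) ^ p / 3 * (B + (𝔼 y, I (Vy y) * dg h y ^ p) + 𝔼 z, I (Vz z) * dg f z ^ p) ≤
        3 ^ p / 3 * (B + 2 * (1/12) ^ p) := by
      refine mul_le_mul_of_nonneg_left ?_ (by positivity)
      change 𝔼 y, I (Vy y) * dg h y ^ p ≤ E at mh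
      change 𝔼 z, I (Vz z) * dg f z ^ p ≤ E at mf
      linarith
    have a2 := s3.trans (s4.trans a1)
    have a3 : (1/4:ℝ) ^ p = 3 ^ p * (1/12) ^ p := by rw [← mul_pow]; norm_num
    rw [a3] at a2
    have a4 : (0:ℝ) < 3 ^ p := by positivity
    have a5 : 3 ^ p * (2 * (1/12:ℝ) ^ p) ≤ 3 ^ p * ((B + 2 * (1/12) ^ p) / 3) := by linarith
    have a6 := le_of_mul_le_mul_left a5 a4
    have a7 : (0:ℝ) < (1/12) ^ p := by positivity
    linarith
  -- step 3
  have e3 : 𝔼 y, 𝔼 z, v y z * N y z ^ p = 𝔼 y, 𝔼 z, (𝔼 x, Ft h x y * Ft f x z) ^ p := by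
    refine expect_congr rfl fun y _ => expect_congr rfl fun z _ => ?_
    have : 𝔼 x, Ft h x y * Ft f x z = v y z * N y z := by
      simp only [hN]
      rw [mul_expect]
      refine expect_congr rfl fun x _ => ?_
      simp only [Ft, hv, hVy, hVz]; ring
    rw [this, mul_pow]
    congr 1
    simp only [hv]
    by_cases h1 : Vy y <;> by_cases h2 : Vz z <;> simp [I, h1, h2, show p ≠ 0 by omega]
  rw [e3] at s5
  have s6 := moment_cs (Ft h) (Ft f) p
  have a7 : (0:ℝ) < (1/12) ^ p := by positivity
  have m1 := moment_nonneg (Ft h) p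
  have m2 := moment_nonneg (Ft f) p
  rcases le_total ((1/12:ℝ) ^ p) (𝔼 z, 𝔼 z', UU (Ft f) z z' ^ p) with hc | hc
  · exact Hf.noU hp2 hp hm hc hπ n1 n2 n3 n4 n5 n5' n6
  rcases le_total ((1/12:ℝ) ^ p) (𝔼 z, 𝔼 z', UU (Ft h) z z' ^ p) with hc' | hc'
  · exact Hh.noU hp2 hp hm hc' hπ n1 n2 n3 n4 n5 n5' n6
  have s7 : ((1/12:ℝ) ^ p) ^ 2 ≤ (𝔼 z, 𝔼 z', UU (Ft h) z z' ^ p) * (𝔼 z, 𝔼 z', UU (Ft f) z z' ^ p) :=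
    (pow_le_pow_left₀ a7.le s5 2).trans s6
  have : (1/12:ℝ) ^ p ≤ 𝔼 z, 𝔼 z', UU (Ft f) z z' ^ p := by
    by_contra! hlt
    have := mul_le_mul_of_nonneg_right hc' m2
    nlinarith
  exact Hf.noU hp2 hp hm this hπ n1 n2 n3 n4 n5 n5' n6

end
end Corners

open Finset BigOperators

namespace Corners
section
variable {X Y Z : Type*} [Fintype X] [Fintype Y] [Fintype Z]
variable {f sf : X → Z → ℝ} {h sh : X → Y → ℝ} {g sg : Y → Z → ℝ}

lemma two_half {a b c : ℕ} (h : a + c ≤ b) : (2:ℝ) ^ a * (1/2) ^ b ≤ (1/2) ^ c := by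
  have e : (2:ℝ) ^ a * (1/2) ^ a = 1 := by rw [← mul_pow]; norm_num
  obtain ⟨d, rfl⟩ : ∃ d, b = a + d := ⟨b - a, by omega⟩
  rw [pow_add, ← mul_assoc, e, one_mul]
  exact pow_le_pow_of_le_one (by norm_num) (by norm_num) (by omega)

lemma half_le {a b : ℕ} (h : a ≤ b) : (1/2:ℝ) ^ b ≤ (1/2) ^ a :=
  pow_le_pow_of_le_one (by norm_num) (by norm_num) h

set_option maxHeartbeats 1600000 in
lemma tri_count' {κ γ A B : ℕ} (hA : 2000 * (κ + 1) ^ 2 ≤ A)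
    (hB : 200000 * (κ + 1) ^ 3 * (γ + 1) ≤ B)
    (Hf : Gr f sf (2 ^ κ) (2 ^ γ) ((1/2) ^ B) ((1/2) ^ A))
    (Hh : Gr h sh (2 ^ κ) (2 ^ γ) ((1/2) ^ B) ((1/2) ^ A))
    (Hg : Gr g sg (2 ^ κ) (2 ^ γ) ((1/2) ^ B) ((1/2) ^ A)) :
    1/16 ≤ 𝔼 y, 𝔼 z, g y z * 𝔼 x, h x y * f x z := by
  obtain ⟨u, hu⟩ : ∃ u, u = κ + 1 := ⟨_, rfl⟩
  obtain ⟨a, ha⟩ : ∃ a, a = 1 + 2 * u * (50 * κ + 51) := ⟨_, rfl⟩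
  have ua : a ≤ 103 * u ^ 2 := by
    have : 50 * κ + 51 ≤ 51 * u := by omega
    have : u * (50 * κ + 51) ≤ u * (51 * u) := Nat.mul_le_mul_left _ this
    have : 1 ≤ u ^ 2 := Nat.one_le_pow _ _ (by omega)
    nlinarith
  have u1 : 1 ≤ u := by omega
  have u2 : u ≤ u ^ 2 := by nlinarith
  have u2' : u ^ 2 ≤ u ^ 3 := by
    have : u ^ 3 = u ^ 2 * u := by ring
    nlinarith
  rw [← hu] at hA hB
  have hAB : A + 0 ≤ A := le_refl _
  have hB1 : 200000 * u ^ 3 ≤ B := by nlinarith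
  have hB2 : 200000 * u ^ 3 + 200000 * (u ^ 3 * γ) ≤ B := by nlinarith
  have u3γ : u * γ ≤ u ^ 3 * γ := Nat.mul_le_mul_right _ (by omega)
  have γγ : γ ≤ u * γ := by nlinarith
  have a1 : 103 ≤ a := by rw [ha]; nlinarith
  have hπ : (1/2:ℝ) ^ a = (1/2) * (1 / (4 * (2 ^ κ) ^ 2)) ^ (25 * (2 * u) + 1) := by
    have e : (4 * (2 ^ κ) ^ 2 : ℝ) = 2 ^ (2 * u) := by
      rw [hu, ← pow_mul, show (4:ℝ) = 2 ^ 2 by norm_num, ← pow_add]; congr 1; ring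
    rw [e, ← one_div_pow, ← pow_mul, ha, pow_add, pow_one]
    congr 2; rw [hu]; ring
  have inv2 : (2:ℝ) / (1/2) ^ a = 2 ^ (a + 1) := by
    rw [one_div_pow, pow_succ]; field_simp
  have hsum : (2:ℝ) ^ κ * ((1/2) ^ A + (1/2) ^ B) ≤ (1/2) ^ (a + 11) := by
    have h1 : (2:ℝ) ^ κ * (1/2) ^ A ≤ (1/2) ^ (a + 12) := two_half (by nlinarith)
    have h2 : (2:ℝ) ^ κ * (1/2) ^ B ≤ (1/2) ^ (a + 12) := two_half (by nlinarith)
    have h3 : (1/2:ℝ) ^ (a + 11) = (1/2) ^ (a + 12) * 2 := by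
      rw [show a + 12 = a + 11 + 1 by ring, pow_succ (1/2:ℝ) (a + 11)]; ring
    rw [h3]; linarith
  obtain ⟨m, hm⟩ : ∃ m, m = 801 * (κ + 2) := ⟨_, rfl⟩
  refine tri_count Hf Hh Hg (p := 2 * u) (m := m) (π := (1/2) ^ a) (by omega)
    (even_two_mul u) (by omega) hπ ?_ ?_ ?_ ?_ ?_ ?_ ?_ ?_ ?_ ?_ ?_
  · -- n1
    have e1 : (2 * (2 ^ κ) ^ 2 : ℝ) ^ (25 * (2 * u) + 1) = 2 ^ ((2 * κ + 1) * (25 * (2 * u) + 1)) := by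
      rw [pow_mul]; congr 1; ring
    have e2 : (((2:ℝ) ^ γ) ^ 2) ^ (25 * (2 * u) + 1) = 2 ^ (2 * γ * (25 * (2 * u) + 1)) := by
      rw [pow_mul]; congr 1; rw [pow_mul']
    have e3 : (2:ℝ) ^ γ + 1 ≤ 2 ^ (γ + 1) := by
      rw [pow_succ]; have : (1:ℝ) ≤ 2 ^ γ := one_le_pow₀ (by norm_num)
      linarith
    rw [e1, e2]
    calc (2:ℝ) ^ ((2 * κ + 1) * (25 * (2 * u) + 1)) * 2 ^ (2 * γ * (25 * (2 * u) + 1)) *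
          ((2 ^ γ + 1) * (1/2) ^ B) ≤ 2 ^ ((2 * κ + 1) * (25 * (2 * u) + 1)) *
          2 ^ (2 * γ * (25 * (2 * u) + 1)) * (2 ^ (γ + 1) * (1/2) ^ B) := by gcongr
      _ = 2 ^ ((2 * κ + 1) * (25 * (2 * u) + 1) + 2 * γ * (25 * (2 * u) + 1) + (γ + 1)) *
          (1/2) ^ B := by rw [pow_add, pow_add]; ring
      _ ≤ (1/2) ^ 1 := two_half (by
          have : (2 * κ + 1) * (25 * (2 * u) + 1) ≤ (2 * u) * (51 * u) :=
            Nat.mul_le_mul (by omega) (by omega)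
          have : 2 * γ * (25 * (2 * u) + 1) ≤ 2 * γ * (51 * u) :=
            Nat.mul_le_mul (by omega) (by omega)
          nlinarith)
      _ = 1/2 := by norm_num
  · refine hsum.trans ?_
    rw [pow_add]
    have : (0:ℝ) < (1/2) ^ a := by positivity
    rw [show ((1/2:ℝ) ^ 11) = 1/2048 by norm_num]
    linarith
  · -- n3
    have e : (1 + 1/400 : ℝ) = (1 + 1/800) * (1 + 1/801) := by norm_num
    rw [e, mul_pow, mul_comm]
    gcongr
    rw [hm, pow_mul]
    have h1 : (2:ℝ) ≤ (1 + 1/801) ^ 801 := by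
      have := one_add_mul_le_pow (a := (1/801:ℝ)) (by norm_num) 801
      refine le_trans ?_ this; norm_num
    calc 3 * (2:ℝ) ^ κ ≤ 2 ^ (κ + 2) := by rw [pow_add]; linarith [show (0:ℝ) < 2 ^ κ by positivity]
      _ ≤ _ := by gcongr
  · -- n4
    rw [inv2]
    have e1 : ((2:ℝ) ^ κ * 2 ^ γ * 2 ^ (a + 1)) ^ m * (1/2) ^ B
        = 2 ^ ((κ + γ + (a + 1)) * m) * (1/2) ^ B := by
      rw [← pow_add, ← pow_add, ← pow_mul]
    have e2 : (1/2:ℝ) ^ a / 2 = (1/2) ^ (a + 1) := by rw [pow_succ]; ring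
    rw [e1, e2]
    apply two_half
    have b1 : m ≤ 1602 * u := by omega
    have b2 : (κ + γ + (a + 1)) * m ≤ (104 * u ^ 2 + γ) * (1602 * u) :=
      Nat.mul_le_mul (by omega) b1
    have b3 : (104 * u ^ 2 + γ) * (1602 * u) = 166608 * u ^ 3 + 1602 * (u * γ) := by ring
    omega
  · have e2 : (1/2:ℝ) ^ a / 2 = (1/2) ^ (a + 1) := by rw [pow_succ]; ring
    rw [e2]; exact half_le (by omega)
  · have e : (2 * 2 ^ κ : ℝ) = 2 ^ u := by rw [hu, pow_succ]; ring
    rw [e, ← one_div_pow, ← pow_mul, show (1/4:ℝ) = (1/2) ^ 2 by norm_num, ← pow_add]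
    apply half_le
    have : u * m ≤ u * (1602 * u) := Nat.mul_le_mul_left _ (by omega)
    nlinarith
  · -- n6
    rw [inv2]
    have e1 : ((2:ℝ) ^ κ) ^ m * (((2:ℝ) ^ γ) ^ m * (2 ^ (a + 1) * (1/2) ^ B))
        = 2 ^ (κ * m + γ * m + (a + 1)) * (1/2) ^ B := by
      rw [pow_add 2 (κ*m+γ*m), pow_add 2 (κ*m), pow_mul, pow_mul]; ring
    rw [e1, show (1/4:ℝ) = (1/2) ^ 2 by norm_num]
    apply two_half
    have b1 : κ * m ≤ u * (1602 * u) := Nat.mul_le_mul (by omega) (by omega)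
    have b2 : γ * m ≤ γ * (1602 * u) := Nat.mul_le_mul (by omega) (by omega)
    nlinarith
  · refine hsum.trans ?_
    refine (half_le (show 20 ≤ a + 11 by omega)).trans ?_
    norm_num
  · rw [show (4:ℝ) = 2 ^ 2 by norm_num, ← pow_add]
    exact pow_le_pow_right₀ (by norm_num) (by omega)
  · -- nB
    have e0 : 1 + (2:ℝ) ^ κ * 2 ^ γ * (2 ^ κ * 2 ^ γ) ≤ 2 ^ (2 * κ + 2 * γ + 1) := by
      have : (1:ℝ) ≤ 2 ^ (2 * κ + 2 * γ) := one_le_pow₀ (by norm_num)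
      have e : (2:ℝ) ^ κ * 2 ^ γ * (2 ^ κ * 2 ^ γ) = 2 ^ (2 * κ + 2 * γ) := by
        rw [← pow_add, ← pow_add]; congr 1; ring
      rw [e, pow_succ]; linarith
    calc _ ≤ ((2:ℝ) ^ (2 * κ + 2 * γ + 1)) ^ (2 * u) * (1/2) ^ B := by gcongr
      _ = 2 ^ ((2 * κ + 2 * γ + 1) * (2 * u)) * (1/2) ^ B := by rw [← pow_mul]
      _ ≤ (1/2) ^ (2 * (2 * u)) := two_half (by
          have : (2 * κ + 2 * γ + 1) * (2 * u) ≤ (2 * u + 2 * γ) * (2 * u) :=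
            Nat.mul_le_mul_right _ (by omega)
          nlinarith)
      _ = (1/4) ^ (2 * u) := by rw [pow_mul]; norm_num
  · -- nC
    have c1 : (12:ℝ) ^ (2 * u) * (1/400) ^ (2 * u) ≤ 1/2 := by
      rw [← mul_pow]
      calc (12 * (1/400) : ℝ) ^ (2 * u) ≤ (12 * (1/400)) ^ 1 :=
            pow_le_pow_of_le_one (by norm_num) (by norm_num) (by omega)
        _ ≤ _ := by norm_num
    have c0 : (12:ℝ) ^ (2 * u) ≤ 2 ^ (8 * u) := by
      rw [show 8 * u = 4 * (2 * u) by ring, pow_mul 2 4]; gcongr; norm_num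
    have c2 : (12:ℝ) ^ (2 * u) * ((2 ^ κ) ^ (2 * u) * (2 ^ (2 * u) * (1/2) ^ A)) ≤ (1/2) ^ 2 := by
      calc _ ≤ (2:ℝ) ^ (8 * u) * ((2 ^ κ) ^ (2 * u) * (2 ^ (2 * u) * (1/2) ^ A)) := by gcongr
        _ = 2 ^ (8 * u + κ * (2 * u) + 2 * u) * (1/2) ^ A := by
            rw [← pow_mul 2 κ, pow_add 2 (8 * u + κ * (2 * u)), pow_add 2 (8*u)]; simp only [mul_assoc]
        _ ≤ _ := two_half (by
            have : κ * (2 * u) ≤ u * (2 * u) := Nat.mul_le_mul_right _ (by omega)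
            nlinarith)
    have c3 : (12:ℝ) ^ (2 * u) * ((2 ^ κ) ^ (2 * u) * ((2 ^ γ) ^ (2 * u) * (1/2) ^ B)) ≤ (1/2) ^ 2 := by
      calc _ ≤ (2:ℝ) ^ (8 * u) * ((2 ^ κ) ^ (2 * u) * ((2 ^ γ) ^ (2 * u) * (1/2) ^ B)) := by gcongr
        _ = 2 ^ (8 * u + κ * (2 * u) + γ * (2 * u)) * (1/2) ^ B := by
            rw [← pow_mul 2 κ, ← pow_mul 2 γ, pow_add 2 (8 * u + κ * (2 * u)), pow_add 2 (8*u)]; simp only [mul_assoc]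
        _ ≤ _ := two_half (by
            have : κ * (2 * u) ≤ u * (2 * u) := Nat.mul_le_mul_right _ (by omega)
            nlinarith)
    rw [mul_add, mul_add, mul_add]
    linarith
end
end Corners

open Finset BigOperators
open scoped Pointwise

namespace Corners
section
variable {G : Type*} [AddCommGroup G] [DecidableEq G]

/-- symmetric finset containing zero -/
def Sy (P : Finset G) : Prop := 0 ∈ P ∧ ∀ t ∈ P, -t ∈ P

def Pres (τ : ℝ) (T B : Finset G) : Prop := ((T + (B + B)).card : ℝ) ≤ (1 + τ) * T.card

lemma Sy.ne {P : Finset G} (h : Sy P) : P.Nonempty := ⟨0, h.1⟩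
lemma Sy.pos {P : Finset G} (h : Sy P) : (0:ℝ) < P.card := by
  have := h.ne.card_pos; exact_mod_cast this

lemma Pres.mono {τ : ℝ} {T B B' : Finset G} (h : Pres τ T B) (hB : B' ⊆ B) : Pres τ T B' := by
  unfold Pres at *
  refine le_trans ?_ h
  exact_mod_cast card_le_card (add_subset_add_left (add_subset_add hB hB))

lemma shift_sum {E : Type*} [SeminormedAddCommGroup E] {τ : ℝ} {T B : Finset G}
    (h : Pres τ T B) (hB : Sy B) {φ : G → E}
    (hφ : ∀ x, ‖φ x‖ ≤ 1) {t : G} (ht : t ∈ B) :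
    ‖∑ ξ ∈ T, φ (ξ + t) - ∑ ξ ∈ T, φ ξ‖ ≤ 2 * τ * T.card := by
  classical
  have e : ∑ ξ ∈ T, φ (ξ + t) = ∑ ξ ∈ T.map (addRightEmbedding t), φ ξ := by
    rw [sum_map]; rfl
  set T' := T.map (addRightEmbedding t) with hT'
  have cT' : T'.card = T.card := card_map _
  set U := T + (B + B) with hU
  have s1 : T ⊆ U := fun x hx => by
    rw [hU]; exact mem_add.2 ⟨x, hx, 0, mem_add.2 ⟨0, hB.1, 0, hB.1, by simp⟩, by simp⟩
  have s2 : T' ⊆ U := fun x hx => by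
    rw [hT', mem_map] at hx
    obtain ⟨y, hy, rfl⟩ := hx
    exact mem_add.2 ⟨y, hy, t, mem_add.2 ⟨t, ht, 0, hB.1, by simp⟩, by simp⟩
  have c1 : ((U \ T).card : ℝ) ≤ τ * T.card := by
    rw [card_sdiff_of_subset s1, Nat.cast_sub (card_le_card s1)]
    unfold Pres at h; linarith
  have c2 : ((U \ T').card : ℝ) ≤ τ * T.card := by
    rw [card_sdiff_of_subset s2, Nat.cast_sub (card_le_card s2), cT']
    unfold Pres at h; linarith
  have n : ∀ V : Finset G, ‖∑ ξ ∈ V, φ ξ‖ ≤ V.card := fun V =>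
    (norm_sum_le _ _).trans ((sum_le_sum fun x _ => hφ x).trans (by simp))
  have f1 := sum_sdiff s1 (f := φ)
  have f2 := sum_sdiff s2 (f := φ)
  have : ∑ ξ ∈ T', φ ξ - ∑ ξ ∈ T, φ ξ = ∑ ξ ∈ U \ T, φ ξ - ∑ ξ ∈ U \ T', φ ξ := by
    rw [sub_eq_sub_iff_add_eq_add, add_comm, f2, f1]
  rw [e, this]
  refine (norm_sub_le _ _).trans ?_
  linarith [n (U \ T), n (U \ T')]

lemma exS_sub_le {α : Type*} {P : Finset α} {f g : α → ℝ} {c : ℝ} (hP : P.Nonempty)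
    (h : ∀ t ∈ P, |f t - g t| ≤ c) : |𝔼 t ∈ P, f t - 𝔼 t ∈ P, g t| ≤ c := by
  rw [← expect_sub_distrib, abs_le]
  constructor
  · exact le_expect hP fun t ht => (abs_le.1 (h t ht)).1
  · exact expect_le hP fun t ht => (abs_le.1 (h t ht)).2

lemma exS_le {α : Type*} {P : Finset α} {f : α → ℝ} {c : ℝ} (hP : P.Nonempty)
    (h : ∀ t ∈ P, f t ≤ c) : 𝔼 t ∈ P, f t ≤ c := expect_le hP h

lemma exS_abs_le {α : Type*} {P : Finset α} {f : α → ℝ} {c : ℝ} (hP : P.Nonempty)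
    (h : ∀ t ∈ P, |f t| ≤ c) : |𝔼 t ∈ P, f t| ≤ c := by
  have := exS_sub_le (g := fun _ => 0) hP (by simpa using h)
  simpa using this

lemma exS_abs_le' {α : Type*} {P : Finset α} {f : α → ℝ} {c : ℝ} (hc : 0 ≤ c)
    (h : ∀ t, |f t| ≤ c) : |𝔼 t ∈ P, f t| ≤ c := by
  rcases P.eq_empty_or_nonempty with rfl | hP
  · simpa using hc
  · exact exS_abs_le hP fun t _ => h t

lemma exS_sq_le {α : Type*} (P : Finset α) (f : α → ℝ) : (𝔼 a ∈ P, f a) ^ 2 ≤ 𝔼 a ∈ P, f a ^ 2 := by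
  rcases P.eq_empty_or_nonempty with rfl | hP
  · simp
  have c : (0:ℝ) < P.card := by exact_mod_cast hP.card_pos
  have := sq_sum_le_card_mul_sum_sq (s := P) (f := f)
  rw [expect_eq_sum_div_card, expect_eq_sum_div_card, div_pow, div_le_div_iff₀ (by positivity) c]
  nlinarith

lemma exists_ge_of_exS {α : Type*} {P : Finset α} {f : α → ℝ} {c : ℝ} (hP : P.Nonempty)
    (h : c ≤ 𝔼 a ∈ P, f a) : ∃ a ∈ P, c ≤ f a := by
  by_contra! hc
  have := Finset.expect_lt (s := P) (f := f) (a := c) (fun x hx => (hc x hx).le)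
      (by obtain ⟨x, hx⟩ := hP; exact ⟨x, hx, hc x hx⟩)
  linarith

lemma exS_neg {P : Finset G} (h : Sy P) (φ : G → ℝ) : 𝔼 t ∈ P, φ (-t) = 𝔼 t ∈ P, φ t := by
  refine expect_bij (fun t _ => -t) (fun t ht => h.2 t ht) (fun _ _ => rfl)
    (fun _ _ _ _ h => neg_injective h) (fun t ht => ⟨-t, h.2 t ht, by simp⟩)

lemma shift_ex {τ : ℝ} {T B : Finset G} (h : Pres τ T B) (hB : Sy B) (hT : T.Nonempty) {φ : G → ℝ}
    (hφ : ∀ x, |φ x| ≤ 1) {t : G} (ht : t ∈ B) :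
    |𝔼 ξ ∈ T, φ (ξ + t) - 𝔼 ξ ∈ T, φ ξ| ≤ 2 * τ := by
  have := shift_sum h hB (φ := φ) hφ ht
  have c : (0:ℝ) < T.card := by exact_mod_cast hT.card_pos
  rw [expect_eq_sum_div_card, expect_eq_sum_div_card, ← sub_div, abs_div, abs_of_pos c,
    div_le_iff₀ c]
  exact this

lemma shift_ex' {τ : ℝ} {T B : Finset G} (h : Pres τ T B) (hB : Sy B) (hT : T.Nonempty) {φ : G → ℝ}
    (hφ : ∀ x, |φ x| ≤ 1) {t : G} (ht : t ∈ B) :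
    |𝔼 ξ ∈ T, φ (ξ - t) - 𝔼 ξ ∈ T, φ ξ| ≤ 2 * τ := by
  have := shift_ex h hB hT hφ (hB.2 t ht)
  simpa [sub_eq_add_neg] using this

/-- Fuel: iterated chains of smaller and smaller almost-invariant sets. -/
def Fuel [Fintype G] (N : ℕ) (τ : ℝ) (M : ℕ) : ℕ → Finset G → Prop
  | 0, P => Sy P ∧ M ≤ P.card
  | n + 1, P => (Sy P ∧ M ≤ P.card) ∧ ∀ Γ : Finset (AddChar G ℂ), Γ.card ≤ N →
      ∃ P' ⊆ P, Fuel N τ M n P' ∧ Pres τ P P' ∧ ∀ χ ∈ Γ, ∀ t ∈ P', ‖χ t - 1‖ ≤ τ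

variable [Fintype G] {N M : ℕ} {τ : ℝ}

lemma Fuel.base : ∀ {n : ℕ} {P : Finset G}, Fuel N τ M n P → Sy P ∧ M ≤ P.card
  | 0, _, h => h
  | _ + 1, _, h => h.1

lemma Fuel.sy {n : ℕ} {P : Finset G} (h : Fuel N τ M n P) : Sy P := h.base.1

lemma Fuel.pred : ∀ {n : ℕ} {P : Finset G}, Fuel N τ M (n + 1) P → Fuel N τ M n P
  | 0, _, h => h.1
  | n + 1, _, h => ⟨h.1, fun Γ hΓ => by
      obtain ⟨P', h1, h2, h3⟩ := h.2 Γ hΓ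
      exact ⟨P', h1, Fuel.pred h2, h3⟩⟩

lemma Fuel.le {m n : ℕ} (hmn : m ≤ n) {P : Finset G} (h : Fuel N τ M n P) : Fuel N τ M m P := by
  induction n, hmn using Nat.le_induction with
  | base => exact h
  | succ k _ ih => exact ih h.pred

lemma Fuel.next {n : ℕ} {P : Finset G} (h : Fuel N τ M (n + 1) P) :
    ∃ P' ⊆ P, Fuel N τ M n P' ∧ Pres τ P P' := by
  obtain ⟨P', h1, h2, h3, _⟩ := h.2 ∅ (by simp)
  exact ⟨P', h1, h2, h3⟩
end
end Corners

open Finset BigOperators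
open scoped Pointwise ComplexConjugate

namespace Corners
section
variable {G : Type*} [AddCommGroup G] [DecidableEq G] [Fintype G]

noncomputable def ft (F : G → ℂ) (χ : AddChar G ℂ) : ℂ := ∑ s, F s * χ s

lemma sum_norm_sq {ι κ : Type*} (s : Finset ι) (t : Finset κ) (F : ι → ℂ) (χ : κ → ι → ℂ) :
    ((∑ k ∈ t, ‖∑ i ∈ s, F i * χ k i‖ ^ 2 : ℝ) : ℂ)
      = ∑ i ∈ s, ∑ j ∈ s, F i * conj (F j) * ∑ k ∈ t, χ k i * conj (χ k j) := by
  push_cast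
  have : ∀ k ∈ t, ((‖∑ i ∈ s, F i * χ k i‖ : ℝ) : ℂ) ^ 2
      = ∑ i ∈ s, ∑ j ∈ s, F i * conj (F j) * (χ k i * conj (χ k j)) := by
    intro k _
    rw [← Complex.mul_conj', map_sum, sum_mul_sum]
    refine sum_congr rfl fun i _ => sum_congr rfl fun j _ => ?_
    rw [map_mul]; ring
  rw [sum_congr rfl this, sum_comm]
  refine sum_congr rfl fun i _ => ?_
  rw [sum_comm]
  refine sum_congr rfl fun j _ => ?_
  rw [mul_sum]

lemma parseval (F : G → ℂ) : ∑ χ, ‖ft F χ‖ ^ 2 = Fintype.card G * ∑ s, ‖F s‖ ^ 2 := by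
  have h := sum_norm_sq univ univ F (fun (χ : AddChar G ℂ) s => χ s)
  have e : ∀ i j : G, ∑ χ : AddChar G ℂ, χ i * conj (χ j) = if i = j then (Fintype.card G : ℂ) else 0 := by
    intro i j
    have : ∀ χ : AddChar G ℂ, χ i * conj (χ j) = χ (i - j) := fun χ => by
      rw [← AddChar.map_neg_eq_conj, ← AddChar.map_add_eq_mul, sub_eq_add_neg]
    simp only [this]
    rw [AddChar.sum_apply_eq_ite]
    simp [sub_eq_zero]
  simp only [e] at h
  have h2 : ((∑ χ, ‖ft F χ‖ ^ 2 : ℝ) : ℂ) = ((Fintype.card G * ∑ s, ‖F s‖ ^ 2 : ℝ) : ℂ) := by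
    rw [show ((∑ χ, ‖ft F χ‖ ^ 2 : ℝ) : ℂ) = _ from h]
    push_cast
    rw [mul_sum]
    refine sum_congr rfl fun i _ => ?_
    simp
    rw [Complex.mul_conj']; ring
  exact_mod_cast h2

lemma ft_conv (β F : G → ℂ) (χ : AddChar G ℂ) :
    ft (fun s => ∑ v, β v * F (s - v)) χ = ft β χ * ft F χ := by
  unfold ft
  rw [sum_mul_sum]
  simp only [sum_mul]
  rw [sum_comm]
  refine sum_congr rfl fun v _ => ?_
  rw [← Equiv.sum_comp (Equiv.addRight v)]
  refine sum_congr rfl fun s _ => ?_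
  simp [AddChar.map_add_eq_mul]; ring

lemma char_norm (χ : AddChar G ℂ) (s : G) : ‖χ s‖ = 1 := AddChar.norm_apply χ s

set_option maxHeartbeats 1600000 in
lemma spectrum_cover {τ : ℝ} {B B2 : Finset G} (hB : Sy B) (hB2 : Sy B2) (p : Pres τ B B2)
    (b : G → ℂ) (hb : ∀ υ, ‖b υ‖ ≤ 1) {δ : ℝ} (hδ : 0 < δ) :
    ∃ Γ : Finset (AddChar G ℂ), (Γ.card : ℝ) * δ ^ 2 ≤ 2 ∧ ∀ χ : AddChar G ℂ,
      δ * B.card ≤ ‖∑ υ ∈ B, b υ * χ υ‖ → ∃ γ ∈ Γ, ∀ v ∈ B2, ‖χ v - γ v‖ * (δ ^ 2 / 2) ≤ 2 * τ := by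
  classical
  have hc := hB.pos
  have hτ : 0 ≤ τ := by
    have := shift_sum p hB2 (φ := fun _ => (0:ℝ)) (by simp) hB2.1
    simp at this
    by_contra hh
    push Not at hh
    nlinarith
  set Th : Finset (AddChar G ℂ) := univ.filter fun χ => δ * B.card ≤ ‖∑ υ ∈ B, b υ * χ υ‖ with hTh
  set ok : Finset (Finset (AddChar G ℂ)) := univ.filter fun Γ => Γ ⊆ Th ∧
    ∀ χ ∈ Γ, ∀ γ ∈ Γ, χ ≠ γ → ‖∑ υ ∈ B, χ υ * conj (γ υ)‖ ≤ (δ ^ 2 / 2) * B.card with hok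
  obtain ⟨Γ, hΓ, hmax⟩ := exists_max_image ok Finset.card ⟨∅, by simp [hok]⟩
  rw [hok, mem_filter] at hΓ
  obtain ⟨-, hs, hp⟩ := hΓ
  refine ⟨Γ, ?_, ?_⟩
  · -- Bessel
    classical
    obtain ⟨n, hn⟩ : ∃ n : ℝ, n = (Γ.card : ℝ) := ⟨_, rfl⟩
    have n0 : 0 ≤ n := by rw [hn]; positivity
    set bh : AddChar G ℂ → ℂ := fun χ => ∑ υ ∈ B, b υ * χ υ with hbh
    set c : AddChar G ℂ → ℂ := fun χ => conj (bh χ) / ‖bh χ‖ with hcdef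
    have cn : ∀ χ, ‖c χ‖ ≤ 1 := fun χ => by
      simp only [hcdef, norm_div, RCLike.norm_conj, Complex.norm_real, norm_norm]
      exact div_self_le_one _
    have cb : ∀ χ, c χ * bh χ = (‖bh χ‖ : ℂ) := fun χ => by
      simp only [hcdef]
      by_cases h0 : bh χ = 0
      · simp [h0]
      · have : (‖bh χ‖ : ℂ) ≠ 0 := by simpa using h0
        rw [div_mul_eq_mul_div, mul_comm, Complex.mul_conj', div_eq_iff this]; ring
    have h1 : n * (δ * B.card) ≤ ‖∑ χ ∈ Γ, c χ * bh χ‖ := by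
      simp only [cb]
      rw [← Complex.ofReal_sum, Complex.norm_real, Real.norm_of_nonneg (sum_nonneg fun _ _ => norm_nonneg _)]
      rw [hn, ← nsmul_eq_mul]
      exact card_nsmul_le_sum _ _ _ fun χ hχ => (mem_filter.1 (hs hχ)).2
    have h2 : ∑ χ ∈ Γ, c χ * bh χ = ∑ υ ∈ B, b υ * ∑ χ ∈ Γ, c χ * χ υ := by
      simp only [hbh, mul_sum]
      rw [sum_comm]
      refine sum_congr rfl fun i _ => sum_congr rfl fun j _ => ?_
      ring
    have h3 : ‖∑ υ ∈ B, b υ * ∑ χ ∈ Γ, c χ * χ υ‖ ≤ ∑ υ ∈ B, ‖∑ χ ∈ Γ, c χ * χ υ‖ := by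
      refine (norm_sum_le _ _).trans (sum_le_sum fun υ _ => ?_)
      rw [norm_mul]
      exact mul_le_of_le_one_left (norm_nonneg _) (hb υ)
    have h4 := sq_sum_le_card_mul_sum_sq (s := B) (f := fun υ => ‖∑ χ ∈ Γ, c χ * χ υ‖)
    have h5 := sum_norm_sq Γ B c (fun υ χ => χ υ)
    have h6 : ∑ υ ∈ B, ‖∑ χ ∈ Γ, c χ * χ υ‖ ^ 2 ≤ n * B.card + n * (n * (δ ^ 2 / 2 * B.card)) := by
      have e : ∑ υ ∈ B, ‖∑ χ ∈ Γ, c χ * χ υ‖ ^ 2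
          = ‖((∑ υ ∈ B, ‖∑ χ ∈ Γ, c χ * χ υ‖ ^ 2 : ℝ) : ℂ)‖ := by
        rw [Complex.norm_real, Real.norm_of_nonneg (by positivity)]
      rw [e, h5]
      refine (norm_sum_le _ _).trans ?_
      have : ∀ χ ∈ Γ, ‖∑ γ ∈ Γ, c χ * conj (c γ) * ∑ υ ∈ B, χ υ * conj (γ υ)‖
          ≤ B.card + n * (δ ^ 2 / 2 * B.card) := by
        intro χ hχ
        refine (norm_sum_le _ _).trans ?_
        have : ∀ γ ∈ Γ, ‖c χ * conj (c γ) * ∑ υ ∈ B, χ υ * conj (γ υ)‖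
            ≤ (if χ = γ then (B.card : ℝ) else 0) + δ ^ 2 / 2 * B.card := by
          intro γ hγ
          rw [norm_mul, norm_mul, RCLike.norm_conj]
          have i1 : ‖c χ‖ * ‖c γ‖ ≤ 1 := mul_le_one₀ (cn χ) (norm_nonneg _) (cn γ)
          refine (mul_le_of_le_one_left (norm_nonneg _) i1).trans ?_
          split_ifs with hh
          · have : ‖∑ υ ∈ B, χ υ * conj (γ υ)‖ ≤ B.card := by
              refine (norm_sum_le _ _).trans ?_
              simp [char_norm]
            have : 0 ≤ δ ^ 2 / 2 * B.card := by positivity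
            linarith
          · rw [zero_add]; exact hp χ hχ γ hγ hh
        refine (sum_le_sum this).trans ?_
        rw [sum_add_distrib, sum_ite_eq, if_pos hχ, sum_const, nsmul_eq_mul, ← hn]
      refine (sum_le_sum this).trans ?_
      rw [sum_const, nsmul_eq_mul]
      rw [← hn]; nlinarith
    have h7 : (n * (δ * B.card)) ^ 2 ≤ B.card * (n * B.card + n * (n * (δ ^ 2 / 2 * B.card))) := by
      have hh := (h1.trans (h2 ▸ h3))
      calc (n * (δ * B.card)) ^ 2 ≤ (∑ υ ∈ B, ‖∑ χ ∈ Γ, c χ * χ υ‖) ^ 2 := by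
            gcongr
        _ ≤ _ := h4
        _ ≤ _ := by gcongr
    rw [← hn]
    rcases n0.eq_or_lt with h0 | h0
    · rw [← h0]; norm_num
    by_contra hcon
    push Not at hcon
    have : B.card * (n * B.card + n * (n * (δ ^ 2 / 2 * B.card))) = (B.card:ℝ)^2 * n * (1 + n * δ^2/2) := by ring
    have e2 : (n * (δ * B.card)) ^ 2 = (B.card:ℝ)^2 * n * (n * δ^2) := by ring
    rw [this, e2] at h7
    have hpos : 0 < (B.card:ℝ)^2 * n := by positivity
    have := le_of_mul_le_mul_left h7 hpos
    linarith
  · intro χ hχ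
    have hχT : χ ∈ Th := by simp [hTh, hχ]
    by_cases hin : χ ∈ Γ
    · refine ⟨χ, hin, fun v _ => ?_⟩
      simp; exact hτ
    have : ∃ γ ∈ Γ, (δ ^ 2 / 2) * B.card < ‖∑ υ ∈ B, χ υ * conj (γ υ)‖ := by
      by_contra! hno
      have hm := hmax (insert χ Γ) (by
        rw [hok, mem_filter]
        refine ⟨mem_univ _, insert_subset hχT hs, ?_⟩
        intro x hx y hy hxy
        rw [mem_insert] at hx hy
        rcases hx with rfl | hx <;> rcases hy with rfl | hy
        · exact absurd rfl hxy
        · exact hno y hy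
        · have := hno x hx
          have e : ∑ υ ∈ B, x υ * conj (y υ) = conj (∑ υ ∈ B, y υ * conj (x υ)) := by
            rw [map_sum]; refine sum_congr rfl fun i _ => ?_
            rw [map_mul, Complex.conj_conj]; ring
          rw [e, RCLike.norm_conj]; exact this
        · exact hp x hx y hy hxy)
      rw [card_insert_of_notMem hin] at hm
      omega
    obtain ⟨γ, hγ, hlt⟩ := this
    refine ⟨γ, hγ, fun v hv => ?_⟩
    have hsh := shift_sum p hB2 (φ := fun υ => χ υ * conj (γ υ)) (fun x => by simp [char_norm]) hv
    have e : ∑ ξ ∈ B, χ (ξ + v) * conj (γ (ξ + v)) - ∑ ξ ∈ B, χ ξ * conj (γ ξ)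
        = (χ v * conj (γ v) - 1) * ∑ ξ ∈ B, χ ξ * conj (γ ξ) := by
      rw [sub_mul, one_mul, mul_sum]
      congr 1
      refine sum_congr rfl fun i _ => ?_
      rw [AddChar.map_add_eq_mul, AddChar.map_add_eq_mul, map_mul]; ring
    have e2 : ‖χ v * conj (γ v) - 1‖ = ‖χ v - γ v‖ := by
      have : χ v * conj (γ v) - 1 = (χ v - γ v) * conj (γ v) := by
        rw [sub_mul, Complex.mul_conj', char_norm]; simp
      rw [this, norm_mul, RCLike.norm_conj, char_norm, mul_one]
    rw [e, norm_mul, e2] at hsh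
    have hh : ‖χ v - γ v‖ * ((δ ^ 2 / 2) * B.card) ≤ ‖χ v - γ v‖ * ‖∑ υ ∈ B, χ υ * conj (γ υ)‖ := by
      gcongr
    have := hh.trans hsh
    rw [← mul_assoc] at this
    exact le_of_mul_le_mul_right this hc
end
end Corners

open Finset BigOperators
open scoped Pointwise ComplexConjugate

namespace Corners
section
variable {G : Type*} [AddCommGroup G] [DecidableEq G] [Fintype G]

/-- convolution with a normalised measure on `B` -/
noncomputable def cv (B : Finset G) (b : G → ℝ) (F : G → ℝ) (s : G) : ℝ :=
  𝔼 υ ∈ B, b υ * F (s - υ)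

lemma ft_cv (B : Finset G) (b F : G → ℝ) (χ : AddChar G ℂ) :
    ft (fun s => (cv B b F s : ℂ)) χ
      = ((∑ υ ∈ B, (b υ : ℂ) * χ υ) / B.card) * ft (fun s => (F s : ℂ)) χ := by
  have h := ft_conv (fun v => if v ∈ B then (b v : ℂ) / B.card else 0) (fun s => (F s : ℂ)) χ
  have e1 : (fun s => ∑ v, (if v ∈ B then (b v : ℂ) / B.card else 0) * (F (s - v) : ℂ))
      = fun s => (cv B b F s : ℂ) := by
    funext s
    unfold cv
    rw [expect_eq_sum_div_card]
    push_cast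
    simp only [ite_mul, zero_mul]
    rw [sum_ite_mem, univ_inter, sum_div]
    refine sum_congr rfl fun v _ => ?_
    ring
  rw [e1] at h
  rw [h]
  congr 1
  unfold ft
  simp only [ite_mul, zero_mul]
  rw [sum_ite_mem, univ_inter, sum_div]
  refine sum_congr rfl fun v _ => ?_
  ring

lemma cv_sq_sum (B : Finset G) (b F : G → ℝ) (hb : ∀ υ, |b υ| ≤ 1) (hB : B.Nonempty) :
    ∑ s, cv B b F s ^ 2 ≤ ∑ s, F s ^ 2 := by
  have h1 : ∀ s, cv B b F s ^ 2 ≤ 𝔼 υ ∈ B, F (s - υ) ^ 2 := fun s => by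
    refine (exS_sq_le B _).trans (expect_le_expect fun υ _ => ?_)
    rw [mul_pow]
    have : b υ ^ 2 ≤ 1 := by
      rw [← sq_abs]; exact pow_le_one₀ (abs_nonneg _) (hb υ)
    exact mul_le_of_le_one_left (sq_nonneg _) this
  refine (sum_le_sum fun s _ => h1 s).trans ?_
  rw [← expect_sum_comm]
  refine exS_le hB fun υ _ => ?_
  rw [Fintype.sum_equiv (Equiv.subRight υ) (fun s => F (s - υ) ^ 2) (fun s => F s ^ 2) (fun s => rfl)]

set_option maxHeartbeats 1600000 in
lemma energy {τ ε : ℝ} {T B B2 : Finset G} (hT : T.Nonempty) (hB : Sy B) (hB2 : Sy B2)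
    (hBB : B2 ⊆ B) (pT : Pres τ T B) (pB : Pres τ B B2) {F b : G → ℝ}
    (hF : ∀ s, |F s| ≤ 1) (hb : ∀ υ, |b υ| ≤ 1) (z0 : G) (hε : 0 < ε) (hε1 : ε ≤ 1) (hτ0 : 0 ≤ τ)
    (hτ : τ ≤ ε ^ 3 / 2048)
    (h : ε ^ 2 ≤ 𝔼 η ∈ T, (𝔼 υ ∈ B, b υ * F (z0 - η - υ)) ^ 2) :
    ∃ Γ : Finset (AddChar G ℂ), (Γ.card : ℝ) * ε ^ 2 ≤ 128 ∧ ∀ C ⊆ B2, C.Nonempty →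
      (∀ χ ∈ Γ, ∀ t ∈ C, ‖χ t - 1‖ ≤ τ) →
      ε ^ 2 / 4 ≤ 𝔼 η ∈ T, (𝔼 v ∈ C, F (z0 - η - v)) ^ 2 := by
  classical
  obtain ⟨Γ, hΓ, hcov⟩ := spectrum_cover hB hB2 pB (fun υ => (b υ : ℂ))
    (fun υ => by simpa using hb υ) (δ := ε / 8) (by positivity)
  refine ⟨Γ, by nlinarith, fun C hC hCn hχC => ?_⟩
  have hTc : (0:ℝ) < T.card := by exact_mod_cast hT.card_pos
  have hBc := hB.pos
  have hCc : (0:ℝ) < C.card := by exact_mod_cast hCn.card_pos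
  set D : Finset G := T + (B + B) with hD
  set F' : G → ℝ := fun s => if z0 - s ∈ T + B then F s else 0 with hF'
  have hF'1 : ∀ s, |F' s| ≤ 1 := fun s => by
    simp only [hF']; split_ifs
    · exact hF s
    · simp
  have hF'sq : ∑ s, F' s ^ 2 ≤ 2 * T.card := by
    have e : ∀ s, F' s ^ 2 ≤ if z0 - s ∈ T + B then 1 else 0 := fun s => by
      simp only [hF']; split_ifs
      · rw [← sq_abs]; exact pow_le_one₀ (abs_nonneg _) (hF s)
      · simp
    refine (sum_le_sum fun s _ => e s).trans ?_
    rw [Fintype.sum_equiv (Equiv.subLeft z0) (fun s => if z0 - s ∈ T + B then (1:ℝ) else 0)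
      (fun s => if s ∈ T + B then (1:ℝ) else 0) (fun s => rfl)]
    rw [sum_ite_mem, univ_inter, sum_const, nsmul_eq_mul, mul_one]
    have s1 : T + B ⊆ D := by
      refine add_subset_add_left fun x hx => mem_add.2 ⟨x, hx, 0, hB.1, by simp⟩
    have : ((T + B).card : ℝ) ≤ D.card := by exact_mod_cast card_le_card s1
    unfold Pres at pT
    have : τ ≤ 1 := by
      have : ε ^ 3 ≤ 1 := pow_le_one₀ hε.le hε1
      linarith
    nlinarith
  set φ := cv B b F' with hφ
  set H := cv C (fun _ => 1) F' with hH
  -- lower bound for φ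
  have l1 : ε ^ 2 * T.card ≤ ∑ s, φ s ^ 2 := by
    rw [expect_eq_sum_div_card, le_div_iff₀ hTc] at h
    refine h.trans ?_
    have : ∀ η ∈ T, (𝔼 υ ∈ B, b υ * F (z0 - η - υ)) ^ 2 = φ (z0 - η) ^ 2 := by
      intro η hη
      simp only [hφ, cv]
      congr 1
      refine expect_congr rfl fun υ hυ => ?_
      simp only [hF']
      rw [if_pos]
      exact mem_add.2 ⟨η, hη, υ, hυ, by abel⟩
    rw [sum_congr rfl this]
    rw [← Fintype.sum_equiv (Equiv.subLeft z0) (fun s => φ (z0 - s) ^ 2) (fun s => φ s ^ 2)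
      (fun s => rfl)]
    exact sum_le_sum_of_subset_of_nonneg (subset_univ _) fun _ _ _ => sq_nonneg _
  -- the average of φ over C
  set ψ := cv C (fun _ => 1) φ with hψ
  have hcomm : ψ = cv B b H := by
    funext s
    simp only [hψ, hφ, hH, cv, one_mul, mul_expect]
    rw [expect_comm]
    refine expect_congr rfl fun υ _ => expect_congr rfl fun v _ => ?_
    rw [sub_right_comm]
  have u1 : ∑ s, ψ s ^ 2 ≤ ∑ s, H s ^ 2 := by
    rw [hcomm]; exact cv_sq_sum B b H hb hB.ne
  have u2 : ∑ s, (φ s - ψ s) ^ 2 ≤ (ε / 4) ^ 2 * (2 * T.card) := by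
    have pv := parseval (fun s => ((φ s - ψ s : ℝ) : ℂ))
    have pv' := parseval (fun s => (F' s : ℂ))
    have hGc : (0:ℝ) < Fintype.card G := by exact_mod_cast Fintype.card_pos
    have key : ∀ χ, ‖ft (fun s => ((φ s - ψ s : ℝ) : ℂ)) χ‖ ^ 2
        ≤ (ε / 4) ^ 2 * ‖ft (fun s => (F' s : ℂ)) χ‖ ^ 2 := by
      intro χ
      have e1 : ft (fun s => ((φ s - ψ s : ℝ) : ℂ)) χ
          = (1 - (∑ v ∈ C, χ v) / C.card) * ((∑ υ ∈ B, (b υ : ℂ) * χ υ) / B.card)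
            * ft (fun s => (F' s : ℂ)) χ := by
        have a1 : ft (fun s => ((φ s - ψ s : ℝ) : ℂ)) χ
            = ft (fun s => (φ s : ℂ)) χ - ft (fun s => (ψ s : ℂ)) χ := by
          unfold ft; rw [← sum_sub_distrib]
          refine sum_congr rfl fun s _ => ?_
          push_cast; ring
        rw [a1, hψ, ft_cv C, hφ, ft_cv B]
        simp only [Complex.ofReal_one, one_mul]
        ring
      rw [e1, norm_mul, mul_pow]
      gcongr
      rw [norm_mul]
      have a2 : 1 - (∑ v ∈ C, χ v) / C.card = (∑ v ∈ C, (1 - χ v)) / C.card := by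
        rw [sum_sub_distrib, sub_div]
        congr 1
        simp; rw [div_self]; exact_mod_cast hCc.ne'
      have a3 : ∀ r, (∀ v ∈ C, ‖1 - χ v‖ ≤ r) → ‖1 - (∑ v ∈ C, χ v) / C.card‖ ≤ r := by
        intro r hr
        rw [a2, norm_div, RCLike.norm_natCast, div_le_iff₀ hCc]
        refine (norm_sum_le _ _).trans ?_
        refine (sum_le_sum hr).trans ?_
        rw [sum_const, nsmul_eq_mul]; linarith
      have a4 : ‖(∑ υ ∈ B, (b υ : ℂ) * χ υ) / (B.card : ℂ)‖ ≤ 1 := by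
        rw [norm_div, RCLike.norm_natCast, div_le_iff₀ hBc, one_mul]
        refine (norm_sum_le _ _).trans ?_
        have : ∀ υ ∈ B, ‖(b υ : ℂ) * χ υ‖ ≤ 1 := fun υ _ => by
          rw [norm_mul, char_norm, mul_one]; simpa using hb υ
        refine (sum_le_sum this).trans ?_
        simp
      by_cases hbig : ε / 8 * B.card ≤ ‖∑ υ ∈ B, (b υ : ℂ) * χ υ‖
      · obtain ⟨γ, hγ, hv⟩ := hcov χ hbig
        have : ‖1 - (∑ v ∈ C, χ v) / C.card‖ ≤ ε / 4 := by
          refine a3 _ fun v hvC => ?_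
          have b1 := hv v (hC hvC)
          have b2 := hχC γ hγ v hvC
          have b3 : ‖1 - χ v‖ ≤ ‖χ v - γ v‖ + ‖γ v - 1‖ := by
            rw [show 1 - χ v = -((χ v - γ v) + (γ v - 1)) by ring, norm_neg]
            exact norm_add_le _ _
          have e3 : ε ^ 3 ≤ ε := by
            have : ε ^ 3 = ε * ε ^ 2 := by ring
            have : ε ^ 2 ≤ 1 := pow_le_one₀ hε.le hε1
            nlinarith
          have b4 : ‖χ v - γ v‖ ≤ ε / 8 := by
            have : ‖χ v - γ v‖ * ((ε/8)^2/2) ≤ ε / 8 * ((ε/8)^2/2) := by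
              refine b1.trans ?_
              nlinarith
            exact le_of_mul_le_mul_right this (by positivity)
          linarith
        calc _ ≤ ε / 4 * 1 := by gcongr
          _ = _ := mul_one _
      · push Not at hbig
        have c1 : ‖1 - (∑ v ∈ C, χ v) / C.card‖ ≤ 2 := a3 _ fun v _ => by
          refine (norm_sub_le _ _).trans ?_
          rw [char_norm]; simp; norm_num
        have c2 : ‖(∑ υ ∈ B, (b υ : ℂ) * χ υ) / (B.card : ℂ)‖ ≤ ε / 8 := by
          rw [norm_div, RCLike.norm_natCast, div_le_iff₀ hBc]; exact hbig.le
        calc _ ≤ 2 * (ε / 8) := by gcongr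
          _ = _ := by ring
    have := sum_le_sum fun χ (_ : χ ∈ univ) => key χ
    rw [← mul_sum, pv, pv'] at this
    simp only [Complex.norm_real, Real.norm_eq_abs, sq_abs] at this
    have h2 : (Fintype.card G : ℝ) * ∑ s, (φ s - ψ s) ^ 2
        ≤ Fintype.card G * ((ε / 4) ^ 2 * ∑ s, F' s ^ 2) := by linarith
    refine (le_of_mul_le_mul_left h2 hGc).trans ?_
    gcongr
  have u3 : ∑ s, φ s ^ 2 ≤ 2 * ∑ s, (φ s - ψ s) ^ 2 + 2 * ∑ s, ψ s ^ 2 := by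
    rw [mul_sum, mul_sum, ← sum_add_distrib]
    refine sum_le_sum fun s _ => ?_
    nlinarith [sq_nonneg (φ s - 2 * ψ s)]
  have u4 : 3 / 8 * ε ^ 2 * T.card ≤ ∑ s, H s ^ 2 := by nlinarith
  -- split H
  have hTD : T ⊆ D := fun x hx =>
    mem_add.2 ⟨x, hx, 0, mem_add.2 ⟨0, hB.1, 0, hB.1, by simp⟩, by simp⟩
  have u5 : ∑ s, H s ^ 2 ≤ ∑ η ∈ T, (𝔼 v ∈ C, F (z0 - η - v)) ^ 2 + τ * T.card := by
    rw [← Fintype.sum_equiv (Equiv.subLeft z0) (fun s => H (z0 - s) ^ 2) (fun s => H s ^ 2)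
      (fun s => rfl)]
    have z1 : ∑ s, H (z0 - s) ^ 2 = ∑ s ∈ D, H (z0 - s) ^ 2 := by
      symm
      refine sum_subset (subset_univ _) fun s _ hs => ?_
      have : H (z0 - s) = 0 := by
        simp only [hH, cv]
        refine expect_eq_zero fun v hv => ?_
        simp only [hF']
        rw [if_neg, mul_zero]
        intro hmem
        apply hs
        rw [mem_add] at hmem
        obtain ⟨t, ht, β, hβ, e⟩ := hmem
        have hv' : -v ∈ B := hB.2 _ (hBB (hC hv))
        refine mem_add.2 ⟨t, ht, β + -v, mem_add.2 ⟨β, hβ, -v, hv', rfl⟩, ?_⟩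
        have : t + β = s + v := by rw [e]; abel
        rw [← add_assoc, this]; abel
      rw [this]; norm_num
    rw [z1, ← sum_sdiff hTD, add_comm]
    have z2 : ∀ η ∈ T, H (z0 - η) ^ 2 = (𝔼 v ∈ C, F (z0 - η - v)) ^ 2 := by
      intro η hη
      simp only [hH, cv, one_mul]
      congr 1
      refine expect_congr rfl fun υ hυ => ?_
      simp only [hF']
      rw [if_pos]
      exact mem_add.2 ⟨η, hη, υ, hBB (hC hυ), by abel⟩
    rw [sum_congr rfl z2]
    gcongr
    have z3 : ∀ s ∈ D \ T, H (z0 - s) ^ 2 ≤ 1 := by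
      intro s _
      rw [← sq_abs]
      refine pow_le_one₀ (abs_nonneg _) ?_
      refine exS_abs_le hCn fun v _ => ?_
      rw [one_mul]; exact hF'1 _
    refine (sum_le_sum z3).trans ?_
    rw [sum_const, nsmul_eq_mul, mul_one, card_sdiff_of_subset hTD, Nat.cast_sub (card_le_card hTD)]
    unfold Pres at pT
    linarith
  rw [expect_eq_sum_div_card, le_div_iff₀ hTc]
  have e3 : ε ^ 3 ≤ ε ^ 2 := by
    have : ε ^ 3 = ε * ε ^ 2 := by ring
    nlinarith [sq_nonneg ε]
  nlinarith
end
end Corners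

open Finset BigOperators
open scoped Pointwise ComplexConjugate

namespace Corners
section
variable {G : Type*} [AddCommGroup G] [DecidableEq G] [Fintype G]

noncomputable def Bohr (Γ : Finset (AddChar G ℂ)) (ρ : ℝ) : Finset G := by
  classical exact univ.filter fun t => ∀ χ ∈ Γ, ‖χ t - 1‖ ≤ ρ

lemma mem_Bohr {Γ : Finset (AddChar G ℂ)} {ρ : ℝ} {t : G} :
    t ∈ Bohr Γ ρ ↔ ∀ χ ∈ Γ, ‖χ t - 1‖ ≤ ρ := by simp [Bohr]

lemma Bohr_mono {Γ Γ' : Finset (AddChar G ℂ)} {ρ ρ' : ℝ} (h : Γ' ⊆ Γ) (hρ : ρ ≤ ρ') :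
    Bohr Γ ρ ⊆ Bohr Γ' ρ' := fun t ht => by
  rw [mem_Bohr] at *
  exact fun χ hχ => (ht χ (h hχ)).trans hρ

lemma Bohr_sy (Γ : Finset (AddChar G ℂ)) {ρ : ℝ} (h : 0 ≤ ρ) : Sy (Bohr Γ ρ) := by
  constructor
  · rw [mem_Bohr]; intro χ _; simpa using h
  · intro t ht
    rw [mem_Bohr] at *
    intro χ hχ
    have := ht χ hχ
    rw [AddChar.map_neg_eq_conj]
    rw [show conj (χ t) - 1 = conj (χ t - 1) by simp, RCLike.norm_conj]
    exact this

lemma Bohr_add (Γ : Finset (AddChar G ℂ)) {ρ κ : ℝ} {s t : G} (hs : s ∈ Bohr Γ ρ)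
    (ht : t ∈ Bohr Γ κ) : s + t ∈ Bohr Γ (ρ + κ) := by
  rw [mem_Bohr] at *
  intro χ hχ
  rw [AddChar.map_add_eq_mul, show χ s * χ t - 1 = (χ s - 1) * χ t + (χ t - 1) by ring]
  refine (norm_add_le _ _).trans ?_
  rw [norm_mul, char_norm, mul_one]
  exact add_le_add (hs χ hχ) (ht χ hχ)

lemma Bohr_card (Γ : Finset (AddChar G ℂ)) (h : ℕ) :
    Fintype.card G ≤ (Bohr Γ ((1/2) ^ h)).card * 2 ^ (2 * (h + 3) * Γ.card) := by
  classical
  obtain ⟨k, hk⟩ : ∃ k : ℕ, k = 2 ^ (h + 1) := ⟨_, rfl⟩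
  have hkpos : (0:ℝ) < k := by rw [hk]; positivity
  set grid : Finset (Γ → ℤ × ℤ) :=
    Fintype.piFinset fun _ => (Icc (-(k:ℤ)) k) ×ˢ (Icc (-(k:ℤ)) k) with hgrid
  set f : G → Γ → ℤ × ℤ := fun t χ => (⌊(k:ℝ) * (χ.1 t).re⌋, ⌊(k:ℝ) * (χ.1 t).im⌋) with hf
  have fl : ∀ x : ℝ, |x| ≤ 1 → ⌊(k:ℝ) * x⌋ ∈ Icc (-(k:ℤ)) k := fun x hx => by
    rw [abs_le] at hx
    rw [mem_Icc]
    constructor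
    · rw [Int.le_floor]; push_cast; nlinarith
    · have : ((⌊(k:ℝ) * x⌋ : ℤ) : ℝ) ≤ k := (Int.floor_le _).trans (by nlinarith)
      exact_mod_cast this
  have maps : ∀ t ∈ (univ : Finset G), f t ∈ grid := fun t _ => by
    rw [hgrid, Fintype.mem_piFinset]
    intro χ
    simp only [hf, mem_product]
    have := char_norm χ.1 t
    exact ⟨fl _ (this ▸ Complex.abs_re_le_norm _), fl _ (this ▸ Complex.abs_im_le_norm _)⟩
  have fib : ∀ p ∈ grid, (univ.filter fun t => f t = p).card ≤ (Bohr Γ ((1/2) ^ h)).card := by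
    intro p _
    rcases (univ.filter fun t => f t = p).eq_empty_or_nonempty with he | ⟨t0, ht0⟩
    · rw [he]; simp
    refine card_le_card_of_injOn (fun t => t - t0) ?_ (fun a _ b _ hab => by simpa using hab)
    intro t ht
    simp only [coe_filter, mem_univ, true_and, Set.mem_setOf_eq, mem_filter] at ht ht0
    simp only [mem_coe]
    rw [mem_Bohr]
    intro χ hχ
    have e : f t ⟨χ, hχ⟩ = f t0 ⟨χ, hχ⟩ := by rw [ht, ht0]
    simp only [hf, Prod.mk.injEq] at e
    have d : ∀ x y : ℝ, ⌊(k:ℝ) * x⌋ = ⌊(k:ℝ) * y⌋ → |x - y| ≤ 1 / k := fun x y hxy => by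
      have := Int.abs_sub_lt_one_of_floor_eq_floor hxy
      rw [← mul_sub, abs_mul, abs_of_pos hkpos] at this
      rw [le_div_iff₀ hkpos]; linarith
    have e1 : ‖χ (t - t0) - 1‖ = ‖χ t - χ t0‖ := by
      have : χ t - χ t0 = (χ (t - t0) - 1) * χ t0 := by
        rw [sub_mul, ← AddChar.map_add_eq_mul]; simp
      rw [this, norm_mul, char_norm, mul_one]
    rw [e1]
    refine (Complex.norm_le_abs_re_add_abs_im _).trans ?_
    have r1 := d _ _ e.1
    have r2 := d _ _ e.2
    rw [Complex.sub_re, Complex.sub_im]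
    have : (1/2:ℝ) ^ h = 1 / k + 1 / k := by
      rw [hk]; push_cast; rw [pow_succ, one_div_pow]; field_simp; norm_num
    rw [this]; linarith
  have := card_le_mul_card_image_of_maps_to maps _ fib
  rw [card_univ] at this
  refine this.trans (Nat.mul_le_mul_left _ ?_)
  rw [hgrid, Fintype.card_piFinset]
  simp only [card_product, Int.card_Icc, prod_const, card_univ, Fintype.card_coe]
  rw [pow_mul]
  refine Nat.pow_le_pow_left ?_ _
  have : ((k:ℤ) + 1 - -(k:ℤ)).toNat = 2 * k + 1 := by omega
  rw [this, mul_comm 2 (h+3), pow_mul, pow_two]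
  have : 2 * k + 1 ≤ 2 ^ (h + 3) := by
    rw [hk]
    have : 2 ^ (h + 3) = 2 ^ (h + 1) * 4 := by rw [pow_add, pow_add]; ring
    have : 1 ≤ 2 ^ (h + 1) := Nat.one_le_two_pow
    omega
  exact Nat.mul_le_mul this this

lemma bern (t q m : ℕ) (h : q * 2 ^ t ≤ m) : (2:ℝ) ^ q ≤ (1 + (1/2) ^ t) ^ m := by
  have h1 : (2:ℝ) ≤ (1 + (1/2) ^ t) ^ (2 ^ t) := by
    have := one_add_mul_le_pow (a := ((1/2:ℝ) ^ t)) (by have : (0:ℝ) ≤ (1/2)^t := by positivity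
                                                        linarith) (2 ^ t)
    refine le_trans (le_of_eq ?_) this
    push_cast; rw [← mul_pow]; norm_num
  calc (2:ℝ) ^ q ≤ ((1 + (1/2) ^ t) ^ (2 ^ t)) ^ q := by gcongr
    _ = (1 + (1/2) ^ t) ^ (q * 2 ^ t) := by rw [← pow_mul]; congr 1; ring
    _ ≤ _ := pow_le_pow_right₀ (by have : (0:ℝ) ≤ (1/2)^t := by positivity
                                   linarith) h

lemma Bohr_reg (Γ : Finset (AddChar G ℂ)) {κ : ℝ} (hκ : 0 < κ) {t q m : ℕ}
    (hm : (q + 1) * 2 ^ t ≤ m) (hc : Fintype.card G ≤ (Bohr Γ (κ/2)).card * 2 ^ q) :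
    ∃ ρ, κ / 2 ≤ ρ ∧ ρ ≤ κ ∧
      ((Bohr Γ (ρ + κ / (2 * m))).card : ℝ) ≤ (1 + (1/2) ^ t) * (Bohr Γ ρ).card := by
  have m0 : 0 < m := lt_of_lt_of_le (by positivity) hm
  have m0' : (0:ℝ) < m := by exact_mod_cast m0
  by_contra! hcon
  set c : ℕ → ℝ := fun i => ((Bohr Γ (κ / 2 + i * (κ / (2 * m)))).card : ℝ) with hcd
  have step : ∀ i, i ≤ m → (1 + (1/2) ^ t) ^ i * c 0 ≤ c i := by
    intro i
    induction i with
    | zero => intro _; simp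
    | succ j ih =>
      intro hj
      have h1 := ih (by omega)
      have hjm : (j : ℝ) ≤ m := by exact_mod_cast (by omega : j ≤ m)
      have hh : (j:ℝ) * (κ / (2 * m)) ≤ κ / 2 := by
        calc (j:ℝ) * (κ / (2 * m)) ≤ m * (κ / (2 * m)) := by gcongr
          _ = κ / 2 := by field_simp
      have h2 := hcon (κ / 2 + j * (κ / (2 * m))) (by
        have : 0 ≤ (j:ℝ) * (κ / (2 * m)) := by positivity
        linarith) (by linarith)
      have e : c (j + 1) = ((Bohr Γ (κ / 2 + j * (κ / (2 * m)) + κ / (2 * m))).card : ℝ) := by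
        simp only [hcd]; congr 3; push_cast; ring
      rw [e, pow_succ]
      have hp : (0:ℝ) ≤ 1 + (1/2) ^ t := by positivity
      calc _ = (1 + (1/2) ^ t) * ((1 + (1/2) ^ t) ^ j * c 0) := by ring
        _ ≤ (1 + (1/2) ^ t) * c j := by gcongr
        _ ≤ _ := h2.le
  have h1 := step m le_rfl
  have h2 := bern t (q + 1) m hm
  have c0 : (1:ℝ) ≤ c 0 := by
    have : 0 < (Bohr Γ (κ / 2 + (0:ℕ) * (κ / (2 * m)))).card :=
      (Bohr_sy Γ (by simp; positivity)).ne.card_pos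
    simp only [hcd]
    exact_mod_cast this
  have h3 : c m ≤ c 0 * 2 ^ q := by
    have a1 : c m ≤ Fintype.card G := by
      simp only [hcd]; exact_mod_cast card_le_univ _
    have a2 : c 0 = (Bohr Γ (κ / 2)).card := by simp [hcd]
    rw [a2]
    refine a1.trans ?_
    exact_mod_cast hc
  have : (2:ℝ) ^ (q + 1) * c 0 ≤ c 0 * 2 ^ q := by
    refine le_trans ?_ (h1.trans h3)
    gcongr
  rw [pow_succ] at this
  have p : (0:ℝ) < 2 ^ q := by positivity
  nlinarith

lemma fuel_bohr {N M t K H μ : ℕ} (hμ : (2 * (H + 3) * K + 1) * 2 ^ t * 4 ≤ 2 ^ μ)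
    (hG : M * 2 ^ (2 * (H + 3) * K) ≤ Fintype.card G) :
    ∀ (j : ℕ) (Γ : Finset (AddChar G ℂ)) (h : ℕ) (ρ : ℝ), Γ.card + j * N ≤ K →
      h + μ * j + 1 ≤ H → t ≤ h → (1/2) ^ h ≤ ρ →
      ((Bohr Γ (ρ + 2 * (1/2) ^ h)).card : ℝ) ≤ (1 + (1/2) ^ t) * (Bohr Γ ρ).card →
      Fuel N ((1/2) ^ t) M j (Bohr Γ ρ) := by
  have card_lb : ∀ (Γ : Finset (AddChar G ℂ)) (h : ℕ), Γ.card ≤ K → h ≤ H →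
      Fintype.card G ≤ (Bohr Γ ((1/2) ^ h)).card * 2 ^ (2 * (H + 3) * K) := by
    intro Γ h h1 h2
    refine (Bohr_card Γ h).trans (Nat.mul_le_mul_left _ ?_)
    exact Nat.pow_le_pow_right (by norm_num) (Nat.mul_le_mul (by omega) h1)
  have base : ∀ (Γ : Finset (AddChar G ℂ)) (h : ℕ) (ρ : ℝ), Γ.card ≤ K → h ≤ H → (1/2) ^ h ≤ ρ →
      Sy (Bohr Γ ρ) ∧ M ≤ (Bohr Γ ρ).card := by
    intro Γ h ρ h1 h2 h3
    refine ⟨Bohr_sy Γ (le_trans (by positivity) h3), ?_⟩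
    refine le_trans ?_ (card_le_card (Bohr_mono (Subset.refl Γ) h3))
    have := hG.trans (card_lb Γ h h1 h2)
    exact Nat.le_of_mul_le_mul_right this (by positivity)
  intro j
  induction j with
  | zero =>
    intro Γ h ρ h1 h2 h3 h4 h5
    exact base Γ h ρ (by omega) (by omega) h4
  | succ j ih =>
    intro Γ h ρ h1 h2 h3 h4 h5
    have h1' : Γ.card + (j * N + N) ≤ K := by rw [← Nat.succ_mul]; exact h1
    have h2' : h + (μ * j + μ) + 1 ≤ H := by rw [← Nat.mul_succ]; exact h2
    refine ⟨base Γ h ρ (by omega) (by omega) h4, ?_⟩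
    intro Γ2 hΓ2
    classical
    have μ2 : 2 ≤ μ := by
      by_contra hlt
      have : 2 ^ μ ≤ 2 ^ 1 := Nat.pow_le_pow_right (by norm_num) (by omega)
      have : 1 ≤ (2 * (H + 3) * K + 1) * 2 ^ t := Nat.succ_le_of_lt (by positivity)
      omega
    obtain ⟨μ', rfl⟩ : ∃ μ', μ = μ' + 2 := ⟨μ - 2, by omega⟩
    have cu : (Γ ∪ Γ2).card ≤ Γ.card + N := (card_union_le _ _).trans (by omega)
    have hp : (0:ℝ) < (1/2) ^ h := by positivity
    have e1 : (1/2:ℝ) ^ h / 2 = (1/2) ^ (h + 1) := by rw [pow_succ]; ring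
    obtain ⟨ρ', r1, r2, r3⟩ := Bohr_reg (Γ ∪ Γ2) (κ := (1/2) ^ h) hp (t := t)
      (q := 2 * (H + 3) * K) (m := 2 ^ μ') (by rw [pow_add] at hμ; omega)
      (by rw [e1]; exact card_lb _ _ (by omega) (by omega))
    have e2 : (1/2:ℝ) ^ h / (2 * ((2 ^ μ' : ℕ) : ℝ)) = 2 * (1/2) ^ (h + (μ' + 2)) := by
      push_cast
      rw [pow_add, pow_add]
      rw [one_div_pow, one_div_pow]; field_simp
    rw [e2] at r3
    refine ⟨Bohr (Γ ∪ Γ2) ρ', Bohr_mono subset_union_left (r2.trans h4), ?_, ?_, ?_⟩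
    · refine ih (Γ ∪ Γ2) (h + (μ' + 2)) ρ' (by omega) (by omega) (by omega) ?_ r3
      refine le_trans ?_ r1
      rw [e1]; exact half_le (by omega)
    · unfold Pres
      refine le_trans ?_ h5
      have : Bohr Γ ρ + (Bohr (Γ ∪ Γ2) ρ' + Bohr (Γ ∪ Γ2) ρ') ⊆ Bohr Γ (ρ + 2 * (1/2) ^ h) := by
        intro x hx
        obtain ⟨a, ha, y, hy, rfl⟩ := mem_add.1 hx
        obtain ⟨b, hb, c, hc, rfl⟩ := mem_add.1 hy
        have hb' := Bohr_mono (subset_union_left (s₁ := Γ) (s₂ := Γ2)) r2 hb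
        have hc' := Bohr_mono (subset_union_left (s₁ := Γ) (s₂ := Γ2)) r2 hc
        rw [two_mul]
        exact Bohr_add Γ ha (Bohr_add Γ hb' hc')
      exact_mod_cast card_le_card this
    · intro χ hχ t' ht'
      rw [mem_Bohr] at ht'
      exact (ht' χ (mem_union_right _ hχ)).trans (r2.trans (half_le h3))

lemma fuel_univ {e : ℕ} (he : 10 ≤ e) (hG : 2 ^ (2 ^ (6 * e)) ≤ Fintype.card G) :
    Fuel (2 ^ e) ((1/2) ^ e) (2 ^ e) (2 ^ e) (univ : Finset G) := by
  have hu : (univ : Finset G) = Bohr ∅ 1 := by ext; simp [mem_Bohr]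
  have h9 : 9 * e ≤ 2 ^ e := by
    induction e, he using Nat.le_induction with
    | base => norm_num
    | succ k hk ih => 
      have : 9 * k ≤ 2 ^ k := ih (le_trans (Nat.pow_le_pow_right (by norm_num)
        (Nat.pow_le_pow_right (by norm_num) (by omega))) hG)
      rw [pow_succ]; omega
  obtain ⟨E, hE⟩ : ∃ E, E = 2 ^ e := ⟨_, rfl⟩
  have hq : 2 * (e + 8 * e * E + 1 + 3) * (E * E) + 1 ≤ 4 * E ^ 4 := by
    rw [← hE] at h9
    have a1 : e + 8 * e * E + 1 + 3 ≤ E * E := by nlinarith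
    have a2 : 2 * (e + 8 * e * E + 1 + 3) * (E * E) ≤ 2 * (E * E) * (E * E) := by gcongr
    have a3 : 1 ≤ E * E * (E * E) := by nlinarith
    nlinarith
  have hE4 : E ^ 4 = 2 ^ (4 * e) := by rw [hE, ← pow_mul]; congr 1; ring
  rw [hu]
  refine fuel_bohr (K := E * E) (H := e + 8 * e * E + 1) (μ := 8 * e) ?_ ?_ _ ∅ e 1 ?_ ?_ le_rfl ?_ ?_
  · rw [← hE]
    calc _ ≤ 4 * E ^ 4 * E * 4 := by gcongr
      _ = 2 ^ (5 * e + 4) := by rw [pow_add, show 5 * e = 4 * e + e by ring, pow_add, ← hE4, ← hE]; ring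
      _ ≤ _ := Nat.pow_le_pow_right (by norm_num) (by omega)
  · refine le_trans ?_ hG
    rw [← pow_add]
    refine Nat.pow_le_pow_right (by norm_num) ?_
    have : (2:ℕ) ^ (6 * e) = E ^ 4 * (E * E) := by rw [hE4, hE, ← pow_add, ← pow_add]; congr 1; ring
    rw [this]
    rw [← hE] at h9
    have : 90 * E ≤ E * E := Nat.mul_le_mul_right _ (by omega)
    have : E ^ 4 * 90 ≤ E ^ 4 * (E * E) := Nat.mul_le_mul_left _ (by nlinarith)
    have : E ≤ E ^ 4 := Nat.le_self_pow (by norm_num) _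
    omega
  · rw [card_empty, zero_add, ← hE]
  · rw [← hE]
  · exact pow_le_one₀ (by norm_num) (by norm_num)
  · have : ∀ ρ, (Bohr (∅ : Finset (AddChar G ℂ)) ρ) = univ := fun ρ => by ext; simp [mem_Bohr]
    rw [this, this]
    have : (0:ℝ) ≤ (1/2) ^ e * (univ : Finset G).card := by positivity
    linarith
end
end Corners

open Finset BigOperators
open scoped Pointwise

namespace Corners
section
variable {G : Type*} [AddCommGroup G] [DecidableEq G]

lemma comm4 {α β γ δ : Type*} (A : Finset α) (B : Finset β) (C : Finset γ) (D : Finset δ)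
    (f : α → β → γ → δ → ℝ) :
    𝔼 a ∈ A, 𝔼 b ∈ B, 𝔼 c ∈ C, 𝔼 d ∈ D, f a b c d
      = 𝔼 c ∈ C, 𝔼 d ∈ D, 𝔼 a ∈ A, 𝔼 b ∈ B, f a b c d := by
  have h1 : ∀ a, 𝔼 b ∈ B, 𝔼 c ∈ C, 𝔼 d ∈ D, f a b c d
      = 𝔼 c ∈ C, 𝔼 d ∈ D, 𝔼 b ∈ B, f a b c d := fun a => by
    rw [expect_comm]
    refine expect_congr rfl fun c _ => ?_
    rw [expect_comm]
  simp only [h1]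
  rw [expect_comm]
  refine expect_congr rfl fun c _ => ?_
  rw [expect_comm]

lemma shift2 {τ : ℝ} {T1 T2 V1 V2 : Finset G} (h1 : Pres τ T1 V1) (h2 : Pres τ T2 V2)
    (s1 : Sy V1) (s2 : Sy V2) (n1 : T1.Nonempty) (n2 : T2.Nonempty) {ψ : G → G → ℝ}
    (hψ : ∀ x y, |ψ x y| ≤ 1) {c d : G} (hc : c ∈ V1) (hd : d ∈ V2) :
    |𝔼 t ∈ T1, 𝔼 t' ∈ T2, ψ (t + c) (t' + d) - 𝔼 t ∈ T1, 𝔼 t' ∈ T2, ψ t t'| ≤ 4 * τ := by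
  have a1 : |𝔼 t ∈ T1, 𝔼 t' ∈ T2, ψ (t + c) (t' + d) - 𝔼 t ∈ T1, 𝔼 t' ∈ T2, ψ (t + c) t'| ≤ 2 * τ :=
    exS_sub_le n1 fun t _ => shift_ex h2 s2 n2 (φ := fun s => ψ (t + c) s) (fun _ => hψ _ _) hd
  have a2 := shift_ex h1 s1 n1 (φ := fun s => 𝔼 t' ∈ T2, ψ s t')
    (fun s => exS_abs_le n2 fun _ _ => hψ _ _) hc
  rw [abs_le] at *
  constructor <;> linarith [a1.1, a1.2, a2.1, a2.2]

lemma avg_shift2 {τ : ℝ} {T1 T2 V1 V2 C D : Finset G} (h1 : Pres τ T1 V1) (h2 : Pres τ T2 V2)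
    (s1 : Sy V1) (s2 : Sy V2) (n1 : T1.Nonempty) (n2 : T2.Nonempty) {ψ : G → G → ℝ}
    (hψ : ∀ x y, |ψ x y| ≤ 1) (hc : C ⊆ V1) (hd : D ⊆ V2) (nC : C.Nonempty) (nD : D.Nonempty) :
    |𝔼 t ∈ T1, 𝔼 t' ∈ T2, 𝔼 c ∈ C, 𝔼 d ∈ D, ψ (t + c) (t' + d) - 𝔼 t ∈ T1, 𝔼 t' ∈ T2, ψ t t'|
      ≤ 4 * τ := by
  rw [comm4]
  have e : 𝔼 t ∈ T1, 𝔼 t' ∈ T2, ψ t t' = 𝔼 _c ∈ C, 𝔼 _d ∈ D, 𝔼 t ∈ T1, 𝔼 t' ∈ T2, ψ t t' := by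
    rw [expect_const nC, expect_const nD]
  rw [e]
  refine exS_sub_le nC fun c hcc => exS_sub_le nD fun d hdd => ?_
  exact shift2 h1 h2 s1 s2 n1 n2 hψ (hc hcc) (hd hdd)

/-- four-fold average -/
noncomputable def L4 (P Q T1 T2 : Finset G) (Φ : G → G → G → G → ℝ) : ℝ :=
  𝔼 ξ ∈ P, 𝔼 υ ∈ Q, 𝔼 t ∈ T1, 𝔼 t' ∈ T2, Φ ξ υ t t'

lemma lin {τ : ℝ} {P Q T1 T2 V : Finset G} (pP : Pres τ P T1) (pQ : Pres τ Q T2)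
    (p1 : Pres τ T1 V) (p2 : Pres τ T2 V) (sP : P.Nonempty) (sQ : Q.Nonempty) (s1 : Sy T1) (s2 : Sy T2)
    (sV : Sy V) {Ψ : G → G → ℝ} (hΨ : ∀ x y, |Ψ x y| ≤ 1) (C D : G → G → Finset G)
    (hC : ∀ ξ υ, C ξ υ ⊆ V) (hD : ∀ ξ υ, D ξ υ ⊆ V) (nC : ∀ ξ υ, (C ξ υ).Nonempty)
    (nD : ∀ ξ υ, (D ξ υ).Nonempty) (x y : G) :
    |L4 P Q T1 T2 (fun ξ υ t t' => 𝔼 c ∈ C ξ υ, 𝔼 d ∈ D ξ υ, Ψ (x + ξ + t + c) (y + υ + t' + d))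
      - 𝔼 ξ ∈ P, 𝔼 υ ∈ Q, Ψ (x + ξ) (y + υ)| ≤ 8 * τ := by
  unfold L4
  have a1 : |𝔼 ξ ∈ P, 𝔼 υ ∈ Q, 𝔼 t ∈ T1, 𝔼 t' ∈ T2, 𝔼 c ∈ C ξ υ, 𝔼 d ∈ D ξ υ,
        Ψ (x + ξ + t + c) (y + υ + t' + d)
      - 𝔼 ξ ∈ P, 𝔼 υ ∈ Q, 𝔼 t ∈ T1, 𝔼 t' ∈ T2, Ψ (x + ξ + t) (y + υ + t')| ≤ 4 * τ := by
    refine exS_sub_le sP fun ξ _ => exS_sub_le sQ fun υ _ => ?_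
    have := avg_shift2 p1 p2 sV sV s1.ne s2.ne (ψ := fun a b => Ψ (x + ξ + a) (y + υ + b))
      (fun _ _ => hΨ _ _) (hC ξ υ) (hD ξ υ) (nC ξ υ) (nD ξ υ)
    simpa only [add_assoc] using this
  have a2 := avg_shift2 pP pQ s1 s2 sP sQ (ψ := fun a b => Ψ (x + a) (y + b))
      (fun _ _ => hΨ _ _) (Subset.refl T1) (Subset.refl T2) s1.ne s2.ne
  simp only [← add_assoc] at a2
  rw [abs_le] at *
  constructor <;> linarith [a1.1, a1.2, a2.1, a2.2]

noncomputable def av (P : Finset G) (U : G → ℝ) (u : G) : ℝ := 𝔼 t ∈ P, U (u + t)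

noncomputable def val (ψ : G → G → ℝ) (X Y Z : G → ℝ) (w : G) (σ : ℝ) (x y : G) (P Q : Finset G) : ℝ :=
  𝔼 ξ ∈ P, 𝔼 υ ∈ Q, ψ (x + ξ) (y + υ)
    + σ * (av P X x ^ 2 + av Q Y y ^ 2 + av P Z (w - x - y) ^ 2)

def B01 (U : G → ℝ) : Prop := ∀ u, 0 ≤ U u ∧ U u ≤ 1

lemma B01.abs {U : G → ℝ} (h : B01 U) (u : G) : |U u| ≤ 1 := by
  rw [abs_of_nonneg (h u).1]; exact (h u).2

lemma B01.av {U : G → ℝ} (h : B01 U) (P : Finset G) : B01 (av P U) := fun u => by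
  constructor
  · exact expect_nonneg fun t _ => (h _).1
  · have := exS_abs_le' (P := P) (f := fun t => U (u + t)) zero_le_one (fun t => h.abs _)
    exact (le_abs_self _).trans this

lemma L4_sq {P Q T1 T2 : Finset G} (sP : P.Nonempty) (sQ : Q.Nonempty) (s1 : T1.Nonempty)
    (s2 : T2.Nonempty) (u : G → G → G → G → ℝ) {b r : ℝ} (hb : 0 ≤ b) (hb1 : b ≤ 1)
    (h : |L4 P Q T1 T2 u - b| ≤ r) :
    b ^ 2 - 2 * r + L4 P Q T1 T2 (fun ξ υ t t' => (u ξ υ t t' - b) ^ 2)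
      ≤ L4 P Q T1 T2 (fun ξ υ t t' => u ξ υ t t' ^ 2) := by
  have e : L4 P Q T1 T2 (fun ξ υ t t' => u ξ υ t t' ^ 2)
      = L4 P Q T1 T2 (fun ξ υ t t' => (u ξ υ t t' - b) ^ 2) + 2 * b * L4 P Q T1 T2 u - b ^ 2 := by
    have : ∀ ξ υ t t', u ξ υ t t' ^ 2 = (u ξ υ t t' - b) ^ 2 + 2 * b * u ξ υ t t' - b ^ 2 := by
      intros; ring
    unfold L4
    simp only [this, expect_sub_distrib, expect_add_distrib, ← mul_expect, expect_const sP,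
      expect_const sQ, expect_const s1, expect_const s2]
  rw [e]
  rw [abs_le] at h
  nlinarith [h.1, h.2]

variable [Fintype G] {N M : ℕ} {τ : ℝ}

lemma gain_exists {n : ℕ} {P Q T1 T2 V : Finset G} {X Y Z : G → ℝ} (hX : B01 X) (hY : B01 Y)
    (hZ : B01 Z) {ψ : G → G → ℝ} (hψ : ∀ x y, |ψ x y| ≤ 1) (w : G) {σ θ ρ : ℝ} (σ0 : 0 ≤ σ)
    (σ1 : σ ≤ 1) (ρ0 : 0 ≤ ρ) (τ0 : 0 ≤ τ)
    (sP : Sy P) (sQ : Sy Q) (s1 : Sy T1) (s2 : Sy T2) (pPQ : Pres τ P Q) (t1Q : T1 ⊆ Q)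
    (pQ : Pres τ Q T2) (p1 : Pres τ T1 V) (p2 : Pres τ T2 V)
    (fV : Fuel N τ M (n + 2) V) (x y : G) (Bad : G → G → Prop)
    (hbad : ∀ ξ υ, Bad ξ υ → ∃ Γ : Finset (AddChar G ℂ), Γ.card ≤ N ∧ ∀ C D : Finset G,
      C ⊆ V → D ⊆ V → Sy C → Sy D → (∀ χ ∈ Γ, ∀ t ∈ C, ‖χ t - 1‖ ≤ τ) →
      (∀ χ ∈ Γ, ∀ t ∈ D, ‖χ t - 1‖ ≤ τ) →
      ρ ≤ 𝔼 t ∈ T1, 𝔼 t' ∈ T2, ((av C X (x + ξ + t) - av P X x) ^ 2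
        + (av D Y (y + υ + t') - av Q Y y) ^ 2
        + (av C Z (w - (x + ξ + t) - (y + υ + t')) - av P Z (w - x - y)) ^ 2))
    (hθ : θ ≤ 𝔼 ξ ∈ P, 𝔼 υ ∈ Q, I (Bad ξ υ)) :
    ∃ (x' y' : G) (C D : Finset G), D ⊆ C ∧ Sy C ∧ Fuel N τ M n D ∧ Pres τ C D ∧
      val ψ X Y Z w σ x y P Q + σ * (θ * ρ) - 100 * τ ≤ val ψ X Y Z w σ x' y' C D := by
  classical
  have ch : ∀ ξ υ, ∃ C D : Finset G, C ⊆ V ∧ D ⊆ C ∧ Sy C ∧ Sy D ∧ Fuel N τ M n D ∧ Pres τ C D ∧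
      ρ * I (Bad ξ υ) ≤ 𝔼 t ∈ T1, 𝔼 t' ∈ T2, ((av C X (x + ξ + t) - av P X x) ^ 2
        + (av D Y (y + υ + t') - av Q Y y) ^ 2
        + (av C Z (w - (x + ξ + t) - (y + υ + t')) - av P Z (w - x - y)) ^ 2) := by
    intro ξ υ
    by_cases hb : Bad ξ υ
    · obtain ⟨Γ, hΓ, hg⟩ := hbad ξ υ hb
      obtain ⟨C, hC, fC, -, hCΓ⟩ := fV.2 Γ hΓ
      obtain ⟨D, hD, fD, pCD⟩ := fC.next
      refine ⟨C, D, hC, hD, fC.sy, fD.sy, fD, pCD, ?_⟩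
      rw [I_true hb, mul_one]
      exact hg C D hC (hD.trans hC) fC.sy fD.sy hCΓ (fun χ hχ t ht => hCΓ χ hχ t (hD ht))
    · obtain ⟨C, hC, fC, -⟩ := fV.next
      obtain ⟨D, hD, fD, pCD⟩ := fC.next
      refine ⟨C, D, hC, hD, fC.sy, fD.sy, fD, pCD, ?_⟩
      rw [I_false hb, mul_zero]
      exact expect_nonneg fun _ _ => expect_nonneg fun _ _ => by positivity
  choose C D hC hD sC sD fD pCD hgain using ch
  have hDV : ∀ ξ υ, D ξ υ ⊆ V := fun ξ υ => (hD ξ υ).trans (hC ξ υ)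
  have nC : ∀ ξ υ, (C ξ υ).Nonempty := fun ξ υ => (sC ξ υ).ne
  have nD : ∀ ξ υ, (D ξ υ).Nonempty := fun ξ υ => (sD ξ υ).ne
  have pP1 : Pres τ P T1 := pPQ.mono t1Q
  have sV := fV.sy
  -- first order terms
  have lψ := lin pP1 pQ p1 p2 sP.ne sQ.ne s1 s2 sV hψ C D hC hDV nC nD x y
  have lX := lin pP1 pQ p1 p2 sP.ne sQ.ne s1 s2 sV (Ψ := fun a _ => X a) (fun a _ => hX.abs a)
    C D hC hDV nC nD x y
  have lY := lin pP1 pQ p1 p2 sP.ne sQ.ne s1 s2 sV (Ψ := fun _ a => Y a) (fun _ a => hY.abs a)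
    C D hC hDV nC nD x y
  have lZ := lin pP1 pQ p1 p2 sP.ne sQ.ne s1 s2 sV (Ψ := fun a b => Z (w - a - b))
    (fun a b => hZ.abs _) C (fun _ _ => {0}) hC (fun _ _ => by simpa using sV.1) nC
    (fun _ _ => ⟨0, by simp⟩) x y
  simp only [expect_const (nD _ _)] at lX
  simp only [expect_const (nC _ _)] at lY
  rw [show (𝔼 ξ ∈ P, 𝔼 _υ ∈ Q, X (x + ξ)) = av P X x by
    unfold av; refine expect_congr rfl fun ξ _ => ?_; rw [expect_const sQ.ne]] at lX
  rw [show (𝔼 _ξ ∈ P, 𝔼 υ ∈ Q, Y (y + υ)) = av Q Y y by rw [expect_const sP.ne]; rfl] at lY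
  have zz : |𝔼 ξ ∈ P, 𝔼 υ ∈ Q, Z (w - (x + ξ) - (y + υ)) - av P Z (w - x - y)| ≤ 2 * τ := by
    rw [expect_comm]
    have : av P Z (w - x - y) = 𝔼 _υ ∈ Q, 𝔼 ξ ∈ P, Z (w - x - y - ξ) := by
      rw [expect_const sQ.ne]; unfold av
      rw [← exS_neg sP]; simp only [sub_eq_add_neg]
    rw [this]
    refine exS_sub_le sQ.ne fun υ hυ => ?_
    have := shift_ex pPQ sQ sP.ne (φ := fun s => Z (w - x - y - s)) (fun _ => hZ.abs _) hυ
    convert this using 3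
    refine expect_congr rfl fun ξ _ => ?_
    congr 1; abel
  have lZ' : |L4 P Q T1 T2 (fun ξ υ t t' => av (C ξ υ) Z (w - (x + ξ + t) - (y + υ + t')))
      - av P Z (w - x - y)| ≤ 10 * τ := by
    have e : L4 P Q T1 T2 (fun ξ υ t t' => 𝔼 c ∈ C ξ υ, 𝔼 d ∈ ({0} : Finset G),
          Z (w - (x + ξ + t + c) - (y + υ + t' + d)))
        = L4 P Q T1 T2 (fun ξ υ t t' => av (C ξ υ) Z (w - (x + ξ + t) - (y + υ + t'))) := by
      unfold L4
      refine expect_congr rfl fun ξ _ => expect_congr rfl fun υ _ => expect_congr rfl fun t _ =>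
        expect_congr rfl fun t' _ => ?_
      beta_reduce
      unfold av
      rw [← exS_neg (sC ξ υ) (fun c => Z (w - (x + ξ + t) - (y + υ + t') + c))]
      refine expect_congr rfl fun c _ => ?_
      rw [expect_singleton]
      congr 1; abel
    rw [e] at lZ
    rw [abs_le] at *
    constructor <;> linarith [lZ.1, lZ.2, zz.1, zz.2]
  have bX := (hX.av P) x
  have bY := (hY.av Q) y
  have bZ := (hZ.av P) (w - x - y)
  have qX := L4_sq sP.ne sQ.ne s1.ne s2.ne (fun ξ υ t t' => av (C ξ υ) X (x + ξ + t)) bX.1 bX.2 lX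
  have qY := L4_sq sP.ne sQ.ne s1.ne s2.ne (fun ξ υ t t' => av (D ξ υ) Y (y + υ + t')) bY.1 bY.2 lY
  have qZ := L4_sq sP.ne sQ.ne s1.ne s2.ne _ bZ.1 bZ.2 lZ'
  have hE : θ * ρ ≤ L4 P Q T1 T2 (fun ξ υ t t' => (av (C ξ υ) X (x + ξ + t) - av P X x) ^ 2)
      + L4 P Q T1 T2 (fun ξ υ t t' => (av (D ξ υ) Y (y + υ + t') - av Q Y y) ^ 2)
      + L4 P Q T1 T2 (fun ξ υ t t' =>
          (av (C ξ υ) Z (w - (x + ξ + t) - (y + υ + t')) - av P Z (w - x - y)) ^ 2) := by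
    unfold L4
    simp only [← expect_add_distrib]
    calc θ * ρ ≤ (𝔼 ξ ∈ P, 𝔼 υ ∈ Q, I (Bad ξ υ)) * ρ := by gcongr
      _ = 𝔼 ξ ∈ P, 𝔼 υ ∈ Q, ρ * I (Bad ξ υ) := by simp only [← mul_expect]; ring
      _ ≤ _ := expect_le_expect fun ξ _ => expect_le_expect fun υ _ => hgain ξ υ
  have hL : val ψ X Y Z w σ x y P Q + σ * (θ * ρ) - 100 * τ
      ≤ L4 P Q T1 T2 (fun ξ υ t t' => val ψ X Y Z w σ (x + ξ + t) (y + υ + t') (C ξ υ) (D ξ υ)) := by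
    have e : L4 P Q T1 T2 (fun ξ υ t t' => val ψ X Y Z w σ (x + ξ + t) (y + υ + t') (C ξ υ) (D ξ υ))
        = L4 P Q T1 T2 (fun ξ υ t t' => 𝔼 c ∈ C ξ υ, 𝔼 d ∈ D ξ υ, ψ (x + ξ + t + c) (y + υ + t' + d))
        + σ * (L4 P Q T1 T2 (fun ξ υ t t' => av (C ξ υ) X (x + ξ + t) ^ 2)
        + L4 P Q T1 T2 (fun ξ υ t t' => av (D ξ υ) Y (y + υ + t') ^ 2)
        + L4 P Q T1 T2 (fun ξ υ t t' => av (C ξ υ) Z (w - (x + ξ + t) - (y + υ + t')) ^ 2)) := by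
      unfold L4 val
      simp only [expect_add_distrib, ← mul_expect]
    rw [e]
    unfold val
    rw [abs_le] at lψ
    have lo := mul_le_mul_of_nonneg_left (add_le_add (add_le_add qX qY) qZ) σ0
    have lo2 := mul_le_mul_of_nonneg_left hE σ0
    have : σ * τ ≤ τ := by nlinarith
    nlinarith [lψ.1, lψ.2]
  unfold L4 at hL
  obtain ⟨ξ, -, h⟩ := exists_ge_of_exS sP.ne hL
  obtain ⟨υ, -, h⟩ := exists_ge_of_exS sQ.ne h
  obtain ⟨t, -, h⟩ := exists_ge_of_exS s1.ne h
  obtain ⟨t', -, h⟩ := exists_ge_of_exS s2.ne h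
  exact ⟨x + ξ + t, y + υ + t', C ξ υ, D ξ υ, hD ξ υ, sC ξ υ, fD ξ υ, pCD ξ υ, h⟩
end
end Corners

open Finset BigOperators
open scoped Pointwise

namespace Corners
section
variable {G : Type*} [AddCommGroup G] [DecidableEq G]

def CutS (T B : Finset G) (φ : G → G → ℝ) (ε : ℝ) : Prop :=
  ∀ a b : G → ℝ, (∀ x, |a x| ≤ 1) → (∀ x, |b x| ≤ 1) →
    |𝔼 η ∈ T, 𝔼 υ ∈ B, φ η υ * (a η * b υ)| ≤ ε

structure Okay (X Y Z : G → ℝ) (bx b_y bz ε : ℝ) (x1 y1 z1 : G) (W1 W2 W3 : Finset G) : Prop where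
  vX : |av W1 X x1 - bx| ≤ ε
  vY : |av W2 Y y1 - b_y| ≤ ε
  vZ : |av W3 Z z1 - bz| ≤ ε
  cZ : CutS W1 W2 (fun η υ => Z (z1 - η - υ) - bz) ε
  cX : CutS W2 W3 (fun υ ζ => X (x1 - υ - ζ) - bx) ε
  cY : CutS W1 W3 (fun η ζ => Y (y1 - η - ζ) - b_y) ε

variable [Fintype G] {N M : ℕ} {τ : ℝ}

structure Chain (N : ℕ) (τ : ℝ) (M n : ℕ) (P Q W1 W2 W3 : Finset G) : Prop where
  sP : Sy P
  sQ : Sy Q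
  s1 : Sy W1
  s2 : Sy W2
  s3 : Sy W3
  iQ : Q ⊆ P
  i1 : W1 ⊆ Q
  i2 : W2 ⊆ W1
  i3 : W3 ⊆ W2
  pQ : Pres τ P Q
  p1 : Pres τ Q W1
  p2 : Pres τ W1 W2
  p3 : Pres τ W2 W3
  f2 : Fuel N τ M n W2
  f3 : Fuel N τ M n W3

def Inc (N : ℕ) (τ : ℝ) (V T : Finset G) (U : G → ℝ) (u : G) (b ρ : ℝ) : Prop :=
  ∃ Γ : Finset (AddChar G ℂ), Γ.card ≤ N ∧ ∀ C : Finset G, C ⊆ V → Sy C →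
    (∀ χ ∈ Γ, ∀ t ∈ C, ‖χ t - 1‖ ≤ τ) → ρ ≤ 𝔼 t ∈ T, (av C U (u + t) - b) ^ 2

lemma inc_var {V T : Finset G} {U : G → ℝ} {u : G} {b ε : ℝ} (hU : B01 U) (sT : Sy T) (sV : Sy V)
    (p : Pres τ T V) (hε : 0 < ε) (hτ : 4 * τ ≤ ε) (h : ¬ |av T U u - b| ≤ ε) :
    Inc N τ V T U u b (ε ^ 2 / 4) := by
  refine ⟨∅, by simp, fun C hC sC _ => ?_⟩
  have h1 : |𝔼 t ∈ T, av C U (u + t) - av T U u| ≤ 2 * τ := by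
    unfold av
    rw [expect_comm]
    have e : 𝔼 t ∈ T, U (u + t) = 𝔼 _c ∈ C, 𝔼 t ∈ T, U (u + t) := by rw [expect_const sC.ne]
    rw [e]
    refine exS_sub_le sC.ne fun c hc => ?_
    have := shift_ex p sV sT.ne (φ := fun s => U (u + s)) (fun _ => hU.abs _) (hC hc)
    simpa only [add_assoc] using this
  have h2 : ε / 2 ≤ |𝔼 t ∈ T, (av C U (u + t) - b)| := by
    rw [expect_sub_distrib, expect_const sT.ne]
    push Not at h
    have := abs_sub_abs_le_abs_sub (av T U u - b) (𝔼 t ∈ T, av C U (u + t) - b)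
    have e : av T U u - b - (𝔼 t ∈ T, av C U (u + t) - b) = -(𝔼 t ∈ T, av C U (u + t) - av T U u) := by
      ring
    rw [e, abs_neg] at this
    linarith
  have h3 := exS_sq_le T (fun t => av C U (u + t) - b)
  have h4 := pow_le_pow_left₀ (by positivity) h2 2
  rw [sq_abs] at h4
  linarith [h4, h3]

lemma inc_cut {T B V : Finset G} {U : G → ℝ} {u : G} {b ε : ℝ} (hU : B01 U) (hb : 0 ≤ b)
    (hb1 : b ≤ 1) (sT : Sy T) (sB : Sy B) (sV : Sy V) (hVB : V ⊆ B)
    (pT : Pres τ T B) (pB : Pres τ B V) (hε : 0 < ε) (hε1 : ε ≤ 1) (hτ0 : 0 ≤ τ)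
    (hτ : τ ≤ ε ^ 3 / 2048) (hN : 128 ≤ N * ε ^ 2)
    (h : ¬ CutS T B (fun η υ => U (u - η - υ) - b) ε) :
    Inc N τ V T U u b (ε ^ 2 / 4) := by
  unfold CutS at h
  push Not at h
  obtain ⟨a, c, ha, hc, h⟩ := h
  have key : ε ^ 2 ≤ 𝔼 η ∈ T, (𝔼 υ ∈ B, c υ * (fun v => U v - b) (u - η - υ)) ^ 2 := by
    have e : 𝔼 η ∈ T, 𝔼 υ ∈ B, (U (u - η - υ) - b) * (a η * c υ)
        = 𝔼 η ∈ T, a η * 𝔼 υ ∈ B, c υ * (U (u - η - υ) - b) := by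
      refine expect_congr rfl fun η _ => ?_
      rw [mul_expect]
      refine expect_congr rfl fun υ _ => by ring
    rw [e] at h
    have h2 := exS_sq_le T (fun η => a η * 𝔼 υ ∈ B, c υ * (U (u - η - υ) - b))
    have h3 : ε ^ 2 ≤ (𝔼 η ∈ T, a η * 𝔼 υ ∈ B, c υ * (U (u - η - υ) - b)) ^ 2 := by
      rw [← sq_abs (𝔼 η ∈ T, a η * 𝔼 υ ∈ B, c υ * (U (u - η - υ) - b))]
      exact pow_le_pow_left₀ hε.le h.le 2
    refine (h3.trans h2).trans (expect_le_expect fun η _ => ?_)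
    rw [mul_pow]
    have : a η ^ 2 ≤ 1 := by rw [← sq_abs]; exact pow_le_one₀ (abs_nonneg _) (ha η)
    exact mul_le_of_le_one_left (sq_nonneg _) this
  obtain ⟨Γ, hΓ, hg⟩ := energy sT.ne sB sV hVB pT pB (F := fun v => U v - b) (b := c)
    (fun v => by rw [abs_le]; constructor <;> linarith [(hU v).1, (hU v).2]) hc u hε hε1 hτ0 hτ key
  refine ⟨Γ, ?_, fun C hC sC hs => ?_⟩
  · have : (Γ.card : ℝ) ≤ N := by
      have : (0:ℝ) < ε ^ 2 := by positivity
      nlinarith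
    exact_mod_cast this
  · have := hg C hC sC.ne hs
    rw [← exS_neg sT] at this
    refine this.trans (le_of_eq ?_)
    refine expect_congr rfl fun t _ => ?_
    congr 1
    rw [expect_sub_distrib, expect_const sC.ne]
    congr 1
    unfold av
    rw [← exS_neg sC (fun c => U (u + t + c))]
    refine expect_congr rfl fun c _ => ?_
    congr 1; abel

lemma hbadX {V T1 T2 P Q : Finset G} {X Y Z : G → ℝ} {x y w ξ υ : G} {bx b_y bz ρ : ℝ}
    (s2 : T2.Nonempty) (h : Inc N τ V T1 X (x + ξ) bx ρ) : ∃ Γ : Finset (AddChar G ℂ), Γ.card ≤ N ∧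
    ∀ C D : Finset G,
      C ⊆ V → D ⊆ V → Sy C → Sy D → (∀ χ ∈ Γ, ∀ t ∈ C, ‖χ t - 1‖ ≤ τ) →
      (∀ χ ∈ Γ, ∀ t ∈ D, ‖χ t - 1‖ ≤ τ) →
      ρ ≤ 𝔼 t ∈ T1, 𝔼 t' ∈ T2, ((av C X (x + ξ + t) - bx) ^ 2
        + (av D Y (y + υ + t') - b_y) ^ 2
        + (av C Z (w - (x + ξ + t) - (y + υ + t')) - bz) ^ 2) := by
  obtain ⟨Γ, hΓ, h⟩ := h
  refine ⟨Γ, hΓ, fun C D hC hD sC sD c d => (h C hC sC c).trans ?_⟩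
  refine expect_le_expect fun t _ => ?_
  rw [← expect_const s2 ((av C X (x + ξ + t) - bx) ^ 2)]
  refine expect_le_expect fun t' _ => ?_
  rw [expect_const s2]
  nlinarith [sq_nonneg (av D Y (y + υ + t') - b_y), sq_nonneg (av C Z (w - (x + ξ + t) - (y + υ + t')) - bz)]

lemma hbadY {V T1 T2 P Q : Finset G} {X Y Z : G → ℝ} {x y w ξ υ : G} {bx b_y bz ρ : ℝ}
    (s1 : T1.Nonempty) (h : Inc N τ V T2 Y (y + υ) b_y ρ) : ∃ Γ : Finset (AddChar G ℂ), Γ.card ≤ N ∧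
    ∀ C D : Finset G,
      C ⊆ V → D ⊆ V → Sy C → Sy D → (∀ χ ∈ Γ, ∀ t ∈ C, ‖χ t - 1‖ ≤ τ) →
      (∀ χ ∈ Γ, ∀ t ∈ D, ‖χ t - 1‖ ≤ τ) →
      ρ ≤ 𝔼 t ∈ T1, 𝔼 t' ∈ T2, ((av C X (x + ξ + t) - bx) ^ 2
        + (av D Y (y + υ + t') - b_y) ^ 2
        + (av C Z (w - (x + ξ + t) - (y + υ + t')) - bz) ^ 2) := by
  obtain ⟨Γ, hΓ, h⟩ := h
  refine ⟨Γ, hΓ, fun C D hC hD sC sD c d => (h D hD sD d).trans ?_⟩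
  rw [← expect_const s1 (𝔼 t ∈ T2, (av D Y (y + υ + t) - b_y) ^ 2)]
  refine expect_le_expect fun t _ => expect_le_expect fun t' _ => ?_
  nlinarith [sq_nonneg (av C X (x + ξ + t) - bx), sq_nonneg (av C Z (w - (x + ξ + t) - (y + υ + t')) - bz)]

lemma hbadZ {V T1 T2 P Q : Finset G} {X Y Z : G → ℝ} {x y w ξ υ : G} {bx b_y bz ρ : ℝ} (hZ : B01 Z)
    (hb : 0 ≤ bz) (hb1 : bz ≤ 1) (s1 : Sy T1) (s2 : Sy T2) (p : Pres τ T1 T2)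
    (h : Inc N τ V T1 Z (w - (x + ξ) - (y + υ)) bz ρ) : ∃ Γ : Finset (AddChar G ℂ), Γ.card ≤ N ∧
    ∀ C D : Finset G,
      C ⊆ V → D ⊆ V → Sy C → Sy D → (∀ χ ∈ Γ, ∀ t ∈ C, ‖χ t - 1‖ ≤ τ) →
      (∀ χ ∈ Γ, ∀ t ∈ D, ‖χ t - 1‖ ≤ τ) →
      ρ - 2 * τ ≤ 𝔼 t ∈ T1, 𝔼 t' ∈ T2, ((av C X (x + ξ + t) - bx) ^ 2
        + (av D Y (y + υ + t') - b_y) ^ 2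
        + (av C Z (w - (x + ξ + t) - (y + υ + t')) - bz) ^ 2) := by
  obtain ⟨Γ, hΓ, h⟩ := h
  refine ⟨Γ, hΓ, fun C D hC hD sC sD c d => ?_⟩
  have h1 := h C hC sC c
  rw [← exS_neg s1] at h1
  have h2 : ρ - 2 * τ ≤ 𝔼 t ∈ T1, 𝔼 t' ∈ T2, (av C Z (w - (x + ξ + t) - (y + υ + t')) - bz) ^ 2 := by
    rw [expect_comm]
    rw [← expect_const s2.ne (ρ - 2 * τ)]
    refine expect_le_expect fun t' ht' => ?_
    have := shift_ex p s2 s1.ne (φ := fun s => (av C Z (w - (x + ξ) - (y + υ) + -s) - bz) ^ 2)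
      (fun s => by
        have := (hZ.av C) (w - (x + ξ) - (y + υ) + -s)
        rw [abs_of_nonneg (sq_nonneg _)]; nlinarith) ht'
    rw [abs_le] at this
    have e : 𝔼 t ∈ T1, (av C Z (w - (x + ξ + t) - (y + υ + t')) - bz) ^ 2
      = 𝔼 s ∈ T1, (av C Z (w - (x + ξ) - (y + υ) + -(s + t')) - bz) ^ 2 := by
      refine expect_congr rfl fun s _ => ?_
      congr 3; abel
    rw [e]
    linarith [this.1]
  refine h2.trans (expect_le_expect fun t _ => expect_le_expect fun t' _ => ?_)
  nlinarith [sq_nonneg (av C X (x + ξ + t) - bx), sq_nonneg (av D Y (y + υ + t') - b_y)]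

set_option maxHeartbeats 1600000 in
lemma unif_step {n : ℕ} {P Q : Finset G} {X Y Z : G → ℝ} (hX : B01 X) (hY : B01 Y)
    (hZ : B01 Z) {ψ : G → G → ℝ} (hψ : ∀ x y, |ψ x y| ≤ 1) (w : G) {σ θ ε : ℝ} (σ0 : 0 ≤ σ)
    (σ1 : σ ≤ 1) (hε : 0 < ε) (hε1 : ε ≤ 1) (hτ0 : 0 ≤ τ)
    (hτ : τ ≤ ε ^ 3 / 2048) (hτ2 : 1000 * τ ≤ σ * (θ * ε ^ 2)) (hN : 128 ≤ N * ε ^ 2)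
    (hθ0 : 0 ≤ θ)
    (sP : Sy P) (iQ : Q ⊆ P) (pQ : Pres τ P Q) (fQ : Fuel N τ M (n + 7) Q) (x y : G) :
    (∃ W1 W2 W3 : Finset G, Chain N τ M n P Q W1 W2 W3 ∧
      𝔼 ξ ∈ P, 𝔼 υ ∈ Q, I (¬ Okay X Y Z (av P X x) (av Q Y y) (av P Z (w - x - y)) ε (x + ξ) (y + υ)
        (w - (x + ξ) - (y + υ)) W1 W2 W3) ≤ 6 * θ) ∨
    ∃ (x' y' : G) (C D : Finset G), D ⊆ C ∧ Sy C ∧ Fuel N τ M n D ∧ Pres τ C D ∧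
      val ψ X Y Z w σ x y P Q + σ * (θ * ε ^ 2) / 20 ≤ val ψ X Y Z w σ x' y' C D := by
  classical
  have sQ := fQ.sy
  obtain ⟨W1, i1, f1, p1⟩ := fQ.next
  obtain ⟨W2, i2, f2, p2⟩ := f1.next
  obtain ⟨W3, i3, f3, p3⟩ := f2.next
  obtain ⟨W4, i4, f4, p4⟩ := f3.next
  obtain ⟨V, i5, f5, p5⟩ := f4.next
  have h4V : V ⊆ W4 := i5
  have h3V : V ⊆ W3 := i5.trans i4
  have h2V : V ⊆ W2 := h3V.trans i3
  have ε3 : ε ^ 3 ≤ ε ^ 2 := by nlinarith [mul_nonneg (sq_nonneg ε) (sub_nonneg.2 hε1)]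
  have ε2 : ε ^ 2 ≤ ε := by nlinarith
  have h4τ : 4 * τ ≤ ε := by linarith
  by_contra hcon
  push Not at hcon
  obtain ⟨hc1, hc2⟩ := hcon
  have hc1 := hc1 W1 W2 W3 ⟨sP, sQ, f1.sy, f2.sy, f3.sy, iQ, i1, i2, i3, pQ, p1, p2, p3,
    f2.le (by omega), f3.le (by omega)⟩
  have bX := (hX.av P) x
  have bY := (hY.av Q) y
  have bZ := (hZ.av P) (w - x - y)
  obtain ⟨bx, ebx⟩ : ∃ b, b = av P X x := ⟨_, rfl⟩
  obtain ⟨b_y, eby⟩ : ∃ b, b = av Q Y y := ⟨_, rfl⟩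
  obtain ⟨bz, ebz⟩ : ∃ b, b = av P Z (w - x - y) := ⟨_, rfl⟩
  -- generic contradiction
  have gen : ∀ (T1 T2 : Finset G) (Bad : G → G → Prop), Sy T1 → Sy T2 → T1 ⊆ Q → Pres τ Q T2 →
      Pres τ T1 V → Pres τ T2 V → (∀ ξ υ, Bad ξ υ → ∃ Γ : Finset (AddChar G ℂ), Γ.card ≤ N ∧
      ∀ C D : Finset G, C ⊆ V → D ⊆ V → Sy C → Sy D → (∀ χ ∈ Γ, ∀ t ∈ C, ‖χ t - 1‖ ≤ τ) →
      (∀ χ ∈ Γ, ∀ t ∈ D, ‖χ t - 1‖ ≤ τ) →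
      ε ^ 2 / 4 - 2 * τ ≤ 𝔼 t ∈ T1, 𝔼 t' ∈ T2, ((av C X (x + ξ + t) - av P X x) ^ 2
        + (av D Y (y + υ + t') - av Q Y y) ^ 2
        + (av C Z (w - (x + ξ + t) - (y + υ + t')) - av P Z (w - x - y)) ^ 2)) →
      𝔼 ξ ∈ P, 𝔼 υ ∈ Q, I (Bad ξ υ) ≤ θ := by
    intro T1 T2 Bad s1 s2 t1 t2 v1 v2 hb
    by_contra hh
    push Not at hh
    obtain ⟨x', y', C, D, hD, sC, fD, pD, hv⟩ := gain_exists (n := n) hX hY hZ hψ w σ0 σ1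
      (by nlinarith) hτ0 sP sQ s1 s2 pQ t1 t2 v1 v2 (f5.le (by omega)) x y Bad hb hh.le
    have := hc2 x' y' C D hD sC fD pD
    have h1 : ε ^ 2 / 5 ≤ ε ^ 2 / 4 - 2 * τ := by nlinarith
    have h2 : σ * (θ * (ε ^ 2 / 5)) ≤ σ * (θ * (ε ^ 2 / 4 - 2 * τ)) := by gcongr
    have h3 : σ * (θ * (ε ^ 2 / 5)) = σ * (θ * ε ^ 2) / 5 := by ring
    linarith
  have weak : ∀ {a : ℝ}, ε ^ 2 / 4 ≤ a → ε ^ 2 / 4 - 2 * τ ≤ a := fun h => by linarith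
  have g1 := gen W1 W4 (fun ξ υ => ¬ |av W1 X (x + ξ) - av P X x| ≤ ε) f1.sy f4.sy i1
    (p1.mono (i4.trans (i3.trans i2))) (p2.mono h2V) p5 (fun ξ υ h => by
      obtain ⟨Γ, h1, h2⟩ := hbadX (N := N) (P := P) (Q := Q) (Y := Y) (Z := Z) (y := y) (w := w) (υ := υ)
        (b_y := av Q Y y) (bz := av P Z (w - x - y)) f4.sy.ne
        (inc_var hX f1.sy f5.sy (p2.mono h2V) hε h4τ h)
      exact ⟨Γ, h1, fun C D a b c d e f => weak (h2 C D a b c d e f)⟩)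
  have g2 := gen W4 W2 (fun ξ υ => ¬ |av W2 Y (y + υ) - av Q Y y| ≤ ε) f4.sy f2.sy
    (i4.trans (i3.trans (i2.trans i1)))
    (p1.mono i2) p5 (p3.mono h3V) (fun ξ υ h => by
      obtain ⟨Γ, h1, h2⟩ := hbadY (N := N) (P := P) (Q := Q) (X := X) (Z := Z) (x := x) (w := w) (ξ := ξ)
        (bx := av P X x) (bz := av P Z (w - x - y)) f4.sy.ne
        (inc_var hY f2.sy f5.sy (p3.mono h3V) hε h4τ h)
      exact ⟨Γ, h1, fun C D a b c d e f => weak (h2 C D a b c d e f)⟩)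
  have g3 := gen W3 W4 (fun ξ υ => ¬ |av W3 Z (w - (x + ξ) - (y + υ)) - av P Z (w - x - y)| ≤ ε)
    f3.sy f4.sy (i3.trans (i2.trans i1))
    (p1.mono (i4.trans (i3.trans i2))) (p4.mono h4V) p5 (fun ξ υ h => 
      hbadZ (N := N) (P := P) (Q := Q) hZ bZ.1 bZ.2 f3.sy f4.sy p4
        (inc_var hZ f3.sy f5.sy (p4.mono h4V) hε h4τ h))
  have g4 := gen W1 W4 (fun ξ υ => ¬ CutS W1 W2 (fun η υ' => Z (w - (x + ξ) - (y + υ) - η - υ')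
      - av P Z (w - x - y)) ε) f1.sy f4.sy i1
    (p1.mono (i4.trans (i3.trans i2))) (p2.mono h2V) p5 (fun ξ υ h => 
      hbadZ (N := N) (P := P) (Q := Q) hZ bZ.1 bZ.2 f1.sy f4.sy (p2.mono (i4.trans i3))
        (inc_cut hZ bZ.1 bZ.2 f1.sy f2.sy f5.sy h2V p2 (p3.mono h3V) hε hε1 hτ0 hτ hN h))
  have g5 := gen W2 W4 (fun ξ υ => ¬ CutS W2 W3 (fun η υ' => X (x + ξ - η - υ')
      - av P X x) ε) f2.sy f4.sy (i2.trans i1)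
    (p1.mono (i4.trans (i3.trans i2))) (p3.mono h3V) p5 (fun ξ υ h => by
      obtain ⟨Γ, h1, h2⟩ := hbadX (N := N) (P := P) (Q := Q) (Y := Y) (Z := Z) (y := y) (w := w) (υ := υ)
        (b_y := av Q Y y) (bz := av P Z (w - x - y)) f4.sy.ne
        (inc_cut hX bX.1 bX.2 f2.sy f3.sy f5.sy h3V p3 (p4.mono h4V) hε hε1 hτ0 hτ hN h)
      exact ⟨Γ, h1, fun C D a b c d e f => weak (h2 C D a b c d e f)⟩)
  have g6 := gen W4 W1 (fun ξ υ => ¬ CutS W1 W3 (fun η υ' => Y (y + υ - η - υ')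
      - av Q Y y) ε) f4.sy f1.sy (i4.trans (i3.trans (i2.trans i1)))
    p1 p5 (p2.mono h2V) (fun ξ υ h => by
      obtain ⟨Γ, h1, h2⟩ := hbadY (N := N) (P := P) (Q := Q) (X := X) (Z := Z) (x := x) (w := w) (ξ := ξ)
        (bx := av P X x) (bz := av P Z (w - x - y)) f4.sy.ne
        (inc_cut hY bY.1 bY.2 f1.sy f3.sy f5.sy h3V (p2.mono i3) (p4.mono h4V) hε hε1 hτ0 hτ hN h)
      exact ⟨Γ, h1, fun C D a b c d e f => weak (h2 C D a b c d e f)⟩)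
  have un : 𝔼 ξ ∈ P, 𝔼 υ ∈ Q, I (¬ Okay X Y Z (av P X x) (av Q Y y) (av P Z (w - x - y)) ε (x + ξ) (y + υ)
        (w - (x + ξ) - (y + υ)) W1 W2 W3) ≤ 𝔼 ξ ∈ P, 𝔼 υ ∈ Q, (
        I (¬ |av W1 X (x + ξ) - av P X x| ≤ ε) + I (¬ |av W2 Y (y + υ) - av Q Y y| ≤ ε)
        + I (¬ |av W3 Z (w - (x + ξ) - (y + υ)) - av P Z (w - x - y)| ≤ ε)
        + I (¬ CutS W1 W2 (fun η υ' => Z (w - (x + ξ) - (y + υ) - η - υ') - av P Z (w - x - y)) ε)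
        + I (¬ CutS W2 W3 (fun η υ' => X (x + ξ - η - υ') - av P X x) ε)
        + I (¬ CutS W1 W3 (fun η υ' => Y (y + υ - η - υ') - av Q Y y) ε)) := by
    refine expect_le_expect fun ξ _ => expect_le_expect fun υ _ => ?_
    have key : ∀ (A B C D E F O : Prop), (A → B → C → D → E → F → O) →
        I (¬ O) ≤ I (¬ A) + I (¬ B) + I (¬ C) + I (¬ D) + I (¬ E) + I (¬ F) := by
      intro A B C D E F O h
      have := I_nonneg (¬ A)
      have := I_nonneg (¬ B)
      have := I_nonneg (¬ C)
      have := I_nonneg (¬ D)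
      have := I_nonneg (¬ E)
      have := I_nonneg (¬ F)
      by_cases hO : O
      · rw [I_false (not_not.2 hO)]; positivity
      · have := I_le_one (¬ O)
        by_cases hA : A
        · by_cases hB : B
          · by_cases hC : C
            · by_cases hD : D
              · by_cases hE : E
                · by_cases hF : F
                  · exact absurd (h hA hB hC hD hE hF) hO
                  · have := I_true hF; linarith
                · have := I_true hE; linarith
              · have := I_true hD; linarith
            · have := I_true hC; linarith
          · have := I_true hB; linarith
        · have := I_true hA; linarith
    exact key _ _ _ _ _ _ _ (fun a b c d e f => ⟨a, b, c, d, e, f⟩)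
  simp only [expect_add_distrib] at un
  linarith

lemma val_le {ψ : G → G → ℝ} {X Y Z : G → ℝ} (hψ : ∀ x y, |ψ x y| ≤ 1) (hX : B01 X) (hY : B01 Y)
    (hZ : B01 Z) {w : G} {σ : ℝ} (σ0 : 0 ≤ σ) {x y : G} {P Q : Finset G} :
    val ψ X Y Z w σ x y P Q ≤ 𝔼 ξ ∈ P, 𝔼 υ ∈ Q, ψ (x + ξ) (y + υ) + 3 * σ := by
  have := (hX.av P) x
  have := (hY.av Q) y
  have := (hZ.av P) (w - x - y)
  unfold val
  have : av P X x ^ 2 + av Q Y y ^ 2 + av P Z (w - x - y) ^ 2 ≤ 3 := by nlinarith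
  nlinarith

lemma unif {X Y Z : G → ℝ} (hX : B01 X) (hY : B01 Y)
    (hZ : B01 Z) {ψ : G → G → ℝ} (hψ : ∀ x y, |ψ x y| ≤ 1) (w : G) {σ θ ε : ℝ} (σ0 : 0 ≤ σ)
    (σ1 : σ ≤ 1) (hε : 0 < ε) (hε1 : ε ≤ 1) (hτ0 : 0 ≤ τ)
    (hτ : τ ≤ ε ^ 3 / 2048) (hτ2 : 1000 * τ ≤ σ * (θ * ε ^ 2)) (hN : 128 ≤ N * ε ^ 2)
    (hθ0 : 0 ≤ θ) {n : ℕ} : ∀ (k : ℕ) (P Q : Finset G) (x y : G),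
    Sy P → Q ⊆ P → Pres τ P Q → Fuel N τ M (n + 7 * (k + 1)) Q →
    4 < val ψ X Y Z w σ x y P Q + (k + 1) * (σ * (θ * ε ^ 2) / 20) →
    ∃ (P' Q' : Finset G) (x' y' : G) (W1 W2 W3 : Finset G), Chain N τ M n P' Q' W1 W2 W3 ∧
      𝔼 ξ ∈ P', 𝔼 υ ∈ Q', I (¬ Okay X Y Z (av P' X x') (av Q' Y y') (av P' Z (w - x' - y')) ε
        (x' + ξ) (y' + υ) (w - (x' + ξ) - (y' + υ)) W1 W2 W3) ≤ 6 * θ ∧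
      val ψ X Y Z w σ x y P Q ≤ val ψ X Y Z w σ x' y' P' Q' := by
  have up : ∀ x y P Q, val ψ X Y Z w σ x y P Q ≤ 4 := fun x y P Q => by
    refine (val_le hψ hX hY hZ σ0).trans ?_
    have : |𝔼 ξ ∈ P, 𝔼 υ ∈ Q, ψ (x + ξ) (y + υ)| ≤ 1 :=
      exS_abs_le' zero_le_one fun _ => exS_abs_le' zero_le_one fun _ => hψ _ _
    linarith [(abs_le.1 this).2]
  have g0 : 0 ≤ σ * (θ * ε ^ 2) / 20 := by positivity
  intro k
  induction k with
  | zero =>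
    intro P Q x y sP iQ pQ fQ hv
    rcases unif_step (n := n) hX hY hZ hψ w σ0 σ1 hε hε1 hτ0 hτ hτ2 hN hθ0 sP iQ pQ
      (fQ.le (by omega)) x y with ⟨W1, W2, W3, hc, h⟩ | ⟨x', y', C, D, hD, sC, fD, pD, hv'⟩
    · exact ⟨P, Q, x, y, W1, W2, W3, hc, h, le_rfl⟩
    · exfalso
      have := up x' y' C D
      push_cast at hv
      linarith
  | succ k ih =>
    intro P Q x y sP iQ pQ fQ hv
    rcases unif_step (n := n + 7 * (k + 1)) hX hY hZ hψ w σ0 σ1 hε hε1 hτ0 hτ hτ2 hN hθ0 sP iQ pQ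
      (fQ.le (by omega)) x y with ⟨W1, W2, W3, hc, h⟩ | ⟨x', y', C, D, hD, sC, fD, pD, hv'⟩
    · refine ⟨P, Q, x, y, W1, W2, W3, ?_, h, le_rfl⟩
      exact { hc with f2 := hc.f2.le (by omega), f3 := hc.f3.le (by omega) }
    · obtain ⟨P', Q', x'', y'', W1, W2, W3, hc, h, h'⟩ := ih C D x' y' sC hD pD fD (by
        push_cast at hv; linarith)
      exact ⟨P', Q', x'', y'', W1, W2, W3, hc, h, by linarith⟩
end
end Corners

open Finset BigOperators
open scoped Pointwise

namespace Corners
section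
variable {G : Type*} [Fintype G]

abbrev Sub (T : Finset G) (p : G → Prop) : Type _ := {η : G // η ∈ T ∧ p η}

noncomputable instance (T : Finset G) (p : G → Prop) : Fintype (Sub T p) := by
  classical
  unfold Sub; infer_instance

lemma sub_sum (T : Finset G) (p : G → Prop) (φ : G → ℝ) :
    ∑ η ∈ T, I (p η) * φ η = ∑ v : Sub T p, φ v.1 := by
  classical
  have h1 : ∑ η ∈ T, I (p η) * φ η = ∑ η ∈ T.filter p, φ η := by
    rw [sum_filter]
    refine sum_congr rfl fun η _ => ?_
    split_ifs with h
    · rw [I_true h, one_mul]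
    · rw [I_false h, zero_mul]
  rw [h1]
  symm
  refine sum_bij (fun v _ => v.1) (fun v _ => ?_) (fun v _ u _ h => ?_) (fun η h => ?_) (fun _ _ => rfl)
  · exact mem_filter.2 v.2
  · exact Subtype.ext h
  · exact ⟨⟨η, mem_filter.1 h⟩, mem_univ _, rfl⟩

lemma sub_ex (T : Finset G) (p : G → Prop) (φ : G → ℝ) :
    𝔼 η ∈ T, I (p η) * φ η = (𝔼 η ∈ T, I (p η)) * 𝔼 v : Sub T p, φ v.1 := by
  have h2 : ∑ η ∈ T, I (p η) = Fintype.card (Sub T p) := by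
    have := sub_sum T p (fun _ => 1)
    simpa using this
  rw [expect_eq_sum_div_card, expect_eq_sum_div_card T, Fintype.expect_eq_sum_div_card, sub_sum, h2]
  by_cases h : (Fintype.card (Sub T p) : ℝ) = 0
  · have : IsEmpty (Sub T p) := by
      rw [← Fintype.card_eq_zero_iff]; exact_mod_cast h
    simp
  · field_simp

lemma sub_ex2 (T B : Finset G) (p q : G → Prop) (φ : G → G → ℝ) :
    𝔼 η ∈ T, 𝔼 υ ∈ B, (I (p η) * I (q υ)) * φ η υ
      = ((𝔼 η ∈ T, I (p η)) * (𝔼 υ ∈ B, I (q υ))) * 𝔼 v : Sub T p, 𝔼 u : Sub B q, φ v.1 u.1 := by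
  have h : ∀ η, 𝔼 υ ∈ B, (I (p η) * I (q υ)) * φ η υ
      = I (p η) * ((𝔼 υ ∈ B, I (q υ)) * 𝔼 u : Sub B q, φ η u.1) := by
    intro η
    rw [← sub_ex, mul_expect]
    refine expect_congr rfl fun υ _ => by ring
  simp only [h]
  rw [sub_ex, ← mul_expect]
  ring

lemma window {T B : Finset G} {p q : G → Prop} {U a : G → G → Prop}
    (ha : ∀ η υ, a η υ → p η ∧ q υ ∧ U η υ) {b ε : ℝ} (hb : 0 < b) (hb1 : b ≤ 1)
    (cut : CutS T B (fun η υ => I (U η υ) - b) ε) {κ γ A B' : ℕ} {μ1 μ2 m : ℝ}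
    (hμ1 : μ1 = 𝔼 η ∈ T, I (p η)) (hμ2 : μ2 = 𝔼 υ ∈ B, I (q υ))
    (hm : m = 𝔼 η ∈ T, 𝔼 υ ∈ B, I (a η υ)) (m0 : 0 < m)
    (hK : b * (μ1 * μ2) ≤ 2 ^ κ * m) (hΓ : 1 ≤ 2 ^ γ * b)
    (hε : ε ≤ (1/2) ^ B' * (b * (μ1 * μ2))) :
    Gr (X := Sub T p) (Z := Sub B q) (fun v u => I (a v.1 u.1) * (μ1 * μ2 / m))
      (fun v u => I (U v.1 u.1) / b) (2 ^ κ) (2 ^ γ) ((1/2) ^ B') ((1/2) ^ A) ∨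
    ∃ p' q' : G → Prop, (∀ η, p' η → p η) ∧ (∀ η, q' η → q η) ∧
      (1/2) ^ A * μ1 ≤ 𝔼 η ∈ T, I (p' η) ∧ (1/2) ^ A * μ2 ≤ 𝔼 υ ∈ B, I (q' υ) ∧
      (1 + 1/10000) * m * ((𝔼 η ∈ T, I (p' η)) * 𝔼 υ ∈ B, I (q' υ))
        ≤ (μ1 * μ2) * 𝔼 η ∈ T, 𝔼 υ ∈ B, I (a η υ ∧ p' η ∧ q' υ) := by
  have em : m = (μ1 * μ2) * 𝔼 v : Sub T p, 𝔼 u : Sub B q, I (a v.1 u.1) := by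
    rw [hμ1, hμ2, ← sub_ex2 T B p q (fun η υ => I (a η υ)), hm]
    refine expect_congr rfl fun η _ => expect_congr rfl fun υ _ => ?_
    by_cases h : a η υ
    · obtain ⟨h1, h2, -⟩ := ha η υ h
      rw [I_true h, I_true h1, I_true h2]; ring
    · rw [I_false h]; ring
  have hmu_one_nn : 0 ≤ μ1 := by rw [hμ1]; exact expect_nonneg fun _ _ => I_nonneg _
  have hmu_two_nn : 0 ≤ μ2 := by rw [hμ2]; exact expect_nonneg fun _ _ => I_nonneg _
  have μ0 : 0 < μ1 * μ2 := by
    rcases (mul_nonneg hmu_one_nn hmu_two_nn).eq_or_lt with h | h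
    · rw [← h, zero_mul] at em; linarith
    · exact h
  by_cases NI : ∀ (X' : Sub T p → Prop) (Z' : Sub B q → Prop), ((1:ℝ)/2) ^ A ≤ 𝔼 x, I (X' x) →
      ((1:ℝ)/2) ^ A ≤ 𝔼 z, I (Z' z) →
      𝔼 x : Sub T p, 𝔼 z : Sub B q, (I (a x.1 z.1) * (μ1 * μ2 / m)) * (I (X' x) * I (Z' z))
        ≤ (1 + 1/10000) * ((𝔼 x, I (X' x)) * 𝔼 z, I (Z' z))
  · left
    refine ⟨fun x z => ?_, fun x z => ?_, fun x z => ?_, fun x z => ?_, ?_, ?_, NI, ?_, ?_, ?_, ?_⟩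
    · exact mul_nonneg (I_nonneg _) (by positivity)
    · by_cases h : a x.1 z.1
      · rw [I_true h, I_true (ha _ _ h).2.2, one_mul, mul_one_div, div_le_div_iff₀ m0 hb]
        linarith
      · rw [I_false h, zero_mul]
        exact mul_nonneg (by positivity) (div_nonneg (I_nonneg _) hb.le)
    · exact div_nonneg (I_nonneg _) hb.le
    · rw [div_le_iff₀ hb]
      exact (I_le_one _).trans hΓ
    · intro f g hf hg
      classical
      obtain ⟨f', hf'⟩ : ∃ f' : G → ℝ, f' = fun η => if h : η ∈ T ∧ p η then f ⟨η, h⟩ else 0 := ⟨_, rfl⟩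
      obtain ⟨g', hg'⟩ : ∃ g' : G → ℝ, g' = fun η => if h : η ∈ B ∧ q η then g ⟨η, h⟩ else 0 := ⟨_, rfl⟩
      have ef : ∀ v : Sub T p, f' v.1 = f v := fun v => by rw [hf']; simp [v.2.1, v.2.2]
      have eg : ∀ v : Sub B q, g' v.1 = g v := fun v => by rw [hg']; simp [v.2.1, v.2.2]
      have bf : ∀ η, |f' η| ≤ 1 := fun η => by
        rw [hf']; dsimp only; split_ifs with h
        · exact hf _
        · simp
      have bg : ∀ η, |g' η| ≤ 1 := fun η => by
        rw [hg']; dsimp only; split_ifs with h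
        · exact hg _
        · simp
      have c := cut (fun η => I (p η) * f' η) (fun υ => I (q υ) * g' υ)
        (fun η => by rw [abs_mul]; exact mul_le_one₀ (I_abs_le _) (abs_nonneg _) (bf _))
        (fun η => by rw [abs_mul]; exact mul_le_one₀ (I_abs_le _) (abs_nonneg _) (bg _))
      have e : 𝔼 η ∈ T, 𝔼 υ ∈ B, (I (U η υ) - b) * (I (p η) * f' η * (I (q υ) * g' υ))
          = (b * (μ1 * μ2)) * 𝔼 x : Sub T p, 𝔼 z : Sub B q, (I (U x.1 z.1) / b - 1) * (f x * g z) := by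
        have : ∀ η υ, (I (U η υ) - b) * (I (p η) * f' η * (I (q υ) * g' υ))
          = (I (p η) * I (q υ)) * ((I (U η υ) - b) * (f' η * g' υ)) := by intros; ring
        simp only [this]
        rw [sub_ex2, ← hμ1, ← hμ2, mul_comm b, mul_assoc (μ1 * μ2) b, mul_expect _ _ b]
        congr 1
        refine expect_congr rfl fun v _ => ?_
        rw [mul_expect]
        refine expect_congr rfl fun u _ => ?_
        rw [ef, eg]
        field_simp
      rw [e, abs_mul, abs_of_pos (by positivity)] at c
      have : 0 < b * (μ1 * μ2) := by positivity
      nlinarith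
    · have : ∀ (x : Sub T p) (z : Sub B q), I (a x.1 z.1) * (μ1 * μ2 / m) = (μ1 * μ2 / m) * I (a x.1 z.1) := by
        intros; ring
      simp only [this, ← mul_expect]
      rw [div_mul_eq_mul_div, ← em, div_self m0.ne']
    · exact one_le_pow₀ (by norm_num)
    · exact one_le_pow₀ (by norm_num)
    · positivity
    · exact pow_le_one₀ (by norm_num) (by norm_num)
  · right
    push Not at NI
    obtain ⟨X', Z', hX, hZ, h⟩ := NI
    refine ⟨fun η => ∃ h : η ∈ T ∧ p η, X' ⟨η, h⟩, fun η => ∃ h : η ∈ B ∧ q η, Z' ⟨η, h⟩,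
      fun η h => h.1.2, fun η h => h.1.2, ?_⟩
    have eX : ∀ v : Sub T p, I (∃ h : v.1 ∈ T ∧ p v.1, X' ⟨v.1, h⟩) = I (X' v) := fun v => by
      congr 1; exact propext ⟨fun h => h.2, fun h => ⟨v.2, h⟩⟩
    have eZ : ∀ v : Sub B q, I (∃ h : v.1 ∈ B ∧ q v.1, Z' ⟨v.1, h⟩) = I (Z' v) := fun v => by
      congr 1; exact propext ⟨fun h => h.2, fun h => ⟨v.2, h⟩⟩
    have EX : 𝔼 η ∈ T, I (∃ h : η ∈ T ∧ p η, X' ⟨η, h⟩) = μ1 * 𝔼 x, I (X' x) := by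
      simp only [← eX]
      rw [hμ1, ← sub_ex T p (fun η => I (∃ h : η ∈ T ∧ p η, X' ⟨η, h⟩))]
      refine expect_congr rfl fun η _ => ?_
      by_cases h : ∃ h : η ∈ T ∧ p η, X' ⟨η, h⟩
      · rw [I_true h, I_true h.1.2, one_mul]
      · rw [I_false h, mul_zero]
    have EZ : 𝔼 η ∈ B, I (∃ h : η ∈ B ∧ q η, Z' ⟨η, h⟩) = μ2 * 𝔼 x, I (Z' x) := by
      simp only [← eZ]
      rw [hμ2, ← sub_ex B q (fun η => I (∃ h : η ∈ B ∧ q η, Z' ⟨η, h⟩))]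
      refine expect_congr rfl fun η _ => ?_
      by_cases h : ∃ h : η ∈ B ∧ q η, Z' ⟨η, h⟩
      · rw [I_true h, I_true h.1.2, one_mul]
      · rw [I_false h, mul_zero]
    rw [EX, EZ]
    refine ⟨by nlinarith, by nlinarith, ?_⟩
    have e : (μ1 * μ2) * 𝔼 x : Sub T p, 𝔼 z : Sub B q, I (a x.1 z.1) * (I (X' x) * I (Z' z))
        = 𝔼 η ∈ T, 𝔼 υ ∈ B, I (a η υ ∧ (∃ h : η ∈ T ∧ p η, X' ⟨η, h⟩) ∧ ∃ h : υ ∈ B ∧ q υ, Z' ⟨υ, h⟩) := by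
      simp only [← eX, ← eZ]
      rw [hμ1, hμ2, ← sub_ex2 T B p q (fun η υ => I (a η υ) * (I (∃ h : η ∈ T ∧ p η, X' ⟨η, h⟩) *
        I (∃ h : υ ∈ B ∧ q υ, Z' ⟨υ, h⟩)))]
      refine expect_congr rfl fun η _ => expect_congr rfl fun υ _ => ?_
      rw [I_and, I_and]
      by_cases h : a η υ
      · rw [I_true (ha _ _ h).1, I_true (ha _ _ h).2.1]; ring
      · rw [I_false h]; ring
    rw [← e]
    have e2 : 𝔼 x : Sub T p, 𝔼 z : Sub B q, (I (a x.1 z.1) * (μ1 * μ2 / m)) * (I (X' x) * I (Z' z))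
        = (μ1 * μ2 / m) * 𝔼 x : Sub T p, 𝔼 z : Sub B q, I (a x.1 z.1) * (I (X' x) * I (Z' z)) := by
      simp only [mul_expect]
      refine expect_congr rfl fun η _ => expect_congr rfl fun υ _ => by ring
    rw [e2] at h
    obtain ⟨E, hE⟩ : ∃ E, E = 𝔼 x : Sub T p, 𝔼 z : Sub B q, I (a x.1 z.1) * (I (X' x) * I (Z' z)) := ⟨_, rfl⟩
    rw [← hE] at h ⊢
    obtain ⟨u, hu⟩ : ∃ u, u = (𝔼 x, I (X' x)) * 𝔼 z, I (Z' z) := ⟨_, rfl⟩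
    rw [← hu] at h
    have h3 : (1 + 1 / 10000) * u * m ≤ μ1 * μ2 * E := by
      have : μ1 * μ2 / m * E * m = μ1 * μ2 * E := by field_simp
      nlinarith
    have : (1 + 1 / 10000) * m * (μ1 * (𝔼 x, I (X' x)) * (μ2 * 𝔼 z, I (Z' z)))
      = (μ1 * μ2) * ((1 + 1 / 10000) * u * m) := by rw [hu]; ring
    rw [this]
    exact mul_le_mul_of_nonneg_left h3 μ0.le
end
end Corners

open Finset BigOperators
open scoped Pointwise

namespace Corners
section
variable {G : Type*} [Fintype G]

lemma prod_near {b1 b2 b μ1 μ2 ε : ℝ} (h1 : 0 ≤ b1) (h1' : b1 ≤ 1) (h2 : 0 ≤ b2) (h2' : b2 ≤ 1)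
    (hb : 0 ≤ b) (hb1 : b ≤ 1) (m2 : 0 ≤ μ2) (m2' : μ2 ≤ 1) (e1 : |μ1 - b1| ≤ ε) (e2 : |μ2 - b2| ≤ ε) :
    |b * (μ1 * μ2) - b1 * b2 * b| ≤ 2 * ε := by
  have : b * (μ1 * μ2) - b1 * b2 * b = (b * μ2) * (μ1 - b1) + (b * b1) * (μ2 - b2) := by ring
  rw [this]
  refine (abs_add_le _ _).trans ?_
  rw [abs_mul (b * μ2), abs_mul (b * b1), abs_of_nonneg (mul_nonneg hb m2), abs_of_nonneg (mul_nonneg hb h1)]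
  have a1 : b * μ2 ≤ 1 := mul_le_one₀ hb1 m2 m2'
  have a2 : b * b1 ≤ 1 := mul_le_one₀ hb1 h1 h1'
  have := mul_le_mul a1 e1 (abs_nonneg _) zero_le_one
  have := mul_le_mul a2 e2 (abs_nonneg _) zero_le_one
  linarith

lemma exI_mem {T : Finset G} {p : G → Prop} : 0 ≤ 𝔼 η ∈ T, I (p η) ∧ 𝔼 η ∈ T, I (p η) ≤ 1 :=
  ⟨expect_nonneg fun _ _ => I_nonneg _,
    (abs_le.1 (exS_abs_le' zero_le_one fun _ => I_abs_le _)).2⟩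

/-- the density of a box ∩ U from the cut bound -/
lemma box_dens {T B : Finset G} {p q : G → Prop} {U : G → G → Prop} {b ε : ℝ}
    (cut : CutS T B (fun η υ => I (U η υ) - b) ε) :
    |𝔼 η ∈ T, 𝔼 υ ∈ B, I (p η ∧ q υ ∧ U η υ) - b * ((𝔼 η ∈ T, I (p η)) * 𝔼 υ ∈ B, I (q υ))| ≤ ε := by
  have c := cut (fun η => I (p η)) (fun υ => I (q υ)) (fun _ => I_abs_le _) (fun _ => I_abs_le _)
  have e : 𝔼 η ∈ T, 𝔼 υ ∈ B, (I (U η υ) - b) * (I (p η) * I (q υ))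
      = 𝔼 η ∈ T, 𝔼 υ ∈ B, I (p η ∧ q υ ∧ U η υ) - b * ((𝔼 η ∈ T, I (p η)) * 𝔼 υ ∈ B, I (q υ)) := by
    rw [expect_mul_expect]
    simp only [mul_expect, ← expect_sub_distrib]
    refine expect_congr rfl fun η _ => expect_congr rfl fun υ _ => ?_
    rw [I_and, I_and]; ring
  rw [e] at c
  exact c

set_option maxHeartbeats 1600000 in
lemma view {T B : Finset G} {p q : G → Prop} {U a : G → G → Prop}
    (ha : ∀ η υ, a η υ → p η ∧ q υ ∧ U η υ) {b b1 b2 ε α β : ℝ} (hb : 0 ≤ b) (hb1 : b ≤ 1)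
    (h1 : 0 ≤ b1) (h1' : b1 ≤ 1) (h2 : 0 ≤ b2) (h2' : b2 ≤ 1)
    (cut : CutS T B (fun η υ => I (U η υ) - b) ε) {κ γ A B' : ℕ} {μ1 μ2 m : ℝ}
    (hμ1 : μ1 = 𝔼 η ∈ T, I (p η)) (hμ2 : μ2 = 𝔼 υ ∈ B, I (q υ))
    (e1 : |μ1 - b1| ≤ ε) (e2 : |μ2 - b2| ≤ ε)
    (hm : m = 𝔼 η ∈ T, 𝔼 υ ∈ B, I (a η υ))
    (hβ : β = b1 * b2 * b) (hα : 0 < α) (β0 : 0 < β)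
    (hmβ : (1 - 1/10^5) * ((1 - 1/10^7) * α * β) ≤ m)
    (hκ : 2 ≤ 2 ^ κ * α) (hγ : 1 ≤ 2 ^ γ * β)
    (hε1 : ε ≤ (1/2) ^ B' * β / 2) (hε2 : ε ≤ (1/2) ^ (2 * A) * β / 10^7) :
    Gr (X := Sub T p) (Z := Sub B q) (fun v u => I (a v.1 u.1) * (μ1 * μ2 / m))
      (fun v u => I (U v.1 u.1) / b) (2 ^ κ) (2 ^ γ) ((1/2) ^ B') ((1/2) ^ A) ∨
    ∃ p' q' : G → Prop, 
      (1 + (1/2) ^ 21) * α * 𝔼 η ∈ T, 𝔼 υ ∈ B, I (p' η ∧ q' υ ∧ U η υ)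
        ≤ 𝔼 η ∈ T, 𝔼 υ ∈ B, I (a η υ ∧ p' η ∧ q' υ) ∧
      α * β * (1/2) ^ (2 * A) / 2 ≤ 𝔼 η ∈ T, 𝔼 υ ∈ B, I (a η υ ∧ p' η ∧ q' υ) := by
  have m1 : 0 ≤ μ1 ∧ μ1 ≤ 1 := by rw [hμ1]; exact exI_mem
  have m2 : 0 ≤ μ2 ∧ μ2 ≤ 1 := by rw [hμ2]; exact exI_mem
  have pn := prod_near h1 h1' h2 h2' hb hb1 m2.1 m2.2 e1 e2
  rw [← hβ, abs_le] at pn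
  have b0 : 0 < b := by
    rcases hb.eq_or_lt with h | h
    · rw [← h, mul_zero] at hβ; linarith
    · exact h
  have hβb : β ≤ b := by
    rw [hβ]; exact mul_le_of_le_one_left hb (mul_le_one₀ h1' h2 h2')
  have A1 : ((1:ℝ)/2) ^ (2 * A) ≤ 1 := pow_le_one₀ (by norm_num) (by norm_num)
  have hεβ : ε ≤ β / 10^7 := hε2.trans (by gcongr; nlinarith)
  have αβ : 0 < α * β := mul_pos hα β0
  have mm : α * β / 2 ≤ m := by first | linarith | nlinarith
  have lo : (1 - 1/10^6) * β ≤ b * (μ1 * μ2) := by linarith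
  have hi : b * (μ1 * μ2) ≤ (1 + 1/10^6) * β := by linarith
  have B1 : (0:ℝ) < (1/2) ^ B' := by positivity
  have hm99 : (1 - 1/10^4) * (α * β) ≤ m := by first | linarith | nlinarith
  rcases window (A := A) ha b0 hb1 cut hμ1 hμ2 hm (by linarith) (κ := κ) (γ := γ) (B' := B')
    (by
      have h2k : (0:ℝ) < 2 ^ κ := by positivity
      have := mul_le_mul_of_nonneg_left hm99 h2k.le
      have := mul_le_mul_of_nonneg_right hκ β0.le
      (first | linarith | nlinarith))
    (hγ.trans (by gcongr)) (hε1.trans (by nlinarith)) with h | ⟨p', q', -, -, d1, d2, h⟩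
  · exact Or.inl h
  · right
    refine ⟨p', q', ?_⟩
    have bd := box_dens (p := p') (q := q') cut
    rw [abs_le] at bd
    obtain ⟨E, hE⟩ : ∃ E, E = 𝔼 η ∈ T, 𝔼 υ ∈ B, I (a η υ ∧ p' η ∧ q' υ) := ⟨_, rfl⟩
    obtain ⟨S, hS⟩ : ∃ S, S = 𝔼 η ∈ T, 𝔼 υ ∈ B, I (p' η ∧ q' υ ∧ U η υ) := ⟨_, rfl⟩
    obtain ⟨u, hu⟩ : ∃ u, u = 𝔼 η ∈ T, I (p' η) := ⟨_, rfl⟩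
    obtain ⟨v, hv⟩ : ∃ v, v = 𝔼 υ ∈ B, I (q' υ) := ⟨_, rfl⟩
    rw [← hE] at h ⊢
    rw [← hS] at bd ⊢
    rw [← hu] at h d1 bd
    rw [← hv] at h d2 bd
    have hA : (0:ℝ) < (1/2) ^ A := by positivity
    have E0 : 0 ≤ E := by rw [hE]; exact expect_nonneg fun _ _ => expect_nonneg fun _ _ => I_nonneg _
    have d : (1/2) ^ (2 * A) * (μ1 * μ2) ≤ u * v := by
      have := mul_le_mul d1 d2 (mul_nonneg hA.le m2.1) ((mul_nonneg hA.le m1.1).trans d1)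
      refine le_trans (le_of_eq ?_) this
      rw [two_mul, pow_add]; ring
    have dA : (1/2) ^ (2 * A) * β * (1 - 1/10^6) ≤ b * (u * v) := by
      have a1 := mul_le_mul_of_nonneg_left d hb
      have a2 : b * ((1/2) ^ (2 * A) * (μ1 * μ2)) = (1/2) ^ (2 * A) * (b * (μ1 * μ2)) := by ring
      have a3 := mul_le_mul_of_nonneg_left lo (by positivity : (0:ℝ) ≤ (1/2) ^ (2 * A))
      first | linarith | nlinarith
    have hD0 : 0 < (1/2) ^ (2 * A) * β := by positivity
    obtain ⟨D, hD⟩ : ∃ D, D = b * (u * v) := ⟨_, rfl⟩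
    rw [← hD] at dA bd
    have D0 : 0 < D := lt_of_lt_of_le (mul_pos hD0 (by norm_num)) dA
    have hs : S ≤ (1 + 1/10^6) * D := by
      have : ε ≤ D / 10^6 := hε2.trans (by linarith)
      linarith
    have hEE : (1 + 1/10000) * m * D ≤ (1 + 1/10^6) * β * E := by
      have a1 := mul_le_mul_of_nonneg_left h hb
      have a2 := mul_le_mul_of_nonneg_right hi E0
      rw [hD]
      first | linarith | nlinarith
    have hE3 : (1 + 1/10000) * ((1 - 1/10^5) * ((1 - 1/10^7) * α)) * D ≤ (1 + 1/10^6) * E := by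
      have := mul_le_mul_of_nonneg_right hmβ (by positivity : 0 ≤ (1 + 1/10000) * D)
      have : β * ((1 + 1/10000) * ((1 - 1/10^5) * ((1 - 1/10^7) * α)) * D) ≤ β * ((1 + 1/10^6) * E) := by
        first | linarith | nlinarith
      exact le_of_mul_le_mul_left this β0
    have hE4 : (1 + 8/10^5) * (α * D) ≤ E := by
      have : 0 < α * D := by positivity
      first | linarith | nlinarith
    constructor
    · have := mul_le_mul_of_nonneg_left hs hα.le
      have : 0 < α * D := by positivity
      norm_num
      first | linarith | nlinarith
    · have := mul_le_mul_of_nonneg_left dA hα.le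
      have : 0 < α * D := by positivity
      have : 0 < α * ((1/2) ^ (2 * A) * β) := by positivity
      first | linarith | nlinarith
end
end Corners

open Finset BigOperators
open scoped Pointwise

namespace Corners
section

lemma good_point {Ω : Type*} {P : Finset Ω} (hP : P.Nonempty) {Ok : Ω → Prop} {a s : Fin 3 → Ω → ℝ}
    {θ ε ν α β : ℝ} (hθ : 𝔼 t ∈ P, I (¬ Ok t) ≤ 6 * θ) (a0 : ∀ i t, 0 ≤ a i t)
    (as : ∀ i t, a i t ≤ s i t) (s1 : ∀ i t, s i t ≤ 1) (hs : ∀ i t, Ok t → |s i t - β| ≤ 3 * ε)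
    (hE : ∀ i, ν / 3 ≤ 𝔼 t ∈ P, (a i t - α * s i t)) (α0 : 0 < α) (α1 : α ≤ 1)
    (hν : 0 < ν) (hsm : 36 * ε + 72 * θ ≤ ν) (hsm2 : 10^7 * (6 * θ + 3 * ε) ≤ α * ν) (hθ1 : θ ≤ 1/100)
    (hε : 0 ≤ ε) (hθ0 : 0 ≤ θ) :
    ν / 4 ≤ β ∧ ((∃ t, Ok t ∧ ∃ i, (1 + 1/10^6) * (α * β) ≤ a i t) ∨
      (∃ t, Ok t ∧ ∀ i, (1 - 1/10^5) * (α * β) ≤ a i t)) := by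
  have hβ : ν / 4 ≤ β := by
    have h1 : ∀ t ∈ P, a 0 t - α * s 0 t ≤ I (¬ Ok t) + max (β + 3 * ε) 0 := by
      intro t _
      have := a0 0 t
      have := as 0 t
      have := s1 0 t
      have : 0 ≤ α * s 0 t := by nlinarith
      have m0 : 0 ≤ max (β + 3 * ε) 0 := le_max_right _ _
      by_cases ho : Ok t
      · have h := (abs_le.1 (hs 0 t ho)).2
        have m1 : β + 3 * ε ≤ max (β + 3 * ε) 0 := le_max_left _ _
        rw [I_false (not_not.2 ho)]; linarith
      · rw [I_true ho]; linarith
    have h2 := (hE 0).trans (expect_le_expect h1)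
    rw [expect_add_distrib, expect_const hP] at h2
    rcases max_cases (β + 3 * ε) 0 with ⟨h, -⟩ | ⟨h, -⟩ <;> rw [h] at h2 <;> linarith
  refine ⟨hβ, ?_⟩
  by_contra hcon
  push Not at hcon
  obtain ⟨c1, c2⟩ := hcon
  have αβ : 0 < α * β := by have : 0 < β := by linarith
                            positivity
  have αν : α * ν ≤ 4 * (α * β) := by nlinarith
  have hp : ∀ i, 𝔼 t ∈ P, I (Ok t ∧ a i t < (1 - 1/10^5) * (α * β)) ≤ 1/5 := by
    intro i
    have h1 : ∀ t ∈ P, a i t - α * s i t ≤ I (¬ Ok t) + (1/10^6 * (α * β) + 3 * ε)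
        - (1/10^5 * (α * β)) * I (Ok t ∧ a i t < (1 - 1/10^5) * (α * β)) := by
      intro t _
      have := a0 i t
      have := as i t
      have := s1 i t
      by_cases ho : Ok t
      · have h := (abs_le.1 (hs i t ho)).1
        have h' : α * β - 3 * ε ≤ α * s i t := by nlinarith
        have := c1 t ho i
        rw [I_false (not_not.2 ho)]
        by_cases hl : a i t < (1 - 1/10^5) * (α * β)
        · rw [I_true ⟨ho, hl⟩]; linarith
        · rw [I_false (fun h => hl h.2)]; linarith
      · rw [I_true ho, I_false (fun h => ho h.1)]
        have : 0 ≤ α * s i t := by nlinarith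
        linarith
    have h2 := (hE i).trans (expect_le_expect h1)
    rw [expect_sub_distrib, expect_add_distrib, expect_const hP, ← mul_expect] at h2
    nlinarith
  have h1 : ∀ t ∈ P, (1:ℝ) ≤ I (¬ Ok t) + (I (Ok t ∧ a 0 t < (1 - 1/10^5) * (α * β))
      + I (Ok t ∧ a 1 t < (1 - 1/10^5) * (α * β)) + I (Ok t ∧ a 2 t < (1 - 1/10^5) * (α * β))) := by
    intro t _
    have p0 := I_nonneg (Ok t ∧ a 0 t < (1 - 1/10^5) * (α * β))
    have p1 := I_nonneg (Ok t ∧ a 1 t < (1 - 1/10^5) * (α * β))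
    have p2 := I_nonneg (Ok t ∧ a 2 t < (1 - 1/10^5) * (α * β))
    have p3 := I_nonneg (¬ Ok t)
    by_cases ho : Ok t
    · obtain ⟨i, hi⟩ := c2 t ho
      have hi' := I_true (And.intro ho hi)
      fin_cases i
      · simp only [Fin.zero_eta] at hi'; linarith
      · simp only [Fin.mk_one] at hi'; linarith
      · simp only [Fin.reduceFinMk] at hi'; linarith
    · rw [I_true ho]; linarith
  have h2 := expect_le_expect h1
  rw [expect_const hP] at h2
  simp only [expect_add_distrib] at h2
  have := hp 0
  have := hp 1
  have := hp 2
  linarith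

variable {G : Type*} [AddCommGroup G] [DecidableEq G] [Fintype G] {N M : ℕ} {τ : ℝ}

lemma view_gen {P Q T B : Finset G} (nT : T.Nonempty) (nB : B.Nonempty)
    {ψ : G → G → ℝ} {c d : G → G → G} {x y : G} {r : ℝ}
    (h : ∀ η ∈ T, ∀ υ ∈ B, |𝔼 ξ ∈ P, 𝔼 ξ' ∈ Q, ψ (x + ξ + c η υ) (y + ξ' + d η υ)
      - 𝔼 ξ ∈ P, 𝔼 ξ' ∈ Q, ψ (x + ξ) (y + ξ')| ≤ r) :
    |𝔼 ξ ∈ P, 𝔼 ξ' ∈ Q, 𝔼 η ∈ T, 𝔼 υ ∈ B, ψ (x + ξ + c η υ) (y + ξ' + d η υ)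
      - 𝔼 ξ ∈ P, 𝔼 ξ' ∈ Q, ψ (x + ξ) (y + ξ')| ≤ r := by
  rw [comm4]
  have e : 𝔼 ξ ∈ P, 𝔼 ξ' ∈ Q, ψ (x + ξ) (y + ξ') =
      𝔼 _η ∈ T, 𝔼 _υ ∈ B, 𝔼 ξ ∈ P, 𝔼 ξ' ∈ Q, ψ (x + ξ) (y + ξ') := by
    rw [expect_const nT, expect_const nB]
  rw [e]
  exact exS_sub_le nT fun η hη => exS_sub_le nB fun υ hυ => h η hη υ hυ

lemma two_shift {P Q V1 V2 : Finset G} (pP : Pres τ P V1) (pQ : Pres τ Q V2) (nP : P.Nonempty)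
    (nQ : Q.Nonempty) (s1 : Sy V1) (s2 : Sy V2)
    {ψ : G → G → ℝ} (hψ : ∀ x y, |ψ x y| ≤ 1) {x y c d c' d' : G} (hc : c ∈ V1) (hd : d ∈ V2)
    (hc' : c' ∈ V1) (hd' : d' ∈ V2) :
    |𝔼 ξ ∈ P, 𝔼 ξ' ∈ Q, ψ (x + ξ + (c + c')) (y + ξ' + (d + d'))
      - 𝔼 ξ ∈ P, 𝔼 ξ' ∈ Q, ψ (x + ξ) (y + ξ')| ≤ 8 * τ := by
  have a1 := shift2 pP pQ s1 s2 nP nQ (ψ := fun u v => ψ (x + u + c') (y + v + d')) (fun _ _ => hψ _ _) hc hd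
  have a2 := shift2 pP pQ s1 s2 nP nQ (ψ := fun u v => ψ (x + u) (y + v)) (fun _ _ => hψ _ _) hc' hd'
  simp only [← add_assoc] at a1 a2 ⊢
  rw [abs_le] at *
  constructor <;> linarith [a1.1, a1.2, a2.1, a2.2]

lemma views {n : ℕ} {P Q W1 W2 W3 : Finset G} (H : Chain N τ M n P Q W1 W2 W3)
    {ψ : G → G → ℝ} (hψ : ∀ x y, |ψ x y| ≤ 1) (x y : G) :
    |𝔼 ξ ∈ P, 𝔼 ξ' ∈ Q, 𝔼 η ∈ W1, 𝔼 υ ∈ W2, ψ (x + ξ + η) (y + ξ' + υ)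
      - 𝔼 ξ ∈ P, 𝔼 ξ' ∈ Q, ψ (x + ξ) (y + ξ')| ≤ 8 * τ ∧
    |𝔼 ξ ∈ P, 𝔼 ξ' ∈ Q, 𝔼 η ∈ W1, 𝔼 ζ ∈ W3, ψ (x + ξ + η) (y + ξ' - η - ζ)
      - 𝔼 ξ ∈ P, 𝔼 ξ' ∈ Q, ψ (x + ξ) (y + ξ')| ≤ 8 * τ ∧
    |𝔼 ξ ∈ P, 𝔼 ξ' ∈ Q, 𝔼 υ ∈ W2, 𝔼 ζ ∈ W3, ψ (x + ξ - υ - ζ) (y + ξ' + υ)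
      - 𝔼 ξ ∈ P, 𝔼 ξ' ∈ Q, ψ (x + ξ) (y + ξ')| ≤ 8 * τ := by
  have pP := H.pQ.mono H.i1
  have i31 : W3 ⊆ W1 := H.i3.trans H.i2
  refine ⟨?_, ?_, ?_⟩
  · have := view_gen (c := fun η _ => η + 0) (d := fun _ υ => υ + 0) (x := x) (y := y) H.s1.ne H.s2.ne
      (fun η hη υ hυ => two_shift pP H.p1 H.sP.ne H.sQ.ne H.s1 H.s1 hψ (x := x) (y := y)
        hη (H.i2 hυ) H.s1.1 H.s1.1)
    simpa only [add_zero] using this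
  · have := view_gen (c := fun η _ => η + 0) (d := fun η ζ => -η + -ζ) (x := x) (y := y) H.s1.ne H.s3.ne
      (fun η hη ζ hζ => two_shift pP H.p1 H.sP.ne H.sQ.ne H.s1 H.s1 hψ (x := x) (y := y)
        hη (H.s1.2 _ hη) H.s1.1 (H.s1.2 _ (i31 hζ)))
    simpa only [add_zero, ← add_assoc, sub_eq_add_neg] using this
  · have := view_gen (c := fun η ζ => -η + -ζ) (d := fun η _ => η + 0) (x := x) (y := y) H.s2.ne H.s3.ne
      (fun η hη ζ hζ => two_shift pP H.p1 H.sP.ne H.sQ.ne H.s1 H.s1 hψ (x := x) (y := y)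
        (H.s1.2 _ (H.i2 hη)) (H.i2 hη) (H.s1.2 _ (i31 hζ)) H.s1.1)
    simpa only [add_zero, ← add_assoc, sub_eq_add_neg] using this
end
end Corners

open Finset BigOperators
open scoped Pointwise

namespace Corners
section
variable {G : Type*} [AddCommGroup G] [DecidableEq G] [Fintype G] {N M : ℕ} {τ : ℝ}

def A0 (A : G → G → G → Prop) (X Y Z : G → Prop) (x y z : G) : Prop := A x y z ∧ X x ∧ Y y ∧ Z z
def S0 (X Y Z : G → Prop) (x y z : G) : Prop := X x ∧ Y y ∧ Z z

/-- density of `F` on a cell -/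
noncomputable def dn (F : G → G → G → Prop) (w x y : G) (P Q : Finset G) : ℝ :=
  𝔼 ξ ∈ P, 𝔼 υ ∈ Q, I (F (x + ξ) (y + υ) (w - (x + ξ) - (y + υ)))

def Rich (N : ℕ) (τ : ℝ) (M n : ℕ) (A : G → G → G → Prop) (w : G) (α δ : ℝ) : Prop :=
  ∃ (X Y Z : G → Prop) (P Q : Finset G) (x y : G), Sy P ∧ Q ⊆ P ∧ Pres τ P Q ∧ Fuel N τ M n Q ∧
    δ ≤ dn (A0 A X Y Z) w x y P Q ∧ α * dn (S0 X Y Z) w x y P Q ≤ dn (A0 A X Y Z) w x y P Q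

/-- densities in the three views -/
noncomputable def vw (F : G → G → G → Prop) (x1 y1 z1 : G) (W1 W2 W3 : Finset G) : Fin 3 → ℝ :=
  ![𝔼 η ∈ W1, 𝔼 υ ∈ W2, I (F (x1 + η) (y1 + υ) (z1 - η - υ)),
    𝔼 η ∈ W1, 𝔼 ζ ∈ W3, I (F (x1 + η) (y1 - η - ζ) (z1 + ζ)),
    𝔼 υ ∈ W2, 𝔼 ζ ∈ W3, I (F (x1 - υ - ζ) (y1 + υ) (z1 + ζ))]

lemma vw0 (F : G → G → G → Prop) (x1 y1 z1 : G) (W1 W2 W3 : Finset G) :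
    vw F x1 y1 z1 W1 W2 W3 0 = 𝔼 η ∈ W1, 𝔼 υ ∈ W2, I (F (x1 + η) (y1 + υ) (z1 - η - υ)) := rfl
lemma vw1 (F : G → G → G → Prop) (x1 y1 z1 : G) (W1 W2 W3 : Finset G) :
    vw F x1 y1 z1 W1 W2 W3 1 = 𝔼 η ∈ W1, 𝔼 ζ ∈ W3, I (F (x1 + η) (y1 - η - ζ) (z1 + ζ)) := rfl
lemma vw2 (F : G → G → G → Prop) (x1 y1 z1 : G) (W1 W2 W3 : Finset G) :
    vw F x1 y1 z1 W1 W2 W3 2 = 𝔼 υ ∈ W2, 𝔼 ζ ∈ W3, I (F (x1 - υ - ζ) (y1 + υ) (z1 + ζ)) := rfl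

lemma EEI_mem {T B : Finset G} {p : G → G → Prop} :
    0 ≤ 𝔼 η ∈ T, 𝔼 υ ∈ B, I (p η υ) ∧ 𝔼 η ∈ T, 𝔼 υ ∈ B, I (p η υ) ≤ 1 :=
  ⟨expect_nonneg fun _ _ => expect_nonneg fun _ _ => I_nonneg _,
    (abs_le.1 (exS_abs_le' zero_le_one fun _ => exS_abs_le' zero_le_one fun _ => I_abs_le _)).2⟩

lemma EEI_mono {T B : Finset G} {p q : G → G → Prop} (h : ∀ η υ, p η υ → q η υ) :
    𝔼 η ∈ T, 𝔼 υ ∈ B, I (p η υ) ≤ 𝔼 η ∈ T, 𝔼 υ ∈ B, I (q η υ) :=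
  expect_le_expect fun _ _ => expect_le_expect fun _ _ => I_mono (h _ _)

lemma B01_I (X : G → Prop) : B01 (fun x => I (X x)) := fun _ => ⟨I_nonneg _, I_le_one _⟩

lemma okay_dens {X Y Z : G → Prop} {bx b_y bz ε : ℝ} {x1 y1 z1 : G} {W1 W2 W3 : Finset G}
    (h : Okay (fun x => I (X x)) (fun x => I (Y x)) (fun x => I (Z x)) bx b_y bz ε x1 y1 z1 W1 W2 W3)
    (hx : 0 ≤ bx ∧ bx ≤ 1) (hy : 0 ≤ b_y ∧ b_y ≤ 1) (hz : 0 ≤ bz ∧ bz ≤ 1) (i : Fin 3) :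
    |vw (S0 X Y Z) x1 y1 z1 W1 W2 W3 i - bx * b_y * bz| ≤ 3 * ε := by
  have key : ∀ {a b c : ℝ}, |a - b| ≤ ε → |b - c| ≤ 2 * ε → |a - c| ≤ 3 * ε := by
    intro a b c h1 h2
    rw [abs_le] at *
    constructor <;> linarith [h1.1, h1.2, h2.1, h2.2]
  fin_cases i
  · show |𝔼 η ∈ W1, 𝔼 υ ∈ W2, I (X (x1 + η) ∧ Y (y1 + υ) ∧ Z (z1 - η - υ)) - bx * b_y * bz| ≤ 3 * ε
    have d := box_dens (p := fun η => X (x1 + η)) (q := fun υ => Y (y1 + υ))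
      (U := fun η υ => Z (z1 - η - υ)) h.cZ
    exact key d (prod_near hx.1 hx.2 hy.1 hy.2 hz.1 hz.2 exI_mem.1 exI_mem.2 h.vX h.vY)
  · show |𝔼 η ∈ W1, 𝔼 ζ ∈ W3, I (X (x1 + η) ∧ Y (y1 - η - ζ) ∧ Z (z1 + ζ)) - bx * b_y * bz| ≤ 3 * ε
    have d := box_dens (p := fun η => X (x1 + η)) (q := fun υ => Z (z1 + υ))
      (U := fun η υ => Y (y1 - η - υ)) h.cY
    have := key d (prod_near hx.1 hx.2 hz.1 hz.2 hy.1 hy.2 exI_mem.1 exI_mem.2 h.vX h.vZ)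
    convert this using 2
    congr 1
    · refine expect_congr rfl fun η _ => expect_congr rfl fun υ _ => ?_
      congr 1; exact propext (by tauto)
    · ring
  · show |𝔼 υ ∈ W2, 𝔼 ζ ∈ W3, I (X (x1 - υ - ζ) ∧ Y (y1 + υ) ∧ Z (z1 + ζ)) - bx * b_y * bz| ≤ 3 * ε
    have d := box_dens (p := fun η => Y (y1 + η)) (q := fun υ => Z (z1 + υ))
      (U := fun η υ => X (x1 - η - υ)) h.cX
    have := key d (prod_near hy.1 hy.2 hz.1 hz.2 hx.1 hx.2 exI_mem.1 exI_mem.2 h.vY h.vZ)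
    convert this using 2
    congr 1
    · refine expect_congr rfl fun η _ => expect_congr rfl fun υ _ => ?_
      congr 1; exact propext (by tauto)
    · ring

set_option maxHeartbeats 1600000 in
lemma point {n k : ℕ} {A : G → G → G → Prop} {w : G} {α δ ε : ℝ} {X Y Z : G → Prop}
    {P Q : Finset G} {x y : G} (sP : Sy P) (iQ : Q ⊆ P) (pQ : Pres τ P Q)
    (fQ : Fuel N τ M (n + 7 * (k + 1)) Q)
    (hδ : δ ≤ dn (A0 A X Y Z) w x y P Q)
    (hα : α * dn (S0 X Y Z) w x y P Q ≤ dn (A0 A X Y Z) w x y P Q)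
    (α0 : 0 < α) (α1 : α ≤ 1) (δ0 : 0 < δ) (ε0 : 0 < ε) (hε : ε ≤ α * δ / 10^16) (τ0 : 0 ≤ τ)
    (hτ : 10^11 * τ ≤ δ * ε ^ 3) (hN : 128 ≤ N * ε ^ 2) (hk : 10^10 ≤ (k + 1) * (δ * ε ^ 3)) :
    ∃ (P' Q' W1 W2 W3 : Finset G) (x1 y1 : G) (bx b_y bz : ℝ), Chain N τ M n P' Q' W1 W2 W3 ∧
      (0 ≤ bx ∧ bx ≤ 1) ∧ (0 ≤ b_y ∧ b_y ≤ 1) ∧ (0 ≤ bz ∧ bz ≤ 1) ∧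
      Okay (fun x => I (X x)) (fun x => I (Y x)) (fun x => I (Z x)) bx b_y bz ε x1 y1 (w - x1 - y1)
        W1 W2 W3 ∧ δ / 10^8 ≤ bx * b_y * bz ∧
      ((∃ i, (1 + 1/10^6) * ((1 - 1/10^7) * α * (bx * b_y * bz))
          ≤ vw (A0 A X Y Z) x1 y1 (w - x1 - y1) W1 W2 W3 i) ∨
        (∀ i, (1 - 1/10^5) * ((1 - 1/10^7) * α * (bx * b_y * bz))
          ≤ vw (A0 A X Y Z) x1 y1 (w - x1 - y1) W1 W2 W3 i)) := by
  have dn1 : dn (A0 A X Y Z) w x y P Q ≤ 1 := EEI_mem.2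
  have δ1 : δ ≤ 1 := hδ.trans dn1
  have αδ : α * δ ≤ δ := by nlinarith
  have hεδ : ε ≤ δ / 10^16 := hε.trans (by linarith)
  have ε1 : ε ≤ 1 := by linarith
  have ε3 : 0 < ε ^ 3 := by positivity
  have hτ3 : 10^11 * τ ≤ ε ^ 3 := hτ.trans (by nlinarith)
  have ε31 : ε ^ 3 ≤ ε := by
    have : ε ^ 2 ≤ 1 := pow_le_one₀ ε0.le ε1
    nlinarith
  obtain ⟨α', hα'⟩ : ∃ α', α' = (1 - 1/10^7) * α := ⟨_, rfl⟩
  obtain ⟨ν, hν⟩ : ∃ ν, ν = δ / 10^7 := ⟨_, rfl⟩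
  obtain ⟨ψ, hψd⟩ : ∃ ψ : G → G → ℝ, ψ = fun x y => I (A0 A X Y Z x y (w - x - y))
    - α' * I (S0 X Y Z x y (w - x - y)) := ⟨_, rfl⟩
  have α'0 : 0 < α' := by rw [hα']; positivity
  have α'1 : α' ≤ 1 := by rw [hα']; linarith
  have hψ : ∀ x y, |ψ x y| ≤ 1 := by
    intro x y
    rw [hψd]
    have := I_nonneg (A0 A X Y Z x y (w - x - y))
    have := I_le_one (A0 A X Y Z x y (w - x - y))
    have := I_nonneg (S0 X Y Z x y (w - x - y))
    have := I_le_one (S0 X Y Z x y (w - x - y))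
    rw [abs_le]
    constructor <;> dsimp only <;> nlinarith
  have hEψ : ∀ x y (P Q : Finset G), 𝔼 ξ ∈ P, 𝔼 υ ∈ Q, ψ (x + ξ) (y + υ)
      = dn (A0 A X Y Z) w x y P Q - α' * dn (S0 X Y Z) w x y P Q := by
    intro x y P Q
    rw [hψd]; unfold dn
    simp only [expect_sub_distrib, ← mul_expect]
  have bX := B01_I X
  have bY := B01_I Y
  have bZ := B01_I Z
  have S0n : 0 ≤ dn (S0 X Y Z) w x y P Q := EEI_mem.1
  have v0 : ν ≤ val ψ (fun x => I (X x)) (fun x => I (Y x)) (fun x => I (Z x)) w (ν / 6) x y P Q := by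
    unfold val
    rw [hEψ]
    have : ν ≤ dn (A0 A X Y Z) w x y P Q - α' * dn (S0 X Y Z) w x y P Q := by
      rw [hα', hν]; linarith
    have : 0 ≤ ν := by rw [hν]; positivity
    have : 0 ≤ (ν / 6) * (av P (fun x => I (X x)) x ^ 2 + av Q (fun x => I (Y x)) y ^ 2
      + av P (fun x => I (Z x)) (w - x - y) ^ 2) := by positivity
    linarith
  have ν0 : 0 < ν := by rw [hν]; positivity
  obtain ⟨P', Q', x', y', W1, W2, W3, hc, hok, hv⟩ := unif (M := M) (n := n) (τ := τ) (N := N) bX bY bZ hψ w (σ := ν / 6) (θ := ε)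
    (ε := ε) (by positivity) (by rw [hν]; linarith) ε0 ε1 τ0 (by linarith)
    (by
      have : ν / 6 * (ε * ε ^ 2) = δ * ε ^ 3 / (6 * 10^7) := by rw [hν]; ring
      rw [this]; have : 0 ≤ δ * ε ^ 3 := by positivity
      linarith) hN ε0.le k P Q x y sP iQ pQ fQ
    (by
      have : ((k:ℝ) + 1) * (ν / 6 * (ε * ε ^ 2) / 20) = (k + 1) * (δ * ε ^ 3) / (12 * 10^8) := by
        rw [hν]; ring
      rw [this]; linarith)
  obtain ⟨bx, hbx⟩ : ∃ b, b = av P' (fun x => I (X x)) x' := ⟨_, rfl⟩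
  obtain ⟨b_y, hby⟩ : ∃ b, b = av Q' (fun x => I (Y x)) y' := ⟨_, rfl⟩
  obtain ⟨bz, hbz⟩ : ∃ b, b = av P' (fun x => I (Z x)) (w - x' - y') := ⟨_, rfl⟩
  have hbx1 : 0 ≤ bx ∧ bx ≤ 1 := by rw [hbx]; exact bX.av P' x'
  have hby1 : 0 ≤ b_y ∧ b_y ≤ 1 := by rw [hby]; exact bY.av Q' y'
  have hbz1 : 0 ≤ bz ∧ bz ≤ 1 := by rw [hbz]; exact bZ.av P' _
  rw [← hbx, ← hby, ← hbz] at hok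
  have hE : ν / 2 ≤ 𝔼 ξ ∈ P', 𝔼 υ ∈ Q', ψ (x' + ξ) (y' + υ) := by
    have := val_le (w := w) (σ := ν / 6) (x := x') (y := y') (P := P') (Q := Q') hψ bX bY bZ (by positivity)
    linarith
  have hV := views hc hψ x' y'
  rw [← expect_product' P' Q'] at hok
  have τν : 8 * τ ≤ ν / 6 := by rw [hν]; linarith
  obtain ⟨hβ, hcase⟩ := good_point (P := P' ×ˢ Q') (θ := ε) (ε := ε) (ν := ν) (α := α')
    (β := bx * b_y * bz)
    (Ok := fun t : G × G => Okay (fun x => I (X x)) (fun x => I (Y x)) (fun x => I (Z x)) bx b_y bz ε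
      (x' + t.1) (y' + t.2) (w - (x' + t.1) - (y' + t.2)) W1 W2 W3)
    (a := fun i t => vw (A0 A X Y Z) (x' + t.1) (y' + t.2) (w - (x' + t.1) - (y' + t.2)) W1 W2 W3 i)
    (s := fun i t => vw (S0 X Y Z) (x' + t.1) (y' + t.2) (w - (x' + t.1) - (y' + t.2)) W1 W2 W3 i)
    (hc.sP.ne.product hc.sQ.ne) hok
    (fun i t => by fin_cases i <;> exact EEI_mem.1)
    (fun i t => by fin_cases i <;> exact EEI_mono (fun _ _ h => h.2))
    (fun i t => by fin_cases i <;> exact EEI_mem.2)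
    (fun i t ho => okay_dens ho hbx1 hby1 hbz1 i)
    (fun i => by
      rw [expect_product]
      have low : ∀ {c : ℝ}, |c - 𝔼 ξ ∈ P', 𝔼 υ ∈ Q', ψ (x' + ξ) (y' + υ)| ≤ 8 * τ → ν / 3 ≤ c := by
        intro c h
        rw [abs_le] at h; linarith
      fin_cases i
      · refine (low hV.1).trans (le_of_eq ?_)
        refine expect_congr rfl fun ξ _ => expect_congr rfl fun υ _ => ?_
        change _ = vw (A0 A X Y Z) _ _ _ W1 W2 W3 0 - α' * vw (S0 X Y Z) _ _ _ W1 W2 W3 0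
        rw [vw0, vw0]
        simp only [mul_expect, ← expect_sub_distrib]
        refine expect_congr rfl fun η _ => expect_congr rfl fun υ' _ => ?_
        rw [hψd]; dsimp only
        rw [show w - (x' + ξ + η) - (y' + υ + υ') = w - (x' + ξ) - (y' + υ) - η - υ' by abel]
      · refine (low hV.2.1).trans (le_of_eq ?_)
        refine expect_congr rfl fun ξ _ => expect_congr rfl fun υ _ => ?_
        change _ = vw (A0 A X Y Z) _ _ _ W1 W2 W3 1 - α' * vw (S0 X Y Z) _ _ _ W1 W2 W3 1
        rw [vw1, vw1]
        simp only [mul_expect, ← expect_sub_distrib]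
        refine expect_congr rfl fun η _ => expect_congr rfl fun υ' _ => ?_
        rw [hψd]; dsimp only
        rw [show w - (x' + ξ + η) - (y' + υ - η - υ') = w - (x' + ξ) - (y' + υ) + υ' by abel]
      · refine (low hV.2.2).trans (le_of_eq ?_)
        refine expect_congr rfl fun ξ _ => expect_congr rfl fun υ _ => ?_
        change _ = vw (A0 A X Y Z) _ _ _ W1 W2 W3 2 - α' * vw (S0 X Y Z) _ _ _ W1 W2 W3 2
        rw [vw2, vw2]
        simp only [mul_expect, ← expect_sub_distrib]
        refine expect_congr rfl fun η _ => expect_congr rfl fun υ' _ => ?_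
        rw [hψd]; dsimp only
        rw [show w - (x' + ξ - η - υ') - (y' + υ + η) = w - (x' + ξ) - (y' + υ) + υ' by abel])
    α'0 α'1 ν0 (by rw [hν]; linarith) (by rw [hα', hν]; nlinarith) (by linarith) ε0.le ε0.le
  have hβ' : δ / 10^8 ≤ bx * b_y * bz := by rw [hν] at hβ; linarith
  rcases hcase with ⟨t, ho, h⟩ | ⟨t, ho, h⟩
  · exact ⟨P', Q', W1, W2, W3, x' + t.1, y' + t.2, bx, b_y, bz, hc, hbx1, hby1, hbz1, ho, hβ',
      Or.inl (by rw [← hα']; exact h)⟩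
  · exact ⟨P', Q', W1, W2, W3, x' + t.1, y' + t.2, bx, b_y, bz, hc, hbx1, hby1, hbz1, ho, hβ',
      Or.inr (by rw [← hα']; exact h)⟩
end
end Corners

open Finset BigOperators
open scoped Pointwise

namespace Corners
section
variable {G : Type*} [AddCommGroup G] [DecidableEq G] [Fintype G] {N M : ℕ} {τ : ℝ}

def Tri (A : G → G → G → Prop) (w : G) (x y z : G) : Prop :=
  A (w - y - z) y z ∧ A x (w - x - z) z ∧ A x y (w - x - y)

inductive RichS (N : ℕ) (τ : ℝ) (M n : ℕ) (w : G) (α δ : ℝ) : (G → G → G → Prop) → Prop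
  | base {A : G → G → G → Prop} (h : Rich N τ M n A w α δ) : RichS N τ M n w α δ A
  | swap {A : G → G → G → Prop} (h : RichS N τ M n w α δ (fun a b c => A a c b)) : RichS N τ M n w α δ A
  | rot {A : G → G → G → Prop} (h : RichS N τ M n w α δ (fun a b c => A c a b)) : RichS N τ M n w α δ A

lemma dn_mono {F F' : G → G → G → Prop} {w x y : G} {P Q : Finset G}
    (h : ∀ a b c, a + b + c = w → F a b c → F' a b c) : dn F w x y P Q ≤ dn F' w x y P Q :=
  EEI_mono fun _ _ => h _ _ _ (by abel)

lemma Rich.mono {n n' : ℕ} {A A' : G → G → G → Prop} {w : G} {α α' δ δ' : ℝ}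
    (h : Rich N τ M n A w α δ) (hn : n' ≤ n) (hα : α' ≤ α) (hδ : δ' ≤ δ)
    (hA : ∀ a b c, a + b + c = w → A a b c → A' a b c) : Rich N τ M n' A' w α' δ' := by
  obtain ⟨X, Y, Z, P, Q, x, y, h1, h2, h3, h4, h5, h6⟩ := h
  have m : dn (A0 A X Y Z) w x y P Q ≤ dn (A0 A' X Y Z) w x y P Q :=
    dn_mono fun a b c e h => ⟨hA a b c e h.1, h.2⟩
  have s0 : 0 ≤ dn (S0 X Y Z) w x y P Q := EEI_mem.1
  exact ⟨X, Y, Z, P, Q, x, y, h1, h2, h3, h4.le hn, by linarith, by nlinarith⟩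

lemma RichS.mono {n n' : ℕ} {A A' : G → G → G → Prop} {w : G} {α α' δ δ' : ℝ}
    (h : RichS N τ M n w α δ A) (hn : n' ≤ n) (hα : α' ≤ α) (hδ : δ' ≤ δ)
    (hA : ∀ a b c, a + b + c = w → A a b c → A' a b c) : RichS N τ M n' w α' δ' A' := by
  induction h generalizing A' with
  | base h => exact .base (h.mono hn hα hδ hA)
  | swap h ih => exact .swap (ih fun a b c e => hA a c b (by rw [← e]; abel))
  | rot h ih => exact .rot (ih fun a b c e => hA c a b (by rw [← e]; abel))

lemma dn_vw0 (F : G → G → G → Prop) (w x1 y1 : G) (W1 W2 W3 : Finset G) :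
    dn F w x1 y1 W1 W2 = vw F x1 y1 (w - x1 - y1) W1 W2 W3 0 := by
  rw [vw0]; unfold dn
  refine expect_congr rfl fun η _ => expect_congr rfl fun υ _ => ?_
  rw [show w - (x1 + η) - (y1 + υ) = w - x1 - y1 - η - υ by abel]

lemma dn_vw1 (F : G → G → G → Prop) (w x1 y1 : G) (W1 W2 W3 : Finset G) :
    dn (fun a b c => F a c b) w x1 (w - x1 - y1) W1 W3 = vw F x1 y1 (w - x1 - y1) W1 W2 W3 1 := by
  rw [vw1]; unfold dn
  refine expect_congr rfl fun η _ => expect_congr rfl fun υ _ => ?_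
  rw [show w - (x1 + η) - (w - x1 - y1 + υ) = y1 - η - υ by abel]

lemma dn_vw2 (F : G → G → G → Prop) (w x1 y1 : G) (W1 W2 W3 : Finset G) :
    dn (fun a b c => F c a b) w y1 (w - x1 - y1) W2 W3 = vw F x1 y1 (w - x1 - y1) W1 W2 W3 2 := by
  rw [vw2]; unfold dn
  refine expect_congr rfl fun η _ => expect_congr rfl fun υ _ => ?_
  rw [show w - (y1 + η) - (w - x1 - y1 + υ) = x1 - η - υ by abel]

lemma rich_vw {n : ℕ} {A : G → G → G → Prop} {w x1 y1 : G} {α δ : ℝ} {P Q W1 W2 W3 : Finset G}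
    (hc : Chain N τ M n P Q W1 W2 W3) (X Y Z : G → Prop) (i : Fin 3)
    (hδ : δ ≤ vw (A0 A X Y Z) x1 y1 (w - x1 - y1) W1 W2 W3 i)
    (hα : α * vw (S0 X Y Z) x1 y1 (w - x1 - y1) W1 W2 W3 i
      ≤ vw (A0 A X Y Z) x1 y1 (w - x1 - y1) W1 W2 W3 i) : RichS N τ M n w α δ A := by
  fin_cases i
  · change δ ≤ vw _ _ _ _ _ _ _ 0 at hδ
    change α * vw _ _ _ _ _ _ _ 0 ≤ vw _ _ _ _ _ _ _ 0 at hα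
    rw [← dn_vw0] at hδ hα hα
    exact .base ⟨X, Y, Z, W1, W2, x1, y1, hc.s1, hc.i2, hc.p2, hc.f2, hδ, hα⟩
  · change δ ≤ vw _ _ _ _ _ _ _ 1 at hδ
    change α * vw _ _ _ _ _ _ _ 1 ≤ vw _ _ _ _ _ _ _ 1 at hα
    rw [← dn_vw1] at hδ hα hα
    refine .swap (.base ⟨X, Z, Y, W1, W3, x1, w - x1 - y1, hc.s1, hc.i3.trans hc.i2,
      hc.p2.mono hc.i3, hc.f3, ?_, ?_⟩)
    · exact hδ.trans (dn_mono fun a b c _ h => ⟨h.1, h.2.1, h.2.2.2, h.2.2.1⟩)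
    · have e1 : S0 X Z Y = fun a b c => S0 X Y Z a c b := by
        funext a b c; exact propext ⟨fun h => ⟨h.1, h.2.2, h.2.1⟩, fun h => ⟨h.1, h.2.2, h.2.1⟩⟩
      rw [e1]
      exact hα.trans (dn_mono fun a b c _ h => ⟨h.1, h.2.1, h.2.2.2, h.2.2.1⟩)
  · change δ ≤ vw _ _ _ _ _ _ _ 2 at hδ
    change α * vw _ _ _ _ _ _ _ 2 ≤ vw _ _ _ _ _ _ _ 2 at hα
    rw [← dn_vw2] at hδ hα hα
    refine .rot (.base ⟨Y, Z, X, W2, W3, y1, w - x1 - y1, hc.s2, hc.i3,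
      hc.p3, hc.f3, ?_, ?_⟩)
    · exact hδ.trans (dn_mono fun a b c _ h => ⟨h.1, h.2.2.1, h.2.2.2, h.2.1⟩)
    · have e1 : S0 Y Z X = fun a b c => S0 X Y Z c a b := by
        funext a b c; exact propext ⟨fun h => ⟨h.2.2, h.1, h.2.1⟩, fun h => ⟨h.2.1, h.2.2, h.1⟩⟩
      rw [e1]
      exact hα.trans (dn_mono fun a b c _ h => ⟨h.1, h.2.2.1, h.2.2.2, h.2.1⟩)

/-- from three windows to the triangle count -/
lemma count {W1 W2 W3 : Finset G} {p q r : G → Prop} {a0 a1 a2 : G → G → Prop}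
    {s0 : Sub W1 p → Sub W2 q → ℝ} {s1 : Sub W1 p → Sub W3 r → ℝ} {s2 : Sub W2 q → Sub W3 r → ℝ}
    (h0 : ∀ η υ, a0 η υ → p η ∧ q υ) (h1 : ∀ η ζ, a1 η ζ → p η ∧ r ζ) 
    {μx μy μz m0 m1 m2 : ℝ} (hx : μx = 𝔼 η ∈ W1, I (p η)) (hy : μy = 𝔼 η ∈ W2, I (q η))
    (hz : μz = 𝔼 η ∈ W3, I (r η)) {κ γ A B : ℕ} (hA : 2000 * (κ + 1) ^ 2 ≤ A)
    (hB : 200000 * (κ + 1) ^ 3 * (γ + 1) ≤ B) (p0 : 0 < m0) (p1 : 0 < m1) (p2 : 0 < m2)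
    (H0 : Gr (fun (v : Sub W1 p) (u : Sub W2 q) => I (a0 v.1 u.1) * (μx * μy / m0)) s0
      (2 ^ κ) (2 ^ γ) ((1/2) ^ B) ((1/2) ^ A))
    (H1 : Gr (fun (v : Sub W1 p) (u : Sub W3 r) => I (a1 v.1 u.1) * (μx * μz / m1)) s1
      (2 ^ κ) (2 ^ γ) ((1/2) ^ B) ((1/2) ^ A))
    (H2 : Gr (fun (v : Sub W2 q) (u : Sub W3 r) => I (a2 v.1 u.1) * (μy * μz / m2)) s2
      (2 ^ κ) (2 ^ γ) ((1/2) ^ B) ((1/2) ^ A)) :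
    m0 * m1 * m2 / 16 ≤ (μx * μy * μz) *
      𝔼 υ ∈ W2, 𝔼 ζ ∈ W3, 𝔼 η ∈ W1, I (a0 η υ ∧ a1 η ζ ∧ a2 υ ζ) := by
  have c := tri_count' hA hB H1 H0 H2
  have e1 : 𝔼 υ ∈ W2, 𝔼 ζ ∈ W3, 𝔼 η ∈ W1, I (a0 η υ ∧ a1 η ζ ∧ a2 υ ζ)
      = μy * μz * 𝔼 u : Sub W2 q, 𝔼 t : Sub W3 r, I (a2 u.1 t.1) *
        (μx * 𝔼 v : Sub W1 p, I (a0 v.1 u.1) * I (a1 v.1 t.1)) := by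
    rw [hy, hz, ← sub_ex2 W2 W3 q r (fun υ ζ => I (a2 υ ζ) *
        (μx * 𝔼 v : Sub W1 p, I (a0 v.1 υ) * I (a1 v.1 ζ)))]
    refine expect_congr rfl fun υ _ => expect_congr rfl fun ζ _ => ?_
    rw [hx, ← sub_ex W1 p (fun η => I (a0 η υ) * I (a1 η ζ)), mul_expect, mul_expect]
    refine expect_congr rfl fun η _ => ?_
    rw [I_and, I_and]
    by_cases h : a0 η υ
    · by_cases h' : a1 η ζ
      · rw [I_true (h0 _ _ h).1, I_true (h0 _ _ h).2, I_true (h1 _ _ h').2]; ring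
      · rw [I_false h']; ring
    · rw [I_false h]; ring
  obtain ⟨E, hE⟩ : ∃ E, E = 𝔼 u : Sub W2 q, 𝔼 t : Sub W3 r, I (a2 u.1 t.1) *
        𝔼 v : Sub W1 p, I (a0 v.1 u.1) * I (a1 v.1 t.1) := ⟨_, rfl⟩
  have e2 : 𝔼 u : Sub W2 q, 𝔼 t : Sub W3 r, I (a2 u.1 t.1) *
        (μx * 𝔼 v : Sub W1 p, I (a0 v.1 u.1) * I (a1 v.1 t.1)) = μx * E := by
    rw [hE, mul_expect]
    refine expect_congr rfl fun u _ => ?_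
    rw [mul_expect]
    refine expect_congr rfl fun t _ => by ring
  have e3 : 𝔼 y : Sub W2 q, 𝔼 z : Sub W3 r, I (a2 y.1 z.1) * (μy * μz / m2) *
      𝔼 x : Sub W1 p, I (a0 x.1 y.1) * (μx * μy / m0) * (I (a1 x.1 z.1) * (μx * μz / m1))
      = (μx * μy * μz) ^ 2 / (m0 * m1 * m2) * E := by
    rw [hE, mul_expect]
    refine expect_congr rfl fun u _ => ?_
    rw [mul_expect]
    refine expect_congr rfl fun t _ => ?_
    have : ∀ x : Sub W1 p, I (a0 x.1 u.1) * (μx * μy / m0) * (I (a1 x.1 t.1) * (μx * μz / m1))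
      = ((μx * μy / m0) * (μx * μz / m1)) * (I (a0 x.1 u.1) * I (a1 x.1 t.1)) := fun x => by ring
    simp only [this, ← mul_expect]
    field_simp
  rw [e3] at c
  rw [e1, e2]
  have : (μx * μy * μz) ^ 2 / (m0 * m1 * m2) * E * (m0 * m1 * m2)
      = μx * μy * μz * (μy * μz * (μx * E)) := by field_simp
  rw [← this]
  have : 0 < m0 * m1 * m2 := by positivity
  nlinarith
end
end Corners

open Finset BigOperators
open scoped Pointwise

namespace Corners
section
variable {G : Type*} [AddCommGroup G] [DecidableEq G] [Fintype G] {N M : ℕ} {τ : ℝ}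

lemma rich_le_one {n : ℕ} {A : G → G → G → Prop} {X Y Z : G → Prop} {w x y : G} {α δ : ℝ} {P Q : Finset G}
    (δ0 : 0 < δ) (hδ : δ ≤ dn (A0 A X Y Z) w x y P Q)
    (hα : α * dn (S0 X Y Z) w x y P Q ≤ dn (A0 A X Y Z) w x y P Q) : α ≤ 1 := by
  have m : dn (A0 A X Y Z) w x y P Q ≤ dn (S0 X Y Z) w x y P Q := dn_mono fun a b c _ h => h.2
  by_contra h
  push Not at h
  nlinarith

lemma mul_le_aux {u v ε : ℝ} (h : u ≤ ε) (v0 : 0 ≤ v) (v1 : v ≤ 1) (ε0 : 0 ≤ ε) : u * v ≤ ε := by nlinarith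

set_option maxHeartbeats 1600000 in
lemma stepB {n k ℓ Λ e1 : ℕ} {A : G → G → G → Prop} {w : G} {α : ℝ}
    (h : Rich N τ M (n + 7 * (k + 1)) A w α ((1/2) ^ Λ)) (hl : (1/2) ^ ℓ ≤ α)
    (he : 10^6 * (ℓ + 3) ^ 3 * (Λ + 28) ≤ e1) (τ0 : 0 ≤ τ)
    (hτ : 10^11 * τ ≤ (1/2) ^ Λ * ((1/2) ^ e1) ^ 3) (hN : 128 ≤ (N:ℝ) * ((1/2) ^ e1) ^ 2)
    (hk : 10^10 ≤ ((k:ℝ) + 1) * ((1/2) ^ Λ * ((1/2) ^ e1) ^ 3)) :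
    RichS N τ M n w ((1 + (1/2) ^ 21) * α) ((1/2) ^ (Λ + 5000 * (ℓ + 3) ^ 2)) A ∨
    ∃ (X Y Z : G → Prop) (P Q W1 W2 W3 : Finset G) (x1 y1 : G) (bx b_y bz β : ℝ),
      Chain N τ M n P Q W1 W2 W3 ∧ (0 ≤ bx ∧ bx ≤ 1) ∧ (0 ≤ b_y ∧ b_y ≤ 1) ∧ (0 ≤ bz ∧ bz ≤ 1) ∧
      Okay (fun x => I (X x)) (fun x => I (Y x)) (fun x => I (Z x)) bx b_y bz ((1/2) ^ e1) x1 y1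
        (w - x1 - y1) W1 W2 W3 ∧ β = bx * b_y * bz ∧ (1/2) ^ (Λ + 27) ≤ β ∧ α ≤ 1 ∧
      α ^ 3 * β ^ 2 / 40 ≤ 𝔼 υ ∈ W2, 𝔼 ζ ∈ W3, 𝔼 η ∈ W1,
        I (A0 A X Y Z (x1 + η) (y1 + υ) (w - x1 - y1 - η - υ) ∧
          A0 A X Y Z (x1 + η) (y1 - η - ζ) (w - x1 - y1 + ζ) ∧
          A0 A X Y Z (x1 - υ - ζ) (y1 + υ) (w - x1 - y1 + ζ)) := by
  obtain ⟨X, Y, Z, P, Q, x, y, sP, iQ, pQ, fQ, hδ, hα⟩ := h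
  have α1 : α ≤ 1 := rich_le_one (n := n) (by positivity) hδ hα
  have α0 : 0 < α := lt_of_lt_of_le (by positivity) hl
  obtain ⟨C2, hC2⟩ : ∃ C, C = (ℓ + 3) ^ 2 := ⟨_, rfl⟩
  obtain ⟨C3, hC3⟩ : ∃ C, C = (ℓ + 3) ^ 3 := ⟨_, rfl⟩
  have c2 : (ℓ + 2) ^ 2 ≤ C2 := by rw [hC2]; gcongr; omega
  have c3 : (ℓ + 2) ^ 3 ≤ C3 := by rw [hC3]; gcongr; omega
  have c4 : ℓ + 3 ≤ C2 := by rw [hC2]; nlinarith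
  have c5 : C2 ≤ C3 := by rw [hC2, hC3]; exact Nat.pow_le_pow_right (by omega) (by omega)
  have c6 : C3 ≤ C3 * (Λ + 28) := Nat.le_mul_of_pos_right _ (by omega)
  have c7 : Λ + 28 ≤ C3 * (Λ + 28) := Nat.le_mul_of_pos_left _ (by omega)
  rw [← hC3, mul_assoc] at he
  obtain ⟨A_, hA_⟩ : ∃ A_, A_ = 2000 * (ℓ + 2) ^ 2 := ⟨_, rfl⟩
  obtain ⟨B', hB'⟩ : ∃ B', B' = 200000 * (ℓ + 2) ^ 3 * (Λ + 28) := ⟨_, rfl⟩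
  have hA2 : A_ ≤ 2000 * C2 := by omega
  have hB2 : B' ≤ 200000 * (C3 * (Λ + 28)) := by
    rw [hB', mul_assoc]
    exact Nat.mul_le_mul_left _ (Nat.mul_le_mul_right _ c3)
  obtain ⟨ε, hε⟩ : ∃ ε : ℝ, ε = (1/2) ^ e1 := ⟨_, rfl⟩
  rw [← hε] at hτ hN hk ⊢
  have ε0 : 0 < ε := by rw [hε]; positivity
  have e16 : ε ≤ α * (1/2) ^ Λ / 10^16 := by
    have h1 : ε ≤ (1/2) ^ (ℓ + Λ + 54) := by rw [hε]; exact half_le (by omega)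
    rw [pow_add, pow_add] at h1
    have h2 : ((1:ℝ)/2) ^ ℓ * (1/2) ^ Λ ≤ α * (1/2) ^ Λ := by gcongr
    have h3 : (0:ℝ) ≤ (1/2) ^ ℓ * (1/2) ^ Λ := by positivity
    have h4 : ((1:ℝ)/2) ^ 54 ≤ 1 / 10^16 := by norm_num
    have h5 := mul_le_mul_of_nonneg_left h4 h3
    linarith
  obtain ⟨P', Q', W1, W2, W3, x1, y1, bx, b_y, bz, hc, hbx, hby, hbz, ho, hβ, hcase⟩ :=
    point sP iQ pQ fQ hδ hα α0 α1 (by positivity) ε0 e16 τ0 hτ hN hk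
  obtain ⟨β, hβd⟩ : ∃ β, β = bx * b_y * bz := ⟨_, rfl⟩
  rw [← hβd] at hβ hcase
  have hβ27 : (1/2) ^ (Λ + 27) ≤ β := by
    refine le_trans ?_ hβ
    rw [pow_add, div_eq_mul_one_div]
    exact mul_le_mul_of_nonneg_left (by norm_num) (by positivity)
  have β0 : 0 < β := lt_of_lt_of_le (by positivity) hβ27
  have β1 : β ≤ 1 := by
    rw [hβd]; exact mul_le_one₀ (mul_le_one₀ hbx.2 hby.1 hby.2) hbz.1 hbz.2
  have αβ : 0 < α * β := mul_pos α0 β0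
  have hαβ : (1/2) ^ (ℓ + Λ + 27) ≤ α * β := by
    rw [show ℓ + Λ + 27 = ℓ + (Λ + 27) by omega, pow_add _ ℓ]; gcongr
  have hεαβ : ε ≤ α * β / 10^7 := by
    have : (1/2:ℝ) ^ Λ = 10^8 * ((1/2) ^ Λ / 10^8) := by ring
    have : α * ((1/2) ^ Λ / 10^8) ≤ α * β := by gcongr
    have : α * (1/2) ^ Λ / 10^16 = α * ((1/2) ^ Λ / 10^8) / 10^8 := by ring
    linarith
  have hs := okay_dens ho hbx hby hbz
  rw [← hβd] at hs
  rcases hcase with ⟨i, hi⟩ | hall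
  · left
    refine rich_vw hc (x1 := x1) (y1 := y1) X Y Z i ?_ ?_
    · have h1 : (1/2:ℝ) ^ (Λ + 5000 * (ℓ + 3) ^ 2) ≤ (1/2) ^ (ℓ + Λ + 27 + 1) := half_le (by omega)
      rw [pow_succ _ (ℓ + Λ + 27)] at h1
      linarith
    · have h1 := (abs_le.1 (hs i)).2
      have h2 : vw (S0 X Y Z) x1 y1 (w - x1 - y1) W1 W2 W3 i ≤ (1 + 1/10^6/3) * β := by
        have : α * β ≤ β := mul_le_of_le_one_left β0.le α1
        linarith
      refine le_trans (mul_le_mul_of_nonneg_left h2 (by positivity)) (le_trans ?_ hi)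
      have : (1 + (1/2) ^ 21) * α * ((1 + 1 / 10 ^ 6/3) * β) = (1 + (1/2) ^ 21) * (1 + 1/10^6/3) * (α * β) := by ring
      rw [this]
      have : (1 + 1 / 10 ^ 6) * ((1 - 1 / 10 ^ 7) * α * β) = (1 + 1 / 10 ^ 6) * (1 - 1 / 10 ^ 7) * (α * β) := by ring
      rw [this]
      refine mul_le_mul_of_nonneg_right ?_ αβ.le
      norm_num
  have hκ : 2 ≤ 2 ^ (ℓ + 1) * α := by
    have : (2:ℝ) ^ (ℓ + 1) * (1/2) ^ ℓ = 2 := by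
      rw [pow_succ, mul_assoc, mul_comm 2, ← mul_assoc, ← mul_pow]; norm_num
    have h2 := mul_le_mul_of_nonneg_left hl (pow_pos (two_pos (α := ℝ)) (ℓ + 1)).le
    rw [this] at h2; exact h2
  have hγ : 1 ≤ 2 ^ (Λ + 27) * β := by
    have : (2:ℝ) ^ (Λ + 27) * (1/2) ^ (Λ + 27) = 1 := by
      rw [← mul_pow]; norm_num
    have h2 := mul_le_mul_of_nonneg_left hβ27 (pow_pos (two_pos (α := ℝ)) (Λ + 27)).le
    rw [this] at h2; exact h2
  have hε1 : ε ≤ (1/2) ^ B' * β / 2 := by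
    have h1 : ε ≤ (1/2) ^ (B' + (Λ + 27) + 1) := by rw [hε]; exact half_le (by omega)
    rw [pow_succ, pow_add] at h1
    have : ((1:ℝ)/2) ^ B' * (1/2) ^ (Λ + 27) ≤ (1/2) ^ B' * β := by gcongr
    linarith
  have hε2 : ε ≤ (1/2) ^ (2 * A_) * β / 10^7 := by
    have h1 : ε ≤ (1/2) ^ (2 * A_ + (Λ + 27) + 24) := by rw [hε]; exact half_le (by omega)
    rw [pow_add _ _ 24, pow_add] at h1
    have : ((1:ℝ)/2) ^ (2 * A_) * (1/2) ^ (Λ + 27) ≤ (1/2) ^ (2 * A_) * β := by gcongr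
    have h4 : ((1:ℝ)/2) ^ 24 ≤ 1 / 10^7 := by norm_num
    have h3 : (0:ℝ) ≤ (1/2) ^ (2 * A_) * (1/2) ^ (Λ + 27) := by positivity
    have h5 := mul_le_mul_of_nonneg_left h4 h3
    linarith
  have hinc : (1/2:ℝ) ^ (Λ + 5000 * (ℓ + 3) ^ 2) ≤ α * β * (1/2) ^ (2 * A_) / 2 := by
    have h1 : (1/2:ℝ) ^ (Λ + 5000 * (ℓ + 3) ^ 2) ≤ (1/2) ^ (ℓ + Λ + 27 + 2 * A_ + 1) := half_le (by omega)
    rw [pow_succ _ (ℓ + Λ + 27 + 2 * A_), pow_add _ _ (2 * A_)] at h1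
    have : (1/2:ℝ) ^ (ℓ + Λ + 27) * (1/2) ^ (2 * A_) ≤ α * β * (1/2) ^ (2 * A_) := by gcongr
    linarith
  have w0 := hall 0
  have w1 := hall 1
  have w2 := hall 2
  rw [vw0] at w0
  rw [vw1] at w1
  rw [vw2] at w2
  obtain ⟨μx, hμx⟩ : ∃ μ, μ = 𝔼 η ∈ W1, I (X (x1 + η)) := ⟨_, rfl⟩
  obtain ⟨μy, hμy⟩ : ∃ μ, μ = 𝔼 η ∈ W2, I (Y (y1 + η)) := ⟨_, rfl⟩
  obtain ⟨μz, hμz⟩ : ∃ μ, μ = 𝔼 η ∈ W3, I (Z (w - x1 - y1 + η)) := ⟨_, rfl⟩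
  have ex : |μx - bx| ≤ ε := by rw [hμx]; exact ho.vX
  have ey : |μy - b_y| ≤ ε := by rw [hμy]; exact ho.vY
  have ez : |μz - bz| ≤ ε := by rw [hμz]; exact ho.vZ
  obtain ⟨m0, hm0⟩ : ∃ m, m = 𝔼 η ∈ W1, 𝔼 υ ∈ W2, I (A0 A X Y Z (x1 + η) (y1 + υ) (w - x1 - y1 - η - υ)) := ⟨_, rfl⟩
  obtain ⟨m1, hm1⟩ : ∃ m, m = 𝔼 η ∈ W1, 𝔼 ζ ∈ W3, I (A0 A X Y Z (x1 + η) (y1 - η - ζ) (w - x1 - y1 + ζ)) := ⟨_, rfl⟩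
  obtain ⟨m2, hm2⟩ : ∃ m, m = 𝔼 υ ∈ W2, 𝔼 ζ ∈ W3, I (A0 A X Y Z (x1 - υ - ζ) (y1 + υ) (w - x1 - y1 + ζ)) := ⟨_, rfl⟩
  rw [← hm0] at w0
  rw [← hm1] at w1
  rw [← hm2] at w2
  have V0 := view (T := W1) (B := W2) (p := fun η => X (x1 + η)) (q := fun υ => Y (y1 + υ))
    (U := fun η υ => Z (w - x1 - y1 - η - υ))
    (a := fun η υ => A0 A X Y Z (x1 + η) (y1 + υ) (w - x1 - y1 - η - υ))
    (fun η υ h => h.2) hbz.1 hbz.2 hbx.1 hbx.2 hby.1 hby.2 ho.cZ hμx hμy ex ey hm0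
    (β := β) hβd α0 β0 w0 hκ hγ hε1 hε2
  rcases V0 with H0 | ⟨p', q', g1, g2⟩
  swap
  · left
    refine rich_vw hc (x1 := x1) (y1 := y1) (fun x => p' (x - x1)) (fun y => q' (y - y1)) Z 0 ?_ ?_
    · rw [vw0]
      refine hinc.trans (g2.trans (EEI_mono fun η υ h => ⟨h.1.1, ?_, ?_, h.1.2.2.2⟩))
      · dsimp only; rw [add_sub_cancel_left]; exact h.2.1
      · dsimp only; rw [add_sub_cancel_left]; exact h.2.2
    · rw [vw0, vw0]
      refine le_trans (le_of_eq ?_) (g1.trans (EEI_mono fun η υ h => ⟨h.1.1, ?_, ?_, h.1.2.2.2⟩))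
      · simp only [S0, add_sub_cancel_left]
      · dsimp only; rw [add_sub_cancel_left]; exact h.2.1
      · dsimp only; rw [add_sub_cancel_left]; exact h.2.2
  have V1 := view (T := W1) (B := W3) (p := fun η => X (x1 + η)) (q := fun ζ => Z (w - x1 - y1 + ζ))
    (U := fun η ζ => Y (y1 - η - ζ))
    (a := fun η ζ => A0 A X Y Z (x1 + η) (y1 - η - ζ) (w - x1 - y1 + ζ))
    (fun η υ h => ⟨h.2.1, h.2.2.2, h.2.2.1⟩) hby.1 hby.2 hbx.1 hbx.2 hbz.1 hbz.2 ho.cY hμx hμz ex ez hm1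
    (β := β) (by rw [hβd]; ring) α0 β0 w1 hκ hγ hε1 hε2
  rcases V1 with H1 | ⟨p', q', g1, g2⟩
  swap
  · left
    refine rich_vw hc (x1 := x1) (y1 := y1) (fun x => p' (x - x1)) Y (fun z => q' (z - (w - x1 - y1))) 1 ?_ ?_
    · rw [vw1]
      refine hinc.trans (g2.trans (EEI_mono fun η υ h => ⟨h.1.1, ?_, h.1.2.2.1, ?_⟩))
      · dsimp only; rw [add_sub_cancel_left]; exact h.2.1
      · dsimp only; rw [add_sub_cancel_left]; exact h.2.2
    · rw [vw1, vw1]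
      refine le_trans (le_of_eq ?_) (g1.trans (EEI_mono fun η υ h => ⟨h.1.1, ?_, h.1.2.2.1, ?_⟩))
      · simp only [S0, add_sub_cancel_left]
        congr 1
        refine expect_congr rfl fun η _ => expect_congr rfl fun υ _ => ?_
        congr 1; exact propext (by tauto)
      · dsimp only; rw [add_sub_cancel_left]; exact h.2.1
      · dsimp only; rw [add_sub_cancel_left]; exact h.2.2
  have V2 := view (T := W2) (B := W3) (p := fun υ => Y (y1 + υ)) (q := fun ζ => Z (w - x1 - y1 + ζ))
    (U := fun υ ζ => X (x1 - υ - ζ))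
    (a := fun υ ζ => A0 A X Y Z (x1 - υ - ζ) (y1 + υ) (w - x1 - y1 + ζ))
    (fun η υ h => ⟨h.2.2.1, h.2.2.2, h.2.1⟩) hbx.1 hbx.2 hby.1 hby.2 hbz.1 hbz.2 ho.cX hμy hμz ey ez hm2
    (β := β) (by rw [hβd]; ring) α0 β0 w2 hκ hγ hε1 hε2
  rcases V2 with H2 | ⟨p', q', g1, g2⟩
  swap
  · left
    refine rich_vw hc (x1 := x1) (y1 := y1) X (fun y => p' (y - y1)) (fun z => q' (z - (w - x1 - y1))) 2 ?_ ?_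
    · rw [vw2]
      refine hinc.trans (g2.trans (EEI_mono fun η υ h => ⟨h.1.1, h.1.2.1, ?_, ?_⟩))
      · dsimp only; rw [add_sub_cancel_left]; exact h.2.1
      · dsimp only; rw [add_sub_cancel_left]; exact h.2.2
    · rw [vw2, vw2]
      refine le_trans (le_of_eq ?_) (g1.trans (EEI_mono fun η υ h => ⟨h.1.1, h.1.2.1, ?_, ?_⟩))
      · simp only [S0, add_sub_cancel_left]
        congr 1
        refine expect_congr rfl fun η _ => expect_congr rfl fun υ _ => ?_
        congr 1; exact propext (by tauto)
      · dsimp only; rw [add_sub_cancel_left]; exact h.2.1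
      · dsimp only; rw [add_sub_cancel_left]; exact h.2.2
  right
  refine ⟨X, Y, Z, P', Q', W1, W2, W3, x1, y1, bx, b_y, bz, β, hc, hbx, hby, hbz, ho, hβd, hβ27, α1, ?_⟩
  have lo : 0 < (1 - 1/10^5) * ((1 - 1/10^7) * α * β) := by
    have : (1 - 1/10^5) * ((1 - 1/10^7) * α * β) = (1 - 1/10^5) * (1 - 1/10^7) * (α * β) := by ring
    rw [this]; exact mul_pos (by norm_num) αβ
  have cnt := count (p := fun η => X (x1 + η)) (q := fun υ => Y (y1 + υ)) (r := fun ζ => Z (w - x1 - y1 + ζ))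
    (a0 := fun η υ => A0 A X Y Z (x1 + η) (y1 + υ) (w - x1 - y1 - η - υ))
    (a1 := fun η ζ => A0 A X Y Z (x1 + η) (y1 - η - ζ) (w - x1 - y1 + ζ))
    (a2 := fun υ ζ => A0 A X Y Z (x1 - υ - ζ) (y1 + υ) (w - x1 - y1 + ζ)) (fun η υ h => ⟨h.2.1, h.2.2.1⟩) (fun η υ h => ⟨h.2.1, h.2.2.2⟩) hμx hμy hμz
    (κ := ℓ + 1) (γ := Λ + 27) (A := A_) (B := B')
    hA_.ge hB'.ge (by linarith) (by linarith) (by linarith) H0 H1 H2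
  obtain ⟨T, hT⟩ : ∃ T, T = 𝔼 υ ∈ W2, 𝔼 ζ ∈ W3, 𝔼 η ∈ W1,
        I (A0 A X Y Z (x1 + η) (y1 + υ) (w - x1 - y1 - η - υ) ∧
          A0 A X Y Z (x1 + η) (y1 - η - ζ) (w - x1 - y1 + ζ) ∧
          A0 A X Y Z (x1 - υ - ζ) (y1 + υ) (w - x1 - y1 + ζ)) := ⟨_, rfl⟩
  rw [← hT] at cnt ⊢
  have T0 : 0 ≤ T := by
    rw [hT]; exact expect_nonneg fun _ _ => expect_nonneg fun _ _ => expect_nonneg fun _ _ => I_nonneg _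
  have mx : 0 ≤ μx ∧ μx ≤ 1 := by rw [hμx]; exact exI_mem
  have my : 0 ≤ μy ∧ μy ≤ 1 := by rw [hμy]; exact exI_mem
  have mz : 0 ≤ μz ∧ μz ≤ 1 := by rw [hμz]; exact exI_mem
  have pr : μx * μy * μz ≤ (1 + 1/100) * β := by
    rw [abs_le] at ex ey ez
    have h1 : μx * μy * μz - bx * b_y * bz = (μx - bx) * (μy * μz) + (μy - b_y) * (bx * μz) + (μz - bz) * (bx * b_y) := by ring
    have a1 : (μx - bx) * (μy * μz) ≤ ε :=
      mul_le_aux ex.2 (mul_nonneg my.1 mz.1) (mul_le_one₀ my.2 mz.1 mz.2) ε0.le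
    have a2 : (μy - b_y) * (bx * μz) ≤ ε :=
      mul_le_aux ey.2 (mul_nonneg hbx.1 mz.1) (mul_le_one₀ hbx.2 mz.1 mz.2) ε0.le
    have a3 : (μz - bz) * (bx * b_y) ≤ ε :=
      mul_le_aux ez.2 (mul_nonneg hbx.1 hby.1) (mul_le_one₀ hbx.2 hby.1 hby.2) ε0.le
    have : α * β ≤ β := mul_le_of_le_one_left β0.le α1
    rw [← hβd] at h1
    linarith
  have lo' : (9/10) * (α * β) ≤ (1 - 1/10^5) * ((1 - 1/10^7) * α * β) := by
    have : (1 - 1/10^5) * ((1 - 1/10^7) * α * β) = (1 - 1/10^5) * (1 - 1/10^7) * (α * β) := by ring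
    rw [this]; exact mul_le_mul_of_nonneg_right (by norm_num) αβ.le
  have q0 : (9/10) * (α * β) ≤ m0 := lo'.trans w0
  have q1 : (9/10) * (α * β) ≤ m1 := lo'.trans w1
  have q2 : (9/10) * (α * β) ≤ m2 := lo'.trans w2
  have q3 : ((9/10) * (α * β)) ^ 3 ≤ m0 * m1 * m2 := by
    have z0 : 0 ≤ (9/10) * (α * β) := by positivity
    have z1 : 0 ≤ m0 * m1 := mul_nonneg (z0.trans q0) (z0.trans q1)
    rw [pow_succ, sq]
    exact mul_le_mul (mul_le_mul q0 q1 z0 (z0.trans q0)) q2 z0 z1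
  have q4 : ((9/10) * (α * β)) ^ 3 / 16 ≤ (1 + 1/100) * β * T := by
    have := mul_le_mul_of_nonneg_right pr T0
    linarith
  have q5 : β * (α ^ 3 * β ^ 2 / 40) ≤ β * T := by
    have e : ((9/10) * (α * β)) ^ 3 = (9/10) ^ 3 * (β * (α ^ 3 * β ^ 2)) := by ring
    have : 0 < β * (α ^ 3 * β ^ 2) := by positivity
    rw [e] at q4
    linarith
  exact le_of_mul_le_mul_left q5 β0
end
end Corners

open Finset BigOperators
open scoped Pointwise

namespace Corners
section
variable {G : Type*} [AddCommGroup G] [DecidableEq G] [Fintype G] {N M : ℕ} {τ : ℝ}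

lemma ab1 {a b : ℝ} (ha : |a| ≤ 1) (hb : |b| ≤ 1) : |a * b| ≤ 1 := by
  rw [abs_mul]; exact mul_le_one₀ ha (abs_nonneg _) hb

lemma six {W1 W2 W3 : Finset G} {p q r : G → ℝ} {P Q R : G → G → ℝ} {bx b_y bz ε : ℝ}
    (ε0 : 0 ≤ ε)
    (hp : ∀ x, |p x| ≤ 1) (hq : ∀ x, |q x| ≤ 1) (hr : ∀ x, |r x| ≤ 1)
    (hP : ∀ x y, |P x y| ≤ 1) (hQ : ∀ x y, |Q x y| ≤ 1) 
    (hy : |b_y| ≤ 1) (hz : |bz| ≤ 1)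
    (cP : CutS W2 W3 (fun υ ζ => P υ ζ - bx) ε) (cQ : CutS W1 W3 (fun η ζ => Q η ζ - b_y) ε)
    (cR : CutS W1 W2 (fun η υ => R η υ - bz) ε) :
    𝔼 υ ∈ W2, 𝔼 ζ ∈ W3, 𝔼 η ∈ W1, p η * q υ * r ζ * (P υ ζ * Q η ζ * R η υ)
      ≤ bx * b_y * bz * (𝔼 υ ∈ W2, 𝔼 ζ ∈ W3, 𝔼 η ∈ W1, p η * q υ * r ζ) + 3 * ε := by
  have D1 : 𝔼 υ ∈ W2, 𝔼 ζ ∈ W3, 𝔼 η ∈ W1, (R η υ - bz) * ((p η * Q η ζ) * (q υ * r ζ * P υ ζ)) ≤ ε := by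
    rw [expect_comm]
    refine (abs_le.1 (exS_abs_le' ε0 fun ζ => ?_)).2
    rw [expect_comm]
    exact cR (fun η => p η * Q η ζ) (fun υ => q υ * r ζ * P υ ζ) (fun η => ab1 (hp _) (hQ _ _))
      (fun υ => ab1 (ab1 (hq _) (hr _)) (hP _ _))
  have D2 : 𝔼 υ ∈ W2, 𝔼 ζ ∈ W3, 𝔼 η ∈ W1, (Q η ζ - b_y) * (p η * (q υ * r ζ * P υ ζ * bz)) ≤ ε := by
    refine (abs_le.1 (exS_abs_le' ε0 fun υ => ?_)).2
    rw [expect_comm]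
    exact cQ (fun η => p η) (fun ζ => q υ * r ζ * P υ ζ * bz) (fun η => hp _)
      (fun ζ => ab1 (ab1 (ab1 (hq _) (hr _)) (hP _ _)) hz)
  have D3 : 𝔼 υ ∈ W2, 𝔼 ζ ∈ W3, 𝔼 η ∈ W1, (P υ ζ - bx) * (q υ * (r ζ * p η * b_y * bz)) ≤ ε := by
    have : 𝔼 υ ∈ W2, 𝔼 ζ ∈ W3, 𝔼 η ∈ W1, (P υ ζ - bx) * (q υ * (r ζ * p η * b_y * bz))
      = 𝔼 η ∈ W1, 𝔼 υ ∈ W2, 𝔼 ζ ∈ W3, (P υ ζ - bx) * (q υ * (r ζ * p η * b_y * bz)) := by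
      rw [expect_comm (s := W1)]
      refine expect_congr rfl fun υ _ => ?_
      rw [expect_comm]
    rw [this]
    refine (abs_le.1 (exS_abs_le' ε0 fun η => ?_)).2
    exact cP (fun υ => q υ) (fun ζ => r ζ * p η * b_y * bz) (fun η => hq _)
      (fun ζ => ab1 (ab1 (ab1 (hr _) (hp _)) hy) hz)
  have e : 𝔼 υ ∈ W2, 𝔼 ζ ∈ W3, 𝔼 η ∈ W1, p η * q υ * r ζ * (P υ ζ * Q η ζ * R η υ)
      = bx * b_y * bz * (𝔼 υ ∈ W2, 𝔼 ζ ∈ W3, 𝔼 η ∈ W1, p η * q υ * r ζ)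
      + 𝔼 υ ∈ W2, 𝔼 ζ ∈ W3, 𝔼 η ∈ W1, (R η υ - bz) * ((p η * Q η ζ) * (q υ * r ζ * P υ ζ))
      + 𝔼 υ ∈ W2, 𝔼 ζ ∈ W3, 𝔼 η ∈ W1, (Q η ζ - b_y) * (p η * (q υ * r ζ * P υ ζ * bz))
      + 𝔼 υ ∈ W2, 𝔼 ζ ∈ W3, 𝔼 η ∈ W1, (P υ ζ - bx) * (q υ * (r ζ * p η * b_y * bz)) := by
    simp only [mul_expect, ← expect_add_distrib]
    refine expect_congr rfl fun υ _ => expect_congr rfl fun ζ _ => expect_congr rfl fun η _ => ?_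
    ring
  rw [e]; linarith

lemma triple {W1 W2 W3 : Finset G} {p q r : G → ℝ} :
    𝔼 υ ∈ W2, 𝔼 ζ ∈ W3, 𝔼 η ∈ W1, p η * q υ * r ζ
      = (𝔼 η ∈ W1, p η) * (𝔼 υ ∈ W2, q υ) * 𝔼 ζ ∈ W3, r ζ := by
  have : ∀ υ ζ, 𝔼 η ∈ W1, p η * q υ * r ζ = (𝔼 η ∈ W1, p η) * q υ * r ζ := by
    intro υ ζ; rw [← expect_mul, ← expect_mul]
  simp only [this, ← mul_expect, ← expect_mul]

lemma sum_planes (F : G → G → G → Prop) {W1 W2 W3 : Finset G} (h1 : W1.Nonempty) :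
    ∑ s, 𝔼 υ ∈ W2, 𝔼 ζ ∈ W3, I (F (s - υ - ζ) υ ζ ∧ s - υ - ζ ∈ W1)
      = W1.card * 𝔼 υ ∈ W2, 𝔼 ζ ∈ W3, 𝔼 η ∈ W1, I (F η υ ζ) := by
  rw [← expect_sum_comm, mul_expect]
  refine expect_congr rfl fun υ _ => ?_
  rw [← expect_sum_comm, mul_expect]
  refine expect_congr rfl fun ζ _ => ?_
  rw [expect_eq_sum_div_card, mul_div_cancel₀ _ (by exact_mod_cast h1.card_pos.ne')]
  have e := Equiv.sum_comp (Equiv.subRight (υ + ζ)) (fun η => I (F η υ ζ ∧ η ∈ W1))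
  simp only [Equiv.subRight_apply, ← sub_sub] at e
  rw [e, ← sum_subset (subset_univ W1)]
  · refine sum_congr rfl fun η h => ?_
    congr 1; exact propext ⟨fun h => h.1, fun h' => ⟨h', h⟩⟩
  · intro η _ h
    exact I_false fun h' => h h'.2

/-- choose a plane outside the bad set -/
lemma choose_plane {F F' : G → G → G → Prop} {W1 W2 W3 : Finset G} {T U a : ℝ} {w : G}
    (s1 : Sy W1) (i3 : W3 ⊆ W2) (p2 : Pres τ W1 W2) (τ1 : τ ≤ 1)
    (hT : T = 𝔼 υ ∈ W2, 𝔼 ζ ∈ W3, 𝔼 η ∈ W1, I (F η υ ζ))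
    (hU : U = 𝔼 υ ∈ W2, 𝔼 ζ ∈ W3, 𝔼 η ∈ W1, I (F' η υ ζ)) (a0 : 0 ≤ a) (hTU : 4 * (a * U) ≤ T)
    (T0 : 0 < T) (bad : Finset G) (hb : 4 * bad.card < W1.card * T) :
    ∃ s, w + s ∉ bad ∧
      T / 4 ≤ 𝔼 υ ∈ W2, 𝔼 ζ ∈ W3, I (F (s - υ - ζ) υ ζ ∧ s - υ - ζ ∈ W1) ∧ 
      a * 𝔼 υ ∈ W2, 𝔼 ζ ∈ W3, I (F' (s - υ - ζ) υ ζ ∧ s - υ - ζ ∈ W1)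
        ≤ 𝔼 υ ∈ W2, 𝔼 ζ ∈ W3, I (F (s - υ - ζ) υ ζ ∧ s - υ - ζ ∈ W1) := by
  have hF := sum_planes F (W2 := W2) (W3 := W3) s1.ne
  have hF' := sum_planes F' (W2 := W2) (W3 := W3) s1.ne
  rw [← hT] at hF
  rw [← hU] at hF'
  obtain ⟨t, ht⟩ : ∃ t : G → ℝ, t = fun s => 𝔼 υ ∈ W2, 𝔼 ζ ∈ W3, I (F (s - υ - ζ) υ ζ ∧ s - υ - ζ ∈ W1) := ⟨_, rfl⟩
  obtain ⟨u, hu⟩ : ∃ u : G → ℝ, u = fun s => 𝔼 υ ∈ W2, 𝔼 ζ ∈ W3, I (F' (s - υ - ζ) υ ζ ∧ s - υ - ζ ∈ W1) := ⟨_, rfl⟩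
  have t0 : ∀ s, 0 ≤ t s ∧ t s ≤ 1 := fun s => by rw [ht]; exact EEI_mem
  have u0 : ∀ s, 0 ≤ u s := fun s => by rw [hu]; exact EEI_mem.1
  have et : ∑ s, t s = W1.card * T := by rw [ht]; exact hF
  have eu : ∑ s, u s = W1.card * U := by rw [hu]; exact hF'
  by_contra hcon
  push Not at hcon
  have hcon' : ∀ s, w + s ∉ bad → t s - a * u s ≤ T / 4 := by
    intro s hs
    by_contra hlt
    push Not at hlt
    have h1 : T / 4 ≤ t s := by nlinarith [mul_nonneg a0 (u0 s)]
    have h2 := hcon s hs (by rw [ht] at h1; exact h1)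
    have h3 : t s < a * u s := by rw [ht, hu]; exact h2
    linarith
  have key : ∀ s, t s - a * u s ≤ (if s ∈ W1 + (W2 + W2) then T / 4 else 0) + (if w + s ∈ bad then 1 else 0) := by
    intro s
    have := mul_nonneg a0 (u0 s)
    by_cases hb' : w + s ∈ bad
    · rw [if_pos hb']
      have : 0 ≤ (if s ∈ W1 + (W2 + W2) then T / 4 else 0) := by split_ifs <;> linarith
      linarith [(t0 s).2]
    · rw [if_neg hb', add_zero]
      split_ifs with h
      · exact hcon' s hb'
      · have : t s = 0 := by
          rw [ht]
          refine expect_eq_zero fun υ hυ => expect_eq_zero fun ζ hζ => I_false fun h' => h ?_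
          rw [show s = (s - υ - ζ) + (υ + ζ) by abel]
          exact add_mem_add h'.2 (add_mem_add hυ (i3 hζ))
        linarith
  have S := sum_le_sum (s := univ) fun s _ => key s
  rw [sum_sub_distrib, ← mul_sum, et, eu, sum_add_distrib] at S
  have c1 : ∑ s : G, (if s ∈ W1 + (W2 + W2) then T / 4 else 0) = (W1 + (W2 + W2)).card * (T / 4) := by
    rw [← sum_filter, filter_mem_eq_inter, univ_inter, sum_const, nsmul_eq_mul]
  have c2 : ∑ s : G, (if w + s ∈ bad then (1:ℝ) else 0) = bad.card := by
    have := Equiv.sum_comp (Equiv.addLeft w) (fun s => if s ∈ bad then (1:ℝ) else 0)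
    refine Eq.trans this ?_
    rw [← sum_filter, filter_mem_eq_inter, univ_inter, sum_const, nsmul_eq_mul, mul_one]
  rw [c1, c2] at S
  have hW : (0:ℝ) < W1.card := s1.pos
  have hP : ((W1 + (W2 + W2)).card : ℝ) * (T / 4) ≤ 2 * W1.card * (T / 4) := by
    refine mul_le_mul_of_nonneg_right (p2.trans ?_) (by linarith)
    nlinarith
  have : (W1.card : ℝ) * (4 * (a * U)) ≤ W1.card * T := mul_le_mul_of_nonneg_left hTU hW.le
  nlinarith
end
end Corners

open Finset BigOperators
open scoped Pointwise

namespace Corners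
section
variable {G : Type*} [AddCommGroup G] [DecidableEq G] [Fintype G] {N M : ℕ} {τ : ℝ}

set_option maxHeartbeats 1600000 in
lemma success {n : ℕ} {A : G → G → G → Prop} {w : G} {α ε a : ℝ} (X Y Z : G → Prop) {P Q W1 W2 W3 : Finset G}
    {x1 y1 : G} {bx b_y bz β : ℝ} (hc : Chain N τ M n P Q W1 W2 W3)
    (hbx : 0 ≤ bx ∧ bx ≤ 1) (hby : 0 ≤ b_y ∧ b_y ≤ 1) (hbz : 0 ≤ bz ∧ bz ≤ 1)
    (ho : Okay (fun x => I (X x)) (fun x => I (Y x)) (fun x => I (Z x)) bx b_y bz ε x1 y1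
        (w - x1 - y1) W1 W2 W3) (hβ : β = bx * b_y * bz) (β0 : 0 < β) (α0 : 0 < α)
    (ε0 : 0 ≤ ε) (hε : 6 * ε ≤ β ^ 2) (τ1 : τ ≤ 1) (a0 : 0 ≤ a) (ha : a ≤ α ^ 3 / 512) (bad : Finset G)
    (hb : 4 * bad.card < M * (α ^ 3 * β ^ 2 / 40))
    (hT : α ^ 3 * β ^ 2 / 40 ≤ 𝔼 υ ∈ W2, 𝔼 ζ ∈ W3, 𝔼 η ∈ W1,
        I (A0 A X Y Z (x1 + η) (y1 + υ) (w - x1 - y1 - η - υ) ∧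
          A0 A X Y Z (x1 + η) (y1 - η - ζ) (w - x1 - y1 + ζ) ∧
          A0 A X Y Z (x1 - υ - ζ) (y1 + υ) (w - x1 - y1 + ζ))) :
    ∃ w', w' ∉ bad ∧ RichS N τ M n w' a (α ^ 3 * β ^ 2 / 160) (Tri A w) := by
  obtain ⟨T, hTd⟩ : ∃ T, T = 𝔼 υ ∈ W2, 𝔼 ζ ∈ W3, 𝔼 η ∈ W1,
        I (A0 A X Y Z (x1 + η) (y1 + υ) (w - x1 - y1 - η - υ) ∧
          A0 A X Y Z (x1 + η) (y1 - η - ζ) (w - x1 - y1 + ζ) ∧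
          A0 A X Y Z (x1 - υ - ζ) (y1 + υ) (w - x1 - y1 + ζ)) := ⟨_, rfl⟩
  rw [← hTd] at hT
  obtain ⟨U, hUd⟩ : ∃ U, U = 𝔼 υ ∈ W2, 𝔼 ζ ∈ W3, 𝔼 η ∈ W1,
        I ((X (x1 + η) ∧ Y (y1 + υ) ∧ Z (w - x1 - y1 + ζ)) ∧
          (X (x1 - υ - ζ) ∧ Y (y1 - η - ζ) ∧ Z (w - x1 - y1 - η - υ))) := ⟨_, rfl⟩
  have β1 : β ≤ 1 := by
    rw [hβ]; exact mul_le_one₀ (mul_le_one₀ hbx.2 hby.1 hby.2) hbz.1 hbz.2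
  have hU : U ≤ 2 * β ^ 2 := by
    have s := six (W1 := W1) (W2 := W2) (W3 := W3) (p := fun η => I (X (x1 + η)))
      (q := fun υ => I (Y (y1 + υ))) (r := fun ζ => I (Z (w - x1 - y1 + ζ)))
      (P := fun υ ζ => I (X (x1 - υ - ζ))) (Q := fun η ζ => I (Y (y1 - η - ζ)))
      (R := fun η υ => I (Z (w - x1 - y1 - η - υ))) ε0 (fun _ => I_abs_le _) (fun _ => I_abs_le _)
      (fun _ => I_abs_le _) (fun _ _ => I_abs_le _) (fun _ _ => I_abs_le _)
      (by rw [abs_of_nonneg hby.1]; exact hby.2) (by rw [abs_of_nonneg hbz.1]; exact hbz.2) ho.cX ho.cY ho.cZ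
    rw [triple, ← hβ] at s
    have eU : U = 𝔼 υ ∈ W2, 𝔼 ζ ∈ W3, 𝔼 η ∈ W1, I (X (x1 + η)) * I (Y (y1 + υ)) * I (Z (w - x1 - y1 + ζ)) *
      (I (X (x1 - υ - ζ)) * I (Y (y1 - η - ζ)) * I (Z (w - x1 - y1 - η - υ))) := by
      rw [hUd]
      refine expect_congr rfl fun υ _ => expect_congr rfl fun ζ _ => expect_congr rfl fun η _ => ?_
      simp only [I_and]; ring
    rw [← eU] at s
    obtain ⟨μx, hμx⟩ : ∃ μ, μ = 𝔼 η ∈ W1, I (X (x1 + η)) := ⟨_, rfl⟩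
    obtain ⟨μy, hμy⟩ : ∃ μ, μ = 𝔼 η ∈ W2, I (Y (y1 + η)) := ⟨_, rfl⟩
    obtain ⟨μz, hμz⟩ : ∃ μ, μ = 𝔼 η ∈ W3, I (Z (w - x1 - y1 + η)) := ⟨_, rfl⟩
    have ex : |μx - bx| ≤ ε := by rw [hμx]; exact ho.vX
    have ey : |μy - b_y| ≤ ε := by rw [hμy]; exact ho.vY
    have ez : |μz - bz| ≤ ε := by rw [hμz]; exact ho.vZ
    have my : 0 ≤ μy ∧ μy ≤ 1 := by rw [hμy]; exact exI_mem
    have mz : 0 ≤ μz ∧ μz ≤ 1 := by rw [hμz]; exact exI_mem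
    rw [← hμx, ← hμy, ← hμz] at s
    rw [abs_le] at ex ey ez
    have h1 : μx * μy * μz - bx * b_y * bz = (μx - bx) * (μy * μz) + (μy - b_y) * (bx * μz) + (μz - bz) * (bx * b_y) := by ring
    have a1 : (μx - bx) * (μy * μz) ≤ ε :=
      mul_le_aux ex.2 (mul_nonneg my.1 mz.1) (mul_le_one₀ my.2 mz.1 mz.2) ε0
    have a2 : (μy - b_y) * (bx * μz) ≤ ε :=
      mul_le_aux ey.2 (mul_nonneg hbx.1 mz.1) (mul_le_one₀ hbx.2 mz.1 mz.2) ε0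
    have a3 : (μz - bz) * (bx * b_y) ≤ ε :=
      mul_le_aux ez.2 (mul_nonneg hbx.1 hby.1) (mul_le_one₀ hbx.2 hby.1 hby.2) ε0
    rw [← hβ] at h1
    have h2 : μx * μy * μz ≤ β + 3 * ε := by linarith
    have h3 := mul_le_mul_of_nonneg_left h2 β0.le
    have h4 : β * ε ≤ ε := mul_le_of_le_one_left ε0 β1
    linarith
  have U0 : 0 ≤ U := by
    rw [hUd]; exact expect_nonneg fun _ _ => expect_nonneg fun _ _ => expect_nonneg fun _ _ => I_nonneg _
  have pos : 0 < α ^ 3 * β ^ 2 := by positivity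
  have hTU : 4 * (a * U) ≤ T := by
    have h1 : a * U ≤ α ^ 3 / 512 * (2 * β ^ 2) := mul_le_mul ha hU U0 (by positivity)
    linarith
  have hM : M ≤ W1.card := hc.f2.base.2.trans (card_le_card hc.i2)
  have hb' : 4 * (bad.card : ℝ) < W1.card * T := by
    refine hb.trans_le (mul_le_mul (by exact_mod_cast hM) hT (by positivity) (by positivity))
  obtain ⟨s, hs, k1, k2⟩ := choose_plane (w := w) hc.s1 hc.i3 hc.p2 τ1 hTd hUd a0 hTU (by linarith) bad hb'
  refine ⟨w + s, hs, .rot (.base ⟨fun y => Y y ∧ Y (y - s), fun z => Z z ∧ Z (z - s),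
    fun x => X x ∧ X (x - s) ∧ x - x1 ∈ W1, W2, W3, y1, w - x1 - y1, hc.s2, hc.i3, hc.p3, hc.f3, ?_⟩)⟩
  have F1 : 𝔼 υ ∈ W2, 𝔼 ζ ∈ W3, I ((A0 A X Y Z (x1 + (s - υ - ζ)) (y1 + υ) (w - x1 - y1 - (s - υ - ζ) - υ) ∧
          A0 A X Y Z (x1 + (s - υ - ζ)) (y1 - (s - υ - ζ) - ζ) (w - x1 - y1 + ζ) ∧
          A0 A X Y Z (x1 - υ - ζ) (y1 + υ) (w - x1 - y1 + ζ)) ∧ s - υ - ζ ∈ W1) ≤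
      dn (A0 (fun a b c => Tri A w c a b) (fun y => Y y ∧ Y (y - s)) (fun z => Z z ∧ Z (z - s))
        (fun x => X x ∧ X (x - s) ∧ x - x1 ∈ W1)) (w + s) y1 (w - x1 - y1) W2 W3 := by
    refine EEI_mono fun υ ζ h => ?_
    obtain ⟨⟨⟨b1, b2, b3, b4⟩, ⟨b5, b6, b7, b8⟩, ⟨c1, c2, c3, c4⟩⟩, c5⟩ := h
    rw [show w + s - (y1 + υ) - (w - x1 - y1 + ζ) = x1 + (s - υ - ζ) by abel]
    refine ⟨⟨?_, ?_, ?_⟩, ⟨b3, ?_⟩, ⟨b8, ?_⟩, ⟨b2, ?_, ?_⟩⟩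
    · rwa [show w - (y1 + υ) - (w - x1 - y1 + ζ) = x1 - υ - ζ by abel]
    · rwa [show w - (x1 + (s - υ - ζ)) - (w - x1 - y1 + ζ) = y1 - (s - υ - ζ) - ζ by abel]
    · rwa [show w - (x1 + (s - υ - ζ)) - (y1 + υ) = w - x1 - y1 - (s - υ - ζ) - υ by abel]
    · rwa [show y1 + υ - s = y1 - (s - υ - ζ) - ζ by abel]
    · rwa [show w - x1 - y1 + ζ - s = w - x1 - y1 - (s - υ - ζ) - υ by abel]
    · rwa [show x1 + (s - υ - ζ) - s = x1 - υ - ζ by abel]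
    · rwa [add_sub_cancel_left]
  have F2 : dn (S0 (fun y => Y y ∧ Y (y - s)) (fun z => Z z ∧ Z (z - s))
        (fun x => X x ∧ X (x - s) ∧ x - x1 ∈ W1)) (w + s) y1 (w - x1 - y1) W2 W3 ≤
      𝔼 υ ∈ W2, 𝔼 ζ ∈ W3, I (((X (x1 + (s - υ - ζ)) ∧ Y (y1 + υ) ∧ Z (w - x1 - y1 + ζ)) ∧
          (X (x1 - υ - ζ) ∧ Y (y1 - (s - υ - ζ) - ζ) ∧ Z (w - x1 - y1 - (s - υ - ζ) - υ))) ∧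
            s - υ - ζ ∈ W1) := by
    refine EEI_mono fun υ ζ h => ?_
    rw [show w + s - (y1 + υ) - (w - x1 - y1 + ζ) = x1 + (s - υ - ζ) by abel] at h
    obtain ⟨⟨b1, b2⟩, ⟨b3, b4⟩, b5, b6, b7⟩ := h
    refine ⟨⟨⟨b5, b1, b3⟩, ?_, ?_, ?_⟩, ?_⟩
    · rwa [show x1 + (s - υ - ζ) - s = x1 - υ - ζ by abel] at b6
    · rwa [show y1 + υ - s = y1 - (s - υ - ζ) - ζ by abel] at b2
    · rwa [show w - x1 - y1 + ζ - s = w - x1 - y1 - (s - υ - ζ) - υ by abel] at b4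
    · rwa [add_sub_cancel_left] at b7
  refine ⟨le_trans (by linarith) (k1.trans F1), ?_⟩
  exact (mul_le_mul_of_nonneg_left F2 a0).trans (k2.trans F1)

lemma tri_swap (A : G → G → G → Prop) (w : G) (a b c : G) :
    Tri (fun a b c => A a c b) w a b c → Tri A w a c b := by
  rintro ⟨h1, h2, h3⟩
  refine ⟨?_, h3, h2⟩
  rwa [show w - c - b = w - b - c by abel]

lemma tri_rot (A : G → G → G → Prop) (w : G) (a b c : G) :
    Tri (fun a b c => A c a b) w a b c → Tri A w c a b := by
  rintro ⟨h1, h2, h3⟩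
  refine ⟨h3, ?_, ?_⟩
  · rwa [show w - c - b = w - b - c by abel]
  · rwa [show w - c - a = w - a - c by abel]

lemma step {n k ℓ Λ e1 : ℕ} {A : G → G → G → Prop} {w : G} {α : ℝ}
    (h : RichS N τ M (n + 7 * (k + 1)) w α ((1/2) ^ Λ) A) (hl : (1/2) ^ ℓ ≤ α)
    (he : 10^6 * (ℓ + 3) ^ 3 * (Λ + 28) ≤ e1) (τ0 : 0 ≤ τ)
    (hτ : 10^11 * τ ≤ (1/2) ^ Λ * ((1/2) ^ e1) ^ 3) (hN : 128 ≤ (N:ℝ) * ((1/2) ^ e1) ^ 2)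
    (hk : 10^10 ≤ ((k:ℝ) + 1) * ((1/2) ^ Λ * ((1/2) ^ e1) ^ 3)) (bad : Finset G)
    (hb : 4 * bad.card < M * (1/2 : ℝ) ^ (2 * Λ + 3 * ℓ + 60)) :
    RichS N τ M n w ((1 + (1/2) ^ 21) * α) ((1/2) ^ (Λ + 5000 * (ℓ + 3) ^ 2)) A ∨
    ∃ w', w' ∉ bad ∧ RichS N τ M n w' ((1/2) ^ (3 * ℓ + 9)) ((1/2) ^ (2 * Λ + 3 * ℓ + 62)) (Tri A w) := by
  induction h with
  | swap h ih =>
    rcases ih with ih | ⟨w', hw', ih⟩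
    · exact Or.inl (.swap ih)
    · exact Or.inr ⟨w', hw', .swap (ih.mono le_rfl le_rfl le_rfl fun a b c _ => tri_swap _ _ a b c)⟩
  | rot h ih =>
    rcases ih with ih | ⟨w', hw', ih⟩
    · exact Or.inl (.rot ih)
    · exact Or.inr ⟨w', hw', .rot (ih.mono le_rfl le_rfl le_rfl fun a b c _ => tri_rot _ _ a b c)⟩
  | base h =>
    rcases stepB h hl he τ0 hτ hN hk with h | ⟨X, Y, Z, P, Q, W1, W2, W3, x1, y1, bx, b_y, bz, β,
      hc, hbx, hby, hbz, ho, hβ, hβ27, α1, hT⟩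
    · exact Or.inl h
    right
    have α0 : 0 < α := lt_of_lt_of_le (by positivity) hl
    have β0 : 0 < β := lt_of_lt_of_le (by positivity) hβ27
    have α3 : (1/2) ^ (3 * ℓ) ≤ α ^ 3 := by
      rw [mul_comm, pow_mul]; gcongr
    have β2 : (1/2) ^ (2 * Λ + 54) ≤ β ^ 2 := by
      rw [show 2 * Λ + 54 = (Λ + 27) * 2 by ring, pow_mul]; gcongr
    have αβ : (1/2) ^ (2 * Λ + 3 * ℓ + 54) ≤ α ^ 3 * β ^ 2 := by
      rw [show 2 * Λ + 3 * ℓ + 54 = 3 * ℓ + (2 * Λ + 54) by ring, pow_add _ (3 * ℓ)]; gcongr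
    have αβ0 : (0:ℝ) < (1/2) ^ (2 * Λ + 3 * ℓ + 54) := by positivity
    have e1' : 2 * Λ + 57 ≤ e1 := by
      have : 1 ≤ (ℓ + 3) ^ 3 := Nat.one_le_pow _ _ (by omega)
      nlinarith
    obtain ⟨w', hw', h⟩ := success (ε := (1/2) ^ e1) (α := α) (a := (1/2) ^ (3 * ℓ + 9)) X Y Z hc hbx hby hbz ho hβ β0 α0
      (by positivity)
      (by
        have : (1/2:ℝ) ^ e1 ≤ (1/2) ^ (2 * Λ + 54 + 3) := half_le (by omega)
        rw [pow_add _ _ 3] at this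
        have : (0:ℝ) < (1/2) ^ (2 * Λ + 54) := by positivity
        linarith)
      (by
        have h1 : (1/2:ℝ) ^ Λ ≤ 1 := pow_le_one₀ (by norm_num) (by norm_num)
        have h2 : ((1/2:ℝ) ^ e1) ^ 3 ≤ 1 := pow_le_one₀ (by positivity) (pow_le_one₀ (by norm_num) (by norm_num))
        have := mul_le_one₀ h1 (by positivity) h2
        linarith)
      (by positivity)
      (by rw [pow_add]; linarith)
      bad
      (by
        refine hb.trans_le (mul_le_mul_of_nonneg_left ?_ (by positivity))
        rw [show 2 * Λ + 3 * ℓ + 60 = 2 * Λ + 3 * ℓ + 54 + 6 by ring, pow_add _ _ 6]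
        linarith) hT
    refine ⟨w', hw', h.mono le_rfl le_rfl ?_ fun a b c _ h => h⟩
    rw [show 2 * Λ + 3 * ℓ + 62 = 2 * Λ + 3 * ℓ + 54 + 8 by ring, pow_add _ _ 8]
    linarith
end
end Corners

open Finset BigOperators
open scoped Pointwise

namespace Corners
section
variable {G : Type*} [AddCommGroup G] [DecidableEq G] [Fintype G] {N M : ℕ} {τ : ℝ}

lemma RichS.le_one {n : ℕ} {A : G → G → G → Prop} {w : G} {α δ : ℝ}
    (h : RichS N τ M n w α δ A) (δ0 : 0 < δ) : α ≤ 1 := by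
  induction h with
  | base h =>
    obtain ⟨X, Y, Z, P, Q, x, y, -, -, -, -, h5, h6⟩ := h
    exact rich_le_one (n := n) δ0 h5 h6
  | swap _ ih => exact ih
  | rot _ ih => exact ih

lemma RichS.nonempty {n : ℕ} {A : G → G → G → Prop} {w : G} {α δ : ℝ}
    (h : RichS N τ M n w α δ A) (δ0 : 0 < δ) : ∃ x y z, x + y + z = w ∧ A x y z := by
  induction h with
  | base h =>
    obtain ⟨X, Y, Z, P, Q, x, y, -, -, -, -, h5, h6⟩ := h
    by_contra hcon
    push Not at hcon
    have : dn (A0 _ X Y Z) w x y P Q = 0 :=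
      expect_eq_zero fun ξ _ => expect_eq_zero fun υ _ => I_false fun h' =>
        hcon (x + ξ) (y + υ) (w - (x + ξ) - (y + υ)) (by abel) h'.1
    rw [this] at h5
    linarith
  | swap _ ih =>
    obtain ⟨x, y, z, e, h⟩ := ih
    exact ⟨x, z, y, by rw [← e]; abel, h⟩
  | rot _ ih =>
    obtain ⟨x, y, z, e, h⟩ := ih
    exact ⟨z, x, y, by rw [← e]; abel, h⟩

lemma pigeon {C : Type*} [Fintype C] {n : ℕ} {E : G → G → G → Prop} {w : G} {α δ : ℝ}
    (h : RichS N τ M n w α δ E) (f : G → G → G → C) (hC : 0 < Fintype.card C) :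
    ∃ c, RichS N τ M n w (α / Fintype.card C) (δ / Fintype.card C) (fun x y z => E x y z ∧ f x y z = c) := by
  induction h generalizing f with
  | base h =>
    rename_i E
    obtain ⟨X, Y, Z, P, Q, x, y, h1, h2, h3, h4, h5, h6⟩ := h
    have hC' : (0:ℝ) < Fintype.card C := by exact_mod_cast hC
    have hne : (univ : Finset C).Nonempty := univ_nonempty_iff.2 (Fintype.card_pos_iff.1 hC)
    have hs : ∑ _c : C, dn (A0 E X Y Z) w x y P Q / Fintype.card C ≤
        ∑ c : C, dn (A0 (fun x y z => E x y z ∧ f x y z = c) X Y Z) w x y P Q := by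
      rw [sum_const, nsmul_eq_mul, card_univ, mul_div_cancel₀ _ hC'.ne']
      unfold dn
      rw [← expect_sum_comm]
      refine expect_le_expect fun ξ _ => ?_
      rw [← expect_sum_comm]
      refine expect_le_expect fun υ _ => ?_
      obtain ⟨z, hz⟩ : ∃ z, z = w - (x + ξ) - (y + υ) := ⟨_, rfl⟩
      rw [← hz]
      refine le_trans (I_mono ?_) (single_le_sum (f := fun c => I (A0 (fun x y z => E x y z ∧ f x y z = c) X Y Z (x + ξ) (y + υ) z)) (fun c _ => I_nonneg _) (mem_univ (f (x + ξ) (y + υ) z)))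
      exact fun h => ⟨⟨h.1, rfl⟩, h.2⟩
    obtain ⟨c, -, hc⟩ := exists_le_of_sum_le hne hs
    refine ⟨c, .base ⟨X, Y, Z, P, Q, x, y, h1, h2, h3, h4, ?_, ?_⟩⟩
    · exact le_trans (by gcongr) hc
    · refine le_trans ?_ hc
      rw [div_mul_eq_mul_div]
      gcongr
  | swap _ ih =>
    obtain ⟨c, h⟩ := ih (fun a b c => f a c b)
    exact ⟨c, .swap h⟩
  | rot _ ih =>
    obtain ⟨c, h⟩ := ih (fun a b c => f c a b)
    exact ⟨c, .rot h⟩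

lemma iter {n k ℓ L e1 : ℕ} {A : G → G → G → Prop} {w : G}
    (he : 10^6 * (ℓ + 3) ^ 3 * (L + 28) ≤ e1) (τ0 : 0 ≤ τ)
    (hτ : 10^11 * τ ≤ (1/2) ^ L * ((1/2) ^ e1) ^ 3) (hN : 128 ≤ (N:ℝ) * ((1/2) ^ e1) ^ 2)
    (hk : 10^10 ≤ ((k:ℝ) + 1) * ((1/2) ^ L * ((1/2) ^ e1) ^ 3)) (bad : Finset G)
    (hb : 4 * bad.card < M * (1/2 : ℝ) ^ (2 * L + 3 * ℓ + 60)) :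
    ∀ (m Λ : ℕ) (α : ℝ), RichS N τ M (n + m * (7 * (k + 1))) w α ((1/2) ^ Λ) A → (1/2) ^ ℓ ≤ α →
      1 < (1 + (1/2) ^ 21) ^ m * α → Λ + m * (5000 * (ℓ + 3) ^ 2) ≤ L →
      ∃ w', w' ∉ bad ∧ RichS N τ M n w' ((1/2) ^ (3 * ℓ + 9)) ((1/2) ^ (2 * L + 3 * ℓ + 62)) (Tri A w) := by
  intro m
  induction m with
  | zero =>
    intro Λ α h _ h1 _
    have := h.le_one (by positivity)
    rw [pow_zero, one_mul] at h1
    linarith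
  | succ m ih =>
    intro Λ α h hl h1 hL
    obtain ⟨D, hD⟩ : ∃ D, D = 5000 * (ℓ + 3) ^ 2 := ⟨_, rfl⟩
    rw [← hD] at hL
    have hL' : Λ + D + m * D ≤ L := by rw [add_mul, one_mul] at hL; omega
    have hΛ : Λ ≤ L := by omega
    have c1 : (1/2:ℝ) ^ L ≤ (1/2) ^ Λ := half_le hΛ
    have e : n + (m + 1) * (7 * (k + 1)) = n + m * (7 * (k + 1)) + 7 * (k + 1) := by ring
    rw [e] at h
    have α0 : 0 < α := lt_of_lt_of_le (by positivity) hl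
    rcases step h hl (le_trans (by gcongr) he) τ0 (hτ.trans (by gcongr)) hN
      (hk.trans (by gcongr)) bad (hb.trans_le (mul_le_mul_of_nonneg_left (half_le (by omega)) (by positivity)))
      with h | ⟨w', hw', h⟩
    · rw [← hD] at h
      refine ih (Λ + D) _ h (hl.trans ?_) ?_ (by rw [← hD]; exact hL')
      · have : (0:ℝ) < (1/2) ^ 21 := by positivity
        nlinarith
      · rw [pow_succ] at h1; rw [← mul_assoc]; exact h1
    · exact ⟨w', hw', h.mono (by omega) le_rfl (half_le (by omega)) fun a b c _ h => h⟩

lemma stage {n n' k ℓ Λ L e1 : ℕ} {A : G → G → G → Prop} {w : G} (hL : Λ + 2^34 * (ℓ + 3) ^ 3 ≤ L)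
    (he : 10^6 * (ℓ + 3) ^ 3 * (L + 28) ≤ e1) (τ0 : 0 ≤ τ)
    (hτ : 10^11 * τ ≤ (1/2) ^ L * ((1/2) ^ e1) ^ 3) (hN : 128 ≤ (N:ℝ) * ((1/2) ^ e1) ^ 2)
    (hk : 10^10 ≤ ((k:ℝ) + 1) * ((1/2) ^ L * ((1/2) ^ e1) ^ 3)) (bad : Finset G)
    (hb : 4 * bad.card < M * (1/2 : ℝ) ^ (2 * L + 3 * ℓ + 60))
    (h : RichS N τ M n' w ((1/2) ^ ℓ) ((1/2) ^ Λ) A) (hn : n + 2^24 * (ℓ + 3) * (k + 1) ≤ n') :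
    ∃ w', w' ∉ bad ∧ RichS N τ M n w' ((1/2) ^ (3 * ℓ + 9)) ((1/2) ^ (2 * L + 3 * ℓ + 62)) (Tri A w) := by
  obtain ⟨m, hm⟩ : ∃ m, m = (ℓ + 1) * 2097152 := ⟨_, rfl⟩
  have hn2 : n + 16777216 * ((ℓ + 3) * (k + 1)) ≤ n' := by
    rw [← mul_assoc]; norm_num at hn; exact hn
  have hL2 : Λ + 17179869184 * (ℓ + 3) ^ 3 ≤ L := by norm_num at hL; exact hL
  clear hn hL
  have hfu : n + m * (7 * (k + 1)) ≤ n' := by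
    have h1 : m * (7 * (k + 1)) = 14680064 * ((ℓ + 1) * (k + 1)) := by rw [hm]; ring
    rw [h1]
    have : (ℓ + 1) * (k + 1) ≤ (ℓ + 3) * (k + 1) := Nat.mul_le_mul_right _ (by omega)
    generalize (ℓ + 1) * (k + 1) = u at *
    generalize (ℓ + 3) * (k + 1) = v at *
    omega
  refine iter he τ0 hτ hN hk bad hb m Λ _
    (h.mono hfu le_rfl le_rfl fun a b c _ h => h) le_rfl ?_ ?_
  · have b := bern 21 (ℓ + 1) m (le_of_eq (by rw [hm]; norm_num))
    have h0 : (0:ℝ) < (1/2) ^ ℓ := by positivity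
    have h2 : (2:ℝ) ^ (ℓ + 1) * (1/2) ^ ℓ = 2 := by
      rw [pow_succ, mul_assoc, mul_comm 2, ← mul_assoc, ← mul_pow]; norm_num
    have := mul_le_mul_of_nonneg_right b h0.le
    rw [h2] at this
    linarith
  · have h1 : m * (5000 * (ℓ + 3) ^ 2) = 10485760000 * ((ℓ + 1) * (ℓ + 3) ^ 2) := by rw [hm]; ring
    have h2 : (ℓ + 1) * (ℓ + 3) ^ 2 ≤ (ℓ + 3) ^ 3 := by
      rw [pow_succ _ 2, mul_comm]; exact Nat.mul_le_mul_left _ (by omega)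
    rw [h1]
    generalize (ℓ + 1) * (ℓ + 3) ^ 2 = u at *
    generalize (ℓ + 3) ^ 3 = v at *
    omega
end
end Corners

open Finset BigOperators
open scoped Pointwise

namespace Corners
section
variable {G : Type*} [AddCommGroup G] [DecidableEq G] [Fintype G] {N M : ℕ} {τ : ℝ}

lemma tri_closed {A : G → G → G → Prop} {w v x y z : G} (h : Tri (Tri A w) v x y z) :
    Tri A w x y z :=
  ⟨h.1.1, h.2.1.2.1, h.2.2.2.2⟩

lemma tri_mono {A E : G → G → G → Prop} {w x y z : G} (hA : ∀ a b c, A a b c → E a b c)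
    (h : Tri A w x y z) : Tri E w x y z :=
  ⟨hA _ _ _ h.1, hA _ _ _ h.2.1, hA _ _ _ h.2.2⟩

lemma nums {R H K Λ ℓ v : ℕ} (hv : ℓ + R + 3 ≤ H) (hK : K = 68719476736 * H ^ 3)
    (hvv : v = (ℓ + R + 3) ^ 3) :
    2 * (Λ + R + 17179869184 * v) + 3 * (ℓ + R) + 62 + K ≤ 2 * (Λ + K) := by
  have h1 : v ≤ H ^ 3 := by rw [hvv]; exact Nat.pow_le_pow_left hv 3
  have h2 : H ≤ H ^ 3 := Nat.le_self_pow (by norm_num) H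
  generalize H ^ 3 = u at *
  omega

lemma main_ind {C : Type*} [Fintype C] [DecidableEq C] (f : G → G → G → C) {R H K Lm e1 k S : ℕ}
    (hR : Fintype.card C = R) (R1 : 1 ≤ R) (hH : H = 4 ^ R * (R + 3)) (hK : K = 68719476736 * H ^ 3)
    (hLm : Lm = 2 ^ R * K) (he : 10^6 * H ^ 3 * (Lm + 28) ≤ e1) (τ0 : 0 ≤ τ)
    (hτ : 10^11 * τ ≤ (1/2) ^ Lm * ((1/2) ^ e1) ^ 3) (hN : 128 ≤ (N:ℝ) * ((1/2) ^ e1) ^ 2)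
    (hk : 10^10 ≤ ((k:ℝ) + 1) * ((1/2) ^ Lm * ((1/2) ^ e1) ^ 3))
    (hb : 4 * (R:ℝ) < M * (1/2 : ℝ) ^ Lm) (hS : 2^24 * H * (k + 1) ≤ S)
    (NC : ∀ x y z d : G, d ≠ 0 → f (x + d) y z = f x y z → f x (y + d) z = f x y z →
      f x y (z + d) = f x y z → False) :
    ∀ (r : ℕ) (E : G → G → G → Prop) (w : G) (bad : Finset G) (excl : Finset C) (ℓ Λ : ℕ),
      RichS N τ M (r * S) w ((1/2) ^ ℓ) ((1/2) ^ Λ) E →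
      (∀ v x y z, Tri E v x y z → E x y z) →
      (∀ x y z, E x y z → x + y + z ∉ bad → f x y z ∉ excl) →
      w ∉ bad → excl.card + r = R → bad.card ≤ excl.card →
      ℓ + R + 3 ≤ 4 ^ excl.card * (R + 3) → Λ + K ≤ 2 ^ excl.card * K → False := by
  intro r
  induction r with
  | zero =>
    intro E w bad excl ℓ Λ hE _ hav hw hc _ _ _
    obtain ⟨x, y, z, e, h⟩ := hE.nonempty (by positivity)
    refine hav x y z h (by rw [e]; exact hw) ?_
    rw [(card_eq_iff_eq_univ excl).1 (by omega)]
    exact mem_univ _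
  | succ r ih =>
    intro E w bad excl ℓ Λ hE hcl hav hw hc hbad hl hΛ
    have hpow : R < 2 ^ R := Nat.lt_two_pow_self
    have hCR : (0:ℝ) < R := by exact_mod_cast R1
    have hinv : ((1/2:ℝ)) ^ R ≤ 1 / R := by
      rw [one_div_pow]
      exact one_div_le_one_div_of_le hCR (by exact_mod_cast hpow.le)
    have hdiv : ∀ t : ℕ, (1/2:ℝ) ^ (t + R) ≤ (1/2) ^ t / R := by
      intro t
      rw [pow_add _ t R, div_eq_mul_one_div ((1/2:ℝ) ^ t)]
      exact mul_le_mul_of_nonneg_left hinv (by positivity)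
    obtain ⟨c, hA⟩ := pigeon hE f (by omega)
    rw [hR] at hA
    obtain ⟨A, hAdef⟩ : ∃ A : G → G → G → Prop, A = fun x y z => E x y z ∧ f x y z = c := ⟨_, rfl⟩
    rw [← hAdef] at hA
    have hAE : ∀ a b c, A a b c → E a b c := by rw [hAdef]; exact fun a b c h => h.1
    have hAc : ∀ x y z, A x y z → f x y z = c := by rw [hAdef]; exact fun a b c h => h.2
    have hcn : c ∉ excl := by
      obtain ⟨x, y, z, e, h⟩ := hA.nonempty (by positivity)
      have := hav x y z (hAE _ _ _ h) (by rw [e]; exact hw)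
      rwa [hAc _ _ _ h] at this
    have hvH : ℓ + R + 3 ≤ H := by
      rw [hH]; exact hl.trans (Nat.mul_le_mul_right _ (Nat.pow_le_pow_right (by norm_num) (by omega)))
    obtain ⟨v, hv⟩ : ∃ v, v = (ℓ + R + 3) ^ 3 := ⟨_, rfl⟩
    have hnum := nums (Λ := Λ) hvH hK hv
    obtain ⟨L, hLd⟩ : ∃ L, L = Λ + R + 17179869184 * v := ⟨_, rfl⟩
    rw [← hLd] at hnum
    have hstep : 2 * (Λ + K) ≤ 2 ^ (excl.card + 1) * K := by
      rw [pow_succ _ excl.card, mul_comm _ 2, mul_assoc]; exact Nat.mul_le_mul_left _ hΛ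
    have htop : 2 ^ (excl.card + 1) * K ≤ Lm := by
      rw [hLm]; exact Nat.mul_le_mul_right _ (Nat.pow_le_pow_right (by norm_num) (by omega))
    have hLL : 2 * L + 3 * (ℓ + R) + 62 ≤ Lm := by omega
    have hL1 : L ≤ Lm := by omega
    have p1 : (1/2:ℝ) ^ Lm ≤ (1/2) ^ L := half_le hL1
    have hA' : RichS N τ M ((r + 1) * S) w ((1/2) ^ (ℓ + R)) ((1/2) ^ (Λ + R)) A :=
      hA.mono le_rfl (hdiv ℓ) (hdiv Λ) fun a b c _ h => h
    have hbc : (insert w bad).card ≤ R := (card_insert_le _ _).trans (by omega)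
    have hbc' : ((insert w bad).card : ℝ) ≤ R := by exact_mod_cast hbc
    obtain ⟨w', hw', hT⟩ := stage (n := r * S) (L := L) (k := k) (e1 := e1)
      (by rw [← hv, hLd]; norm_num)
      (le_trans (by gcongr) he) τ0 (hτ.trans (by gcongr)) hN (hk.trans (by gcongr)) (insert w bad)
      (lt_of_le_of_lt (by linarith) (hb.trans_le (mul_le_mul_of_nonneg_left (half_le (by omega)) (by positivity))))
      hA' (by
        rw [add_mul r 1 S, one_mul]
        refine Nat.add_le_add_left (le_trans ?_ hS) _
        gcongr)
    have hci : (insert c excl).card = excl.card + 1 := card_insert_of_notMem hcn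
    refine ih (Tri A w) w' (insert w bad) (insert c excl) _ _ hT (fun v x y z => tri_closed) ?_ hw'
      (by omega) ?_ ?_ ?_
    · intro x y z h hs
      rw [mem_insert, not_or] at hs ⊢
      refine ⟨fun hfc => ?_, hav x y z (hcl w x y z (tri_mono hAE h)) hs.2⟩
      refine NC x y z (w - (x + y + z)) (fun h0 => hs.1 (sub_eq_zero.1 h0).symm) ?_ ?_ ?_
      · rw [hfc, show x + (w - (x + y + z)) = w - y - z by abel]; exact hAc _ _ _ h.1
      · rw [hfc, show y + (w - (x + y + z)) = w - x - z by abel]; exact hAc _ _ _ h.2.1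
      · rw [hfc, show z + (w - (x + y + z)) = w - x - y by abel]; exact hAc _ _ _ h.2.2
    · rw [hci]; exact (card_insert_le _ _).trans (by omega)
    · rw [hci, pow_succ _ excl.card, mul_comm _ 4, mul_assoc]
      generalize 4 ^ excl.card * (R + 3) = q at *
      omega
    · rw [hci]; omega

lemma add3 (R : ℕ) (hR : 1 ≤ R) : R + 3 ≤ 4 ^ R := by
  induction R, hR using Nat.le_induction with
  | base => norm_num
  | succ m hm ih => rw [pow_succ]; omega

lemma two_half_pow {a b c : ℕ} (h : a + c ≤ b) : (2:ℝ) ^ c ≤ 2 ^ b * (1/2) ^ a := by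
  obtain ⟨d, rfl⟩ := Nat.exists_eq_add_of_le h
  have h1 : (2:ℝ) ^ (a + c + d) * (1/2) ^ a = 2 ^ (c + d) := by
    rw [show a + c + d = (c + d) + a by ring, pow_add _ (c + d) a, mul_assoc, ← mul_pow]; norm_num
  rw [h1]
  exact pow_le_pow_right₀ (by norm_num) (by omega)

lemma final {C : Type*} [Fintype C] (f : G → G → G → C) (hC : 1 ≤ Fintype.card C)
    (hG : 2 ^ (2 ^ (2 ^ (88 * Fintype.card C))) ≤ Fintype.card G) :
    ∃ x y z d : G, d ≠ 0 ∧ f (x + d) y z = f x y z ∧ f x (y + d) z = f x y z ∧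
      f x y (z + d) = f x y z := by
  classical
  by_contra hcon
  obtain ⟨R, hR⟩ : ∃ R, R = Fintype.card C := ⟨_, rfl⟩
  rw [← hR] at hC hG
  obtain ⟨H, hH⟩ : ∃ H, H = 4 ^ R * (R + 3) := ⟨_, rfl⟩
  obtain ⟨K, hK⟩ : ∃ K, K = 68719476736 * H ^ 3 := ⟨_, rfl⟩
  obtain ⟨Lm, hLm⟩ : ∃ Lm, Lm = 2 ^ R * K := ⟨_, rfl⟩
  obtain ⟨e1, he1⟩ : ∃ e1, e1 = 2 ^ (57 + 25 * R) := ⟨_, rfl⟩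
  obtain ⟨k, hk⟩ : ∃ k, k = 2 ^ (5 * e1) := ⟨_, rfl⟩
  have hR3 : R + 3 ≤ 4 ^ R := by
    exact add3 R hC
  have hH' : H ≤ 2 ^ (4 * R) := by
    rw [hH, pow_mul]
    calc 4 ^ R * (R + 3) ≤ 4 ^ R * 4 ^ R := Nat.mul_le_mul_left _ hR3
      _ = (2 ^ 4) ^ R := by rw [← mul_pow]; norm_num
  have hH3 : H ^ 3 ≤ 2 ^ (12 * R) := by
    calc H ^ 3 ≤ (2 ^ (4 * R)) ^ 3 := Nat.pow_le_pow_left hH' 3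
      _ = _ := by rw [← pow_mul]; congr 1; ring
  have hK' : K ≤ 2 ^ (36 + 12 * R) := by
    rw [hK, pow_add]; exact Nat.mul_le_mul (by norm_num) hH3
  have hLm' : Lm ≤ 2 ^ (36 + 13 * R) := by
    rw [hLm]
    calc 2 ^ R * K ≤ 2 ^ R * 2 ^ (36 + 12 * R) := Nat.mul_le_mul_left _ hK'
      _ = _ := by rw [← pow_add]; congr 1; ring
  have hLm28 : Lm + 28 ≤ 2 ^ (37 + 13 * R) := by
    have h1 : 2 ^ (37 + 13 * R) = 2 ^ (36 + 13 * R) + 2 ^ (36 + 13 * R) := by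
      rw [show 37 + 13 * R = (36 + 13 * R) + 1 by ring, pow_succ]; ring
    have h2 : 2 ^ 5 ≤ 2 ^ (36 + 13 * R) := Nat.pow_le_pow_right (by norm_num) (by omega)
    rw [h1]
    refine Nat.add_le_add hLm' (le_trans (by norm_num) h2)
  have he : 10^6 * H ^ 3 * (Lm + 28) ≤ e1 := by
    rw [he1]
    calc 10^6 * H ^ 3 * (Lm + 28) ≤ 2 ^ 20 * 2 ^ (12 * R) * 2 ^ (37 + 13 * R) :=
          Nat.mul_le_mul (Nat.mul_le_mul (by norm_num) hH3) hLm28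
      _ = _ := by rw [← pow_add, ← pow_add]; congr 1; ring
  have H1 : R ≤ H := by
    rw [hH]
    calc R ≤ 1 * (R + 3) := by omega
      _ ≤ _ := Nat.mul_le_mul_right _ (Nat.one_le_pow _ _ (by norm_num))
  have hHH : H ≤ H ^ 3 := Nat.le_self_pow (by norm_num) H
  have e1big : 1000000 * (Lm + 28) ≤ e1 := by
    refine le_trans ?_ he
    have : 1 ≤ H ^ 3 := by omega
    calc 1000000 * (Lm + 28) = 10 ^ 6 * 1 * (Lm + 28) := by norm_num
      _ ≤ _ := by gcongr
  have e1R : 1000000 * R ≤ e1 := by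
    refine le_trans ?_ he
    calc 1000000 * R = 10 ^ 6 * R * 1 := by norm_num
      _ ≤ _ := Nat.mul_le_mul (Nat.mul_le_mul le_rfl (by omega)) (by omega)
  have hfu : Fuel (2 ^ (8 * e1)) ((1/2) ^ (8 * e1)) (2 ^ (8 * e1)) (2 ^ (8 * e1)) (univ : Finset G) := by
    refine fuel_univ (by omega) (le_trans ?_ hG)
    refine Nat.pow_le_pow_right (by norm_num) (Nat.pow_le_pow_right (by norm_num) ?_)
    calc 6 * (8 * e1) ≤ 2 ^ 6 * e1 := by omega
      _ = 2 ^ (6 + (57 + 25 * R)) := by rw [he1, ← pow_add]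
      _ ≤ _ := Nat.pow_le_pow_right (by norm_num) (by omega)
  have hSf : R * (2^24 * H * (k + 1)) ≤ 2 ^ (8 * e1) := by
    have h1 : k + 1 ≤ 2 ^ (5 * e1 + 1) := by
      rw [hk, pow_succ _ (5 * e1)]
      have : 1 ≤ 2 ^ (5 * e1) := Nat.one_le_two_pow
      generalize 2 ^ (5 * e1) = q at *
      omega
    calc R * (2^24 * H * (k + 1)) ≤ 2 ^ (4 * R) * (2 ^ 24 * 2 ^ (4 * R) * 2 ^ (5 * e1 + 1)) :=
          Nat.mul_le_mul (H1.trans hH') (Nat.mul_le_mul (Nat.mul_le_mul le_rfl hH') h1)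
      _ = 2 ^ (4 * R + (24 + 4 * R + (5 * e1 + 1))) := by simp only [← pow_add]
      _ ≤ _ := Nat.pow_le_pow_right (by norm_num) (by omega)
  have c3 : ((1/2:ℝ) ^ e1) ^ 3 = (1/2) ^ (3 * e1) := by rw [← pow_mul]; congr 1; ring
  have c2 : ((1/2:ℝ) ^ e1) ^ 2 = (1/2) ^ (2 * e1) := by rw [← pow_mul]; congr 1; ring
  refine main_ind (N := 2 ^ (8 * e1)) (M := 2 ^ (8 * e1)) (τ := (1/2) ^ (8 * e1)) f hR.symm hC hH hK hLm he
    (by positivity) (k := k) ?_ ?_ ?_ ?_ (S := 2^24 * H * (k + 1)) le_rfl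
    (fun x y z d h0 h1 h2 h3 => hcon ⟨x, y, z, d, h0, h1, h2, h3⟩) R (fun _ _ _ => True) 0 ∅ ∅ 0 0 ?_
    (fun _ _ _ _ _ => trivial) (by simp) (by simp) (by simp) (by simp) (by simp) (by simp)
  · rw [c3, ← pow_add]
    have h1 : (1/2:ℝ) ^ (8 * e1) ≤ (1/2) ^ (37 + (Lm + 3 * e1)) := half_le (by omega)
    rw [pow_add _ 37] at h1
    have h2 : (0:ℝ) < (1/2) ^ (Lm + 3 * e1) := by positivity
    generalize (1/2:ℝ) ^ (Lm + 3 * e1) = q at *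
    norm_num at h1 ⊢
    linarith
  · rw [c2]; push_cast
    have := two_half_pow (a := 2 * e1) (c := 7) (b := 8 * e1) (by omega)
    refine le_trans (by norm_num) this
  · rw [c3, ← pow_add, hk]; push_cast
    have := two_half_pow (a := Lm + 3 * e1) (c := 34) (b := 5 * e1) (by omega)
    refine le_trans (le_trans (by norm_num) this) (mul_le_mul_of_nonneg_right (by linarith) (by positivity))
  · push_cast
    have := two_half_pow (a := Lm) (c := R + 2) (b := 8 * e1) (by omega)
    refine lt_of_lt_of_le ?_ this
    have h2 : R < 2 ^ R := Nat.lt_two_pow_self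
    have h3 : (R:ℝ) < 2 ^ R := by exact_mod_cast h2
    rw [pow_add _ R 2]
    linarith
  · have hd : ∀ F : G → G → G → Prop, (∀ a b c, F a b c) → dn F 0 0 0 univ univ = 1 := by
      intro F hF
      unfold dn
      have h1 : ∀ ξ υ : G, I (F (0 + ξ) (0 + υ) (0 - (0 + ξ) - (0 + υ))) = 1 := fun _ _ => I_true (hF _ _ _)
      simp only [h1]
      rw [expect_const univ_nonempty, expect_const univ_nonempty]
    refine .base ⟨fun _ => True, fun _ => True, fun _ => True, univ, univ, 0, 0,
      ⟨mem_univ _, fun _ _ => mem_univ _⟩, subset_univ _, ?_, hfu.le hSf, ?_, ?_⟩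
    · unfold Pres
      have h1 : ((univ + (univ + univ) : Finset G).card : ℝ) ≤ (univ : Finset G).card := by
        exact_mod_cast card_le_card (subset_univ _)
      have h2 : (0:ℝ) ≤ (1/2) ^ (8 * e1) * (univ : Finset G).card := by positivity
      rw [add_mul, one_mul]
      exact h1.trans (le_add_of_nonneg_right h2)
    · rw [hd _ fun a b c => ⟨trivial, trivial, trivial, trivial⟩]; norm_num
    · rw [hd (S0 _ _ _) fun a b c => ⟨trivial, trivial, trivial⟩, hd (A0 _ _ _ _) fun a b c => ⟨trivial, trivial, trivial, trivial⟩]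
      norm_num
end
end Corners

theorem coloring_3d_corners :
    ∃ c : ℝ, 0 < c ∧
      ∀ (G : Type*) [Fintype G] [AddCommGroup G] (C : Type*) [Fintype C]
        (f : G × G × G → C),
        1 ≤ Fintype.card C →
        (Fintype.card C : ℝ) ≤
          c * Real.log (Real.log (Real.log (Fintype.card G))) →
        ∃ x y z d : G, d ≠ 0 ∧
          f (x + d, y, z) = f (x, y, z) ∧
          f (x, y + d, z) = f (x, y, z) ∧
          f (x, y, z + d) = f (x, y, z) := by
  refine ⟨1/100, by norm_num, ?_⟩
  intro G _ _ C _ f hC hc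
  classical
  refine Corners.final (fun x y z => f (x, y, z)) hC ?_
  obtain ⟨R, hR⟩ : ∃ R, R = Fintype.card C := ⟨_, rfl⟩
  rw [← hR] at hC hc ⊢
  have hR1 : (1:ℝ) ≤ R := by exact_mod_cast hC
  have hg1 : 1 ≤ Fintype.card G := Fintype.card_pos
  obtain ⟨g, hg⟩ : ∃ g, g = Fintype.card G := ⟨_, rfl⟩
  rw [← hg] at hg1 hc ⊢
  have hlog2 : (0.6931471803:ℝ) < Real.log 2 := Real.log_two_gt_d9
  have hlog2' : Real.log 2 < (0.6931471808:ℝ) := Real.log_two_lt_d9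
  have h3 : 100 * (R:ℝ) ≤ Real.log (Real.log (Real.log g)) := by linarith
  have hlg : Real.log g ≠ 0 := by
    intro h0; rw [h0] at h3; simp at h3; linarith
  have hg2 : 2 ≤ g := by
    by_contra h
    have : g = 1 := by omega
    rw [this] at hlg; simp at hlg
  have hl2 : Real.log 2 ≤ Real.log g := Real.log_le_log (by norm_num) (by exact_mod_cast hg2)
  have hlpos : 0 < Real.log g := by linarith
  have ht1 : -1 ≤ Real.log (Real.log g) := by
    have := Real.one_sub_inv_le_log_of_pos hlpos
    have h5 : (Real.log g)⁻¹ ≤ 2 := by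
      rw [show (2:ℝ) = (1/2)⁻¹ by norm_num]
      exact inv_anti₀ (by norm_num) (by linarith)
    linarith
  have ht : Real.exp (100 * R) ≤ Real.log (Real.log g) := by
    have hne : Real.log (Real.log g) ≠ 0 := by
      intro h0; rw [h0] at h3; simp at h3; linarith
    by_cases hp : 0 < Real.log (Real.log g)
    · exact (Real.le_log_iff_exp_le hp).1 h3
    · exfalso
      have h6 : |Real.log (Real.log g)| ≤ 1 := abs_le.2 ⟨ht1, by linarith⟩
      have h7 := Real.log_nonpos (abs_nonneg _) h6
      rw [Real.log_abs] at h7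
      linarith
  have h8 : Real.exp (Real.exp (100 * R)) ≤ Real.log g := (Real.le_log_iff_exp_le hlpos).1 ht
  have h9 : Real.exp (Real.exp (Real.exp (100 * R))) ≤ g :=
    (Real.le_log_iff_exp_le (by exact_mod_cast hg1)).1 h8
  have key : ∀ (n : ℕ) (x : ℝ), (n:ℝ) ≤ x → (2:ℝ) ^ n ≤ Real.exp x := by
    intro n x h
    have : (2:ℝ) ^ n ≤ Real.exp 1 ^ n := pow_le_pow_left₀ (by norm_num) (by linarith [Real.add_one_le_exp (1:ℝ)]) n
    rw [← Real.exp_nat_mul, mul_one] at this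
    exact this.trans (Real.exp_le_exp.2 h)
  have k1 := key (88 * R) (100 * R) (by push_cast; linarith)
  have k2 := key (2 ^ (88 * R)) _ (by push_cast; exact k1)
  have k3 := key (2 ^ (2 ^ (88 * R))) _ (by push_cast; exact k2)
  exact_mod_cast k3.trans h9
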